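/- arXiv:1410.6111 — 6 statements merged into one kernel-verified Lean document; each statement's English description precedes it below -/
import Mathlib

section
/- Let X be a finite poset which is quasicellular with quasicellular morphism ρ, let M be a homologically admissible Morse matching on the Hasse diagram of X, and for n ≥ 0 let A_n be the set of critical points x of X with ρ(x) = n. Then there exists a chain complex (C_n, d_n) of abelian groups with C_n = ⊕_{x ∈ A_n} H̃^f_{n−1}(Û_x) for n ≥ 0 (and C_n = 0 for n < 0) such that H_n of this chain complex is isomorphic to H^f_n(X) for all n ∈ ℤ. -/
open scoped Classical

universe u

section ChainComplexes

variable (α : Type u) [PartialOrder α]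

/-- The chains of the subposet `S` of `α` (encoded as finsets of `α` contained in `S` that are
totally ordered) having cardinality `n + 1`.  For `n = -1` this contains only the empty chain.
This is the canonical basis of the degree-`n` part of the reduced f-chain complex of `S`. -/
def RChains (S : Set α) (n : ℤ) : Type u :=
  {s : Finset α // (↑s : Set α) ⊆ S ∧ IsChain (· ≤ ·) (↑s : Set α) ∧ (s.card : ℤ) = n + 1}

/-- The degree-`n` part of the reduced f-chain complex of the subposet `S`:
the free abelian group on the chains of `S` of cardinality `n + 1`
(including the empty chain in degree `-1`). -/
abbrev RCgrp (S : Set α) (n : ℤ) : Type u := RChains α S n →₀ ℤ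

/-- The sign `sgn_s(v)`: `(-1) ^ k` where `v` is the `(k+1)`-st smallest element of `s`. -/
noncomputable def chainSgn (s : Finset α) (v : α) : ℤ :=
  (-1) ^ (s.filter fun a => a < v).card

theorem erase_spec {S : Set α} {n : ℤ} {s : Finset α} (hsub : (↑s : Set α) ⊆ S)
    (hch : IsChain (· ≤ ·) (↑s : Set α)) (hcard : (s.card : ℤ) = n + 1) {v : α} (hv : v ∈ s) :
    (↑(s.erase v) : Set α) ⊆ S ∧ IsChain (· ≤ ·) (↑(s.erase v) : Set α) ∧
      ((s.erase v).card : ℤ) = (n - 1) + 1 := by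
  refine ⟨fun x hx => hsub (Finset.coe_subset.mpr (Finset.erase_subset _ _) hx),
    IsChain.mono (Finset.coe_subset.mpr (Finset.erase_subset _ _)) hch, ?_⟩
  rw [Finset.cast_card_erase_of_mem hv, hcard]; ring

/-- The differential of the reduced f-chain complex of the subposet `S`. -/
noncomputable def rd (S : Set α) (n : ℤ) : RCgrp α S n →+ RCgrp α S (n - 1) :=
  ((Finsupp.lift (RCgrp α S (n - 1)) ℤ (RChains α S n)) (fun s =>
    ∑ v ∈ s.1.attach,
      chainSgn α s.1 v.1 •
        Finsupp.single
          (⟨s.1.erase v.1, erase_spec α s.2.1 s.2.2.1 s.2.2.2 v.2⟩ : RChains α S (n - 1))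
          (1 : ℤ))).toAddMonoidHom

/-- The chains of the subposet `S` of cardinality `n + 1` that are not contained in `A`:
the canonical basis of the degree-`n` part of the relative f-chain complex
`C^f(S, A) = C^f(S)/C^f(A)`. -/
def FChains (S A : Set α) (n : ℤ) : Type u :=
  {s : Finset α // (↑s : Set α) ⊆ S ∧ IsChain (· ≤ ·) (↑s : Set α) ∧ (s.card : ℤ) = n + 1 ∧
      ¬(↑s : Set α) ⊆ A}

/-- The degree-`n` part of the relative f-chain complex `C^f(S, A) = C^f(S)/C^f(A)`,
realized as the free abelian group on the chains of `S` not contained in `A`. -/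
abbrev FCgrp (S A : Set α) (n : ℤ) : Type u := FChains α S A n →₀ ℤ

/-- The differential of the relative f-chain complex `C^f(S, A)`. -/
noncomputable def fd (S A : Set α) (n : ℤ) : FCgrp α S A n →+ FCgrp α S A (n - 1) :=
  ((Finsupp.lift (FCgrp α S A (n - 1)) ℤ (FChains α S A n)) (fun s =>
    ∑ v ∈ s.1.attach,
      chainSgn α s.1 v.1 •
        (if h : ¬(↑(s.1.erase v.1) : Set α) ⊆ A then
          Finsupp.single
            (⟨s.1.erase v.1,
              ⟨(erase_spec α s.2.1 s.2.2.1 s.2.2.2.1 v.2).1,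
                (erase_spec α s.2.1 s.2.2.1 s.2.2.2.1 v.2).2.1,
                (erase_spec α s.2.1 s.2.2.1 s.2.2.2.1 v.2).2.2, h⟩⟩ : FChains α S A (n - 1))
            (1 : ℤ)
         else 0))).toAddMonoidHom

end ChainComplexes

section GradedHomology

/-- Transport along an equality of degrees. -/
def castAddEquiv (G : ℤ → Type*) [∀ n, AddCommGroup (G n)] {m n : ℤ} (h : m = n) :
    G m ≃+ G n := by subst h; exact AddEquiv.refl _

/-- The group of `n`-boundaries of a graded group `G` with degree `-1` maps `d`. -/
noncomputable def boundariesOf (G : ℤ → Type*) [∀ n, AddCommGroup (G n)]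
    (d : (n : ℤ) → G n →+ G (n - 1)) (n : ℤ) : AddSubgroup (G n) :=
  AddSubgroup.map (castAddEquiv G (show n + 1 - 1 = n by ring)).toAddMonoidHom (d (n + 1)).range

/-- The `n`-th homology group of a graded abelian group `G` equipped with degree `-1`
homomorphisms `d` (cycles modulo boundaries; when `d ∘ d = 0` this is the usual homology). -/
noncomputable def gradedHomology (G : ℤ → Type*) [∀ n, AddCommGroup (G n)]
    (d : (n : ℤ) → G n →+ G (n - 1)) (n : ℤ) : Type _ :=
  (d n).ker ⧸ ((boundariesOf G d n).addSubgroupOf (d n).ker)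

noncomputable instance (G : ℤ → Type*) [∀ n, AddCommGroup (G n)]
    (d : (n : ℤ) → G n →+ G (n - 1)) (n : ℤ) : AddCommGroup (gradedHomology G d n) :=
  inferInstanceAs (AddCommGroup (_ ⧸ _))

end GradedHomology

section Homology

variable (α : Type u) [PartialOrder α]

/-- The `n`-th reduced f-homology group `H̃^f_n(S)` of the subposet `S`. -/
noncomputable def RH (S : Set α) (n : ℤ) : Type u :=
  gradedHomology (RCgrp α S) (rd α S) n

noncomputable instance (S : Set α) (n : ℤ) : AddCommGroup (RH α S n) :=
  inferInstanceAs (AddCommGroup (gradedHomology _ _ _))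

/-- The `n`-th relative f-homology group `H^f_n(S, A)`. -/
noncomputable def FH (S A : Set α) (n : ℤ) : Type u :=
  gradedHomology (FCgrp α S A) (fd α S A) n

noncomputable instance (S A : Set α) (n : ℤ) : AddCommGroup (FH α S A n) :=
  inferInstanceAs (AddCommGroup (gradedHomology _ _ _))

/-- The `n`-th (unreduced) f-homology group `H^f_n(S)` of the subposet `S`,
i.e. the homology of the complex freely generated by the nonempty chains of `S`. -/
noncomputable def HF (S : Set α) (n : ℤ) : Type u := FH α S ∅ n

noncomputable instance (S : Set α) (n : ℤ) : AddCommGroup (HF α S n) :=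
  inferInstanceAs (AddCommGroup (FH α S ∅ n))

end Homology

/-- `ρ` is a quasicellular morphism for the poset `α`: it is order preserving, its level sets
are antichains, and for every `x` the reduced f-homology of `Û_x = {a | a < x}` is zero in
every degree other than `ρ(x) - 1` and nonzero in degree `ρ(x) - 1`. -/
def IsQuasicellular (α : Type u) [PartialOrder α] (ρ : α → ℕ) : Prop :=
  Monotone ρ ∧ (∀ n : ℕ, IsAntichain (· ≤ ·) {x : α | ρ x = n}) ∧
    ∀ x : α,
      (∀ k : ℤ, k ≠ (ρ x : ℤ) - 1 → Subsingleton (RH α {a | a < x} k)) ∧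
        ¬Subsingleton (RH α {a | a < x} ((ρ x : ℤ) - 1))

/-- `M` is a matching on the Hasse diagram of `α`: a set of edges `(a, b)` (with `b` covering
`a`) such that every element of `α` is incident to at most one edge of `M`. -/
def IsMatching (α : Type u) [PartialOrder α] (M : Set (α × α)) : Prop :=
  (∀ e ∈ M, e.1 ⋖ e.2) ∧
    ∀ (x : α), ∀ e ∈ M, ∀ f ∈ M,
      (x = e.1 ∨ x = e.2) → (x = f.1 ∨ x = f.2) → e = f

/-- The edge relation of the directed graph `H_M(X)` obtained from the Hasse diagram by
orienting the edges of `M` upwards and all other edges downwards. -/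
def MorseStep {α : Type u} [PartialOrder α] (M : Set (α × α)) (u v : α) : Prop :=
  (u, v) ∈ M ∨ (v ⋖ u ∧ (v, u) ∉ M)

/-- `M` is a Morse matching: a matching such that `H_M(X)` has no directed cycles. -/
def IsMorseMatching (α : Type u) [PartialOrder α] (M : Set (α × α)) : Prop :=
  IsMatching α M ∧ ∀ x : α, ¬Relation.TransGen (MorseStep M) x x

/-- `x` is a critical point of the matching `M`: it is incident to no edge of `M`. -/
def IsCritical {α : Type u} [PartialOrder α] (M : Set (α × α)) (x : α) : Prop :=
  ∀ e ∈ M, x ≠ e.1 ∧ x ≠ e.2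

/-- Every edge `(a, b)` of `M` is homologically admissible, i.e. `Û_b ∖ {a}` has trivial
reduced f-homology in every degree. -/
def IsHomologicallyAdmissible (α : Type u) [PartialOrder α] (M : Set (α × α)) : Prop :=
  ∀ e ∈ M, ∀ k : ℤ, Subsingleton (RH α ({y | y < e.2} \ {e.1}) k)


section Alg

theorem hlp_clsMap {V : Type*} [AddCommGroup V] (δ : V →+ V)
    (G : ℤ → Type*) [∀ n, AddCommGroup (G n)] (d : (n : ℤ) → G n →+ G (n - 1))
    (ι : ∀ n, G n →+ V) (C : ℤ → AddSubgroup V)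
    (inj : ∀ n, Function.Injective (ι n)) (hC : ∀ n z, z ∈ C n ↔ ∃ x, ι n x = z)
    (comm : ∀ n x, ι (n - 1) (d n x) = δ (ι n x)) (n : ℤ) :
    ∃ π : (C n ⊓ δ.ker : AddSubgroup V) →+ gradedHomology G d n,
      Function.Surjective π ∧ ∀ z, π z = 0 ↔ ∃ w ∈ C (n + 1), δ w = z := by
  have hcast : ∀ (m k : ℤ) (h : m = k) (x : G m), ι k (castAddEquiv G h x) = ι m x := by
    intro m k h x; subst h; rfl
  have hb : ∀ x : G n, x ∈ boundariesOf G d n ↔ ∃ w ∈ C (n + 1), δ w = ι n x := by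
    intro x
    constructor
    · rintro ⟨_, ⟨w, rfl⟩, rfl⟩
      refine ⟨ι (n+1) w, (hC _ _).2 ⟨w, rfl⟩, ?_⟩
      rw [← comm]
      exact (hcast _ _ _ _).symm
    · rintro ⟨w, hw, h⟩
      obtain ⟨w, rfl⟩ := (hC _ _).1 hw
      refine ⟨_, ⟨w, rfl⟩, inj n ?_⟩
      rw [← h, ← comm]
      exact hcast _ _ _ _
  have key : ∀ z : (C n ⊓ δ.ker : AddSubgroup V), ∃ x : (d n).ker, ι n x = z := by
    rintro ⟨z, hz, hz'⟩
    obtain ⟨x, rfl⟩ := (hC _ _).1 hz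
    refine ⟨⟨x, ?_⟩, rfl⟩
    rw [AddMonoidHom.mem_ker]
    apply inj
    rw [comm, map_zero]; exact hz'
  choose s hs using key
  let S : (C n ⊓ δ.ker : AddSubgroup V) →+ (d n).ker :=
    AddMonoidHom.mk' s (by
      intro a b
      apply Subtype.ext
      apply inj
      simp [hs])
  refine ⟨(QuotientAddGroup.mk' ((boundariesOf G d n).addSubgroupOf (d n).ker)).comp S, ?_, ?_⟩
  · intro q
    obtain ⟨x, rfl⟩ := QuotientAddGroup.mk'_surjective _ q
    refine ⟨⟨ι n x, (hC _ _).2 ⟨_, rfl⟩, ?_⟩, ?_⟩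
    · show δ _ = 0
      rw [← comm, x.2, map_zero]
    · refine congrArg (QuotientAddGroup.mk' ((boundariesOf G d n).addSubgroupOf (d n).ker)) ?_
      apply Subtype.ext
      apply inj
      exact hs _
  · intro z
    have : ((QuotientAddGroup.mk' ((boundariesOf G d n).addSubgroupOf (d n).ker)).comp S) z = 0 ↔
        S z ∈ (boundariesOf G d n).addSubgroupOf (d n).ker := by
      rw [AddMonoidHom.comp_apply]
      exact QuotientAddGroup.eq_zero_iff _
    refine this.trans ?_
    rw [AddSubgroup.mem_addSubgroupOf, hb]
    have : ι n (S z) = z := hs z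
    rw [this]

theorem hlp_homIso {V : Type*} [AddCommGroup V] (δ : V →+ V)
    (G : ℤ → Type*) [∀ n, AddCommGroup (G n)] (d : (n : ℤ) → G n →+ G (n - 1))
    (ι : ∀ n, G n →+ V) (C : ℤ → AddSubgroup V)
    (inj : ∀ n, Function.Injective (ι n)) (hC : ∀ n z, z ∈ C n ↔ ∃ x, ι n x = z)
    (comm : ∀ n x, ι (n - 1) (d n x) = δ (ι n x))
    (G' : ℤ → Type*) [∀ n, AddCommGroup (G' n)] (d' : (n : ℤ) → G' n →+ G' (n - 1))
    (ι' : ∀ n, G' n →+ V) (C' : ℤ → AddSubgroup V)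
    (inj' : ∀ n, Function.Injective (ι' n)) (hC' : ∀ n z, z ∈ C' n ↔ ∃ x, ι' n x = z)
    (comm' : ∀ n x, ι' (n - 1) (d' n x) = δ (ι' n x)) (hδ : ∀ v, δ (δ v) = 0)
    (hle : ∀ n, C n ≤ C' n) (n : ℤ)
    (hsurj : ∀ z ∈ C' n, δ z = 0 → ∃ w ∈ C' (n + 1), z - δ w ∈ C n)
    (hinj : ∀ w ∈ C' (n + 1), δ w ∈ C n → ∃ w' ∈ C (n + 1), δ w' = δ w) :
    Nonempty (gradedHomology G d n ≃+ gradedHomology G' d' n) := by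
  obtain ⟨π, hπ, hk⟩ := hlp_clsMap δ G d ι C inj hC comm n
  obtain ⟨π', hπ', hk'⟩ := hlp_clsMap δ G' d' ι' C' inj' hC' comm' n
  let i : (C n ⊓ δ.ker : AddSubgroup V) →+ (C' n ⊓ δ.ker : AddSubgroup V) :=
    AddSubgroup.inclusion (inf_le_inf_right _ (hle n))
  have hs : Function.Surjective (π'.comp i) := by
    intro q
    obtain ⟨⟨z, hz, hz'⟩, rfl⟩ := hπ' q
    obtain ⟨w, hw, hzw⟩ := hsurj z hz hz'
    refine ⟨⟨z - δ w, hzw, ?_⟩, ?_⟩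
    · show δ _ = 0
      rw [map_sub, hδ, sub_zero]; exact hz'
    · rw [AddMonoidHom.comp_apply, ← sub_eq_zero, ← map_sub, hk']
      refine ⟨-w, neg_mem hw, ?_⟩
      simp [i]
  have hker : π.ker = (π'.comp i).ker := by
    ext z
    rw [AddMonoidHom.mem_ker, AddMonoidHom.mem_ker, AddMonoidHom.comp_apply, hk, hk']
    constructor
    · rintro ⟨w, hw, h⟩
      exact ⟨w, hle _ hw, h⟩
    · rintro ⟨w, hw, h⟩
      have h2 : δ w = z := h
      obtain ⟨w', hw', h'⟩ := hinj w hw (h2 ▸ z.2.1)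
      exact ⟨w', hw', h'.trans h2⟩
  exact ⟨(QuotientAddGroup.quotientKerEquivOfSurjective π hπ).symm.trans
    ((QuotientAddGroup.quotientAddEquivOfEq hker).trans
      (QuotientAddGroup.quotientKerEquivOfSurjective _ hs))⟩

end Alg

set_option linter.unusedSectionVars false

section Ops

variable {α : Type u} [PartialOrder α]

/-- sign -/
noncomputable def hlpS (t : Finset α) (u : α) : ℤ :=
  (-1) ^ (t.filter fun a => toLinearExtension a < toLinearExtension u).card

theorem hlpS_sq (t : Finset α) (u : α) : hlpS t u * hlpS t u = 1 := by
  unfold hlpS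
  rw [← mul_pow]; simp

theorem hlpS_insert_self (t : Finset α) (u : α) : hlpS (insert u t) u = hlpS t u := by
  unfold hlpS
  rw [Finset.filter_insert]; simp

theorem hlpS_erase_self (t : Finset α) (u : α) : hlpS (t.erase u) u = hlpS t u := by
  unfold hlpS
  congr 2
  ext a
  simp only [Finset.mem_filter, Finset.mem_erase]
  constructor
  · rintro ⟨⟨_, h⟩, h'⟩; exact ⟨h, h'⟩
  · rintro ⟨h, h'⟩
    refine ⟨⟨?_, h⟩, h'⟩
    rintro rfl
    exact lt_irrefl _ h'

/-- auxiliary sign -/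
noncomputable def hlpE (u v : α) : ℤ :=
  if toLinearExtension u < toLinearExtension v then -1 else 1

theorem hlpE_sq (u v : α) : hlpE u v * hlpE u v = 1 := by
  unfold hlpE; split_ifs <;> simp

theorem hlpE_anti {u v : α} (h : u ≠ v) : hlpE u v = - hlpE v u := by
  have h' : (toLinearExtension u : LinearExtension α) ≠ toLinearExtension v := h
  unfold hlpE
  rcases lt_or_gt_of_ne h' with h1 | h1
  · simp [h1, not_lt_of_gt h1]
  · simp [h1, not_lt_of_gt h1]

theorem hlpS_insert {t : Finset α} {u : α} (v : α) (hu : u ∉ t) :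
    hlpS (insert u t) v = hlpE u v * hlpS t v := by
  unfold hlpS hlpE
  rw [Finset.filter_insert]
  split_ifs with h
  · rw [Finset.card_insert_of_notMem (by simp [hu]), pow_succ]; ring
  · simp

theorem hlpS_erase {t : Finset α} {u : α} (v : α) (hu : u ∈ t) :
    hlpS (t.erase u) v = hlpE u v * hlpS t v := by
  have := hlpS_insert v (Finset.notMem_erase u t)
  rw [Finset.insert_erase hu] at this
  rw [this, ← mul_assoc, hlpE_sq, one_mul]

/-- contraction -/
noncomputable def hlpLk (u : α) : (Finset α → ℤ) →+ (Finset α → ℤ) where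
  toFun f t := if u ∈ t then 0 else hlpS t u * f (insert u t)
  map_zero' := by ext t; simp
  map_add' f g := by ext t; simp only [Pi.add_apply]; split_ifs <;> ring

/-- insertion -/
noncomputable def hlpIns (u : α) : (Finset α → ℤ) →+ (Finset α → ℤ) where
  toFun f t := if u ∈ t then hlpS t u * f (t.erase u) else 0
  map_zero' := by ext t; simp
  map_add' f g := by ext t; simp only [Pi.add_apply]; split_ifs <;> ring

theorem hlpLk_apply (u : α) (f : Finset α → ℤ) (t : Finset α) :
    hlpLk u f t = if u ∈ t then 0 else hlpS t u * f (insert u t) := rfl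

theorem hlpIns_apply (u : α) (f : Finset α → ℤ) (t : Finset α) :
    hlpIns u f t = if u ∈ t then hlpS t u * f (t.erase u) else 0 := rfl

theorem hlpLk_lk (u v : α) (f : Finset α → ℤ) :
    hlpLk u (hlpLk v f) + hlpLk v (hlpLk u f) = 0 := by
  ext t
  simp only [Pi.add_apply, hlpLk_apply, Pi.zero_apply]
  by_cases huv : u = v
  · subst huv; simp
  by_cases hu : u ∈ t
  · simp [hu]
  by_cases hv : v ∈ t
  · simp [hv]
  have h1 : v ∉ insert u t := by simp [hv, Ne.symm huv]
  have h2 : u ∉ insert v t := by simp [hu, huv]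
  simp only [hu, hv, h1, h2, if_false]
  rw [hlpS_insert v hu, hlpS_insert u hv, Finset.insert_comm u v, hlpE_anti huv]
  ring

theorem hlpLk_ins_self (u : α) (f : Finset α → ℤ) :
    hlpLk u (hlpIns u f) + hlpIns u (hlpLk u f) = f := by
  ext t
  simp only [Pi.add_apply, hlpLk_apply, hlpIns_apply]
  by_cases hu : u ∈ t
  · simp only [hu, if_true, Finset.notMem_erase, if_false, hlpS_erase_self, Finset.insert_erase hu]
    rw [← mul_assoc, hlpS_sq]; ring
  · simp only [hu, if_false, Finset.mem_insert_self, if_true, Finset.erase_insert hu,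
      hlpS_insert_self]
    rw [← mul_assoc, hlpS_sq]; ring

theorem hlpLk_ins {u v : α} (huv : u ≠ v) (f : Finset α → ℤ) :
    hlpLk u (hlpIns v f) + hlpIns v (hlpLk u f) = 0 := by
  ext t
  simp only [Pi.add_apply, hlpLk_apply, hlpIns_apply, Pi.zero_apply]
  by_cases hu : u ∈ t
  · simp [hu, huv]
  by_cases hv : v ∈ t
  · have h1 : v ∈ insert u t := by simp [hv]
    have h2 : u ∉ t.erase v := by simp [hu]
    simp only [hu, hv, h1, h2, if_false, if_true]
    rw [hlpS_insert v hu, hlpS_erase u hv, Finset.erase_insert_of_ne huv, hlpE_anti huv]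
    ring
  · have h1 : v ∉ insert u t := by simp [hv, Ne.symm huv]
    simp [hv, h1]

variable [Fintype α]

/-- boundary -/
noncomputable def hlpD : (Finset α → ℤ) →+ (Finset α → ℤ) := ∑ u, hlpLk u

theorem hlpD_apply (f : Finset α → ℤ) : hlpD f = ∑ u, hlpLk u f := by
  simp [hlpD]

theorem hlpLk_D (v : α) (f : Finset α → ℤ) : hlpLk v (hlpD f) = - hlpD (hlpLk v f) := by
  rw [eq_neg_iff_add_eq_zero, hlpD_apply, hlpD_apply, map_sum, ← Finset.sum_add_distrib]
  exact Finset.sum_eq_zero fun u _ => hlpLk_lk v u f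

theorem hlpD_D (f : Finset α → ℤ) : hlpD (hlpD f) = 0 := by
  have h : hlpD (hlpD f) = - hlpD (hlpD f) := by
    conv_lhs => rw [hlpD_apply (hlpD f)]
    simp only [hlpLk_D]
    rw [Finset.sum_neg_distrib, ← map_sum, ← hlpD_apply]
  ext t
  have := congrFun h t
  simp only [Pi.neg_apply, Pi.zero_apply] at *
  omega

theorem hlpD_ins (v : α) (f : Finset α → ℤ) : hlpD (hlpIns v f) = f - hlpIns v (hlpD f) := by
  rw [eq_sub_iff_add_eq, hlpD_apply, hlpD_apply, map_sum, ← Finset.sum_add_distrib,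
    Finset.sum_eq_single v]
  · exact hlpLk_ins_self v f
  · intro u _ h; exact hlpLk_ins h f
  · simp

/-- chains of degree k in S -/
def hlpCh (S : Set α) (k : ℤ) : AddSubgroup (Finset α → ℤ) where
  carrier := {f | ∀ s, f s ≠ 0 → (↑s : Set α) ⊆ S ∧ IsChain (· ≤ ·) (↑s : Set α) ∧ (s.card : ℤ) = k + 1}
  zero_mem' := by intro s h; simp at h
  add_mem' := by
    intro f g hf hg s h
    by_cases h1 : f s = 0
    · apply hg; intro h2; simp [h1, h2] at h
    · exact hf s h1
  neg_mem' := by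
    intro f hf s h
    exact hf s (by simpa using h)

theorem hlpCh_mono {S T : Set α} (h : S ⊆ T) (k : ℤ) : hlpCh S k ≤ hlpCh T k :=
  fun _ hf s hs => ⟨(hf s hs).1.trans h, (hf s hs).2⟩

/-- the link of v in S -/
theorem hlpLk_mem {S T : Set α} {k : ℤ} {v : α} {f : Finset α → ℤ} (hf : f ∈ hlpCh S k)
    (hT : ∀ y ∈ S, y < v ∨ v < y → y ∈ T) : hlpLk v f ∈ hlpCh T (k - 1) := by
  intro s hs
  rw [hlpLk_apply] at hs
  split_ifs at hs with hv
  · exact absurd rfl hs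
  obtain ⟨h1, h2, h3⟩ := hf _ (right_ne_zero_of_mul hs)
  refine ⟨?_, h2.mono (by simp), ?_⟩
  · intro y hy
    have hyv : y ≠ v := by rintro rfl; exact hv hy
    refine hT y (h1 (by simp [Finset.mem_coe.1 hy])) ?_
    rcases h2 (x := y) (by simp [Finset.mem_coe.1 hy]) (y := v) (by simp) hyv with h | h
    · exact Or.inl (lt_of_le_of_ne h hyv)
    · exact Or.inr (lt_of_le_of_ne h hyv.symm)
  · rw [Finset.card_insert_of_notMem hv] at h3
    push_cast at h3; linarith

theorem hlpD_mem {S : Set α} {k : ℤ} {f : Finset α → ℤ} (hf : f ∈ hlpCh S k) :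
    hlpD f ∈ hlpCh S (k - 1) := by
  rw [hlpD_apply]
  exact sum_mem fun u _ => hlpLk_mem hf (fun y hy _ => hy)

theorem hlpLk_eq_zero {S : Set α} {k : ℤ} {v : α} {f : Finset α → ℤ} (hf : f ∈ hlpCh S k)
    (hv : v ∉ S) : hlpLk v f = 0 := by
  ext s
  rw [hlpLk_apply]
  split_ifs with h
  · rfl
  · rw [Pi.zero_apply, mul_eq_zero]
    right
    by_contra h0
    exact hv ((hf _ h0).1 (by simp))

/-- insertion stays in chains -/
theorem hlpIns_mem {S T : Set α} {k : ℤ} {v : α} {f : Finset α → ℤ} (hf : f ∈ hlpCh S k)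
    (hS : ∀ y ∈ S, y ≤ v ∨ v ≤ y) (hvT : v ∈ T) (hST : S ⊆ T) : hlpIns v f ∈ hlpCh T (k + 1) := by
  intro s hs
  rw [hlpIns_apply] at hs
  split_ifs at hs with hv
  swap
  · exact absurd rfl hs
  obtain ⟨h1, h2, h3⟩ := hf _ (right_ne_zero_of_mul hs)
  rw [← Finset.insert_erase hv]
  refine ⟨?_, ?_, ?_⟩
  · rw [Finset.coe_insert]
    exact Set.insert_subset hvT (h1.trans hST)
  · rw [Finset.coe_insert]
    refine h2.insert ?_
    intro b hb _
    exact (hS b (h1 hb)).symm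
  · rw [Finset.card_insert_of_notMem (by simp)]
    push_cast; linarith

theorem hlpIns_lk_apply (v : α) (f : Finset α → ℤ) (t : Finset α) :
    hlpIns v (hlpLk v f) t = if v ∈ t then f t else 0 := by
  rw [hlpIns_apply]
  split_ifs with h
  · rw [hlpLk_apply, if_neg (by simp), Finset.insert_erase h, hlpS_erase_self, ← mul_assoc,
      hlpS_sq, one_mul]
  · rfl

/-- acyclicity -/
def hlpAc (L : Set α) (k : ℤ) : Prop :=
  ∀ f ∈ hlpCh L k, hlpD f = 0 → ∃ g ∈ hlpCh L (k + 1), hlpD g = f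

/-- relative acyclicity -/
def hlpR (B A : Set α) (k : ℤ) : Prop :=
  ∀ f ∈ hlpCh B k, hlpD f ∈ hlpCh A (k - 1) → ∃ g ∈ hlpCh B (k + 1), f - hlpD g ∈ hlpCh A k

theorem hlpR_refl (A : Set α) (k : ℤ) : hlpR A A k :=
  fun f hf _ => ⟨0, zero_mem _, by simpa using hf⟩

theorem hlpR_trans {C B A : Set α} {k : ℤ} (hCB : B ⊆ C) (hBA : A ⊆ B)
    (h1 : hlpR C B k) (h2 : hlpR B A k) : hlpR C A k := by
  intro f hf hd
  obtain ⟨g, hg, h⟩ := h1 f hf (hlpCh_mono hBA _ hd)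
  obtain ⟨g', hg', h'⟩ := h2 _ h (by rw [map_sub, hlpD_D, sub_zero]; exact hd)
  refine ⟨g + g', add_mem hg (hlpCh_mono hCB _ hg'), ?_⟩
  rw [map_add, ← sub_sub]; exact h'

theorem hlpR_insert {Y : Set α} {v : α} (hv : v ∉ Y) {k : ℤ}
    (hac : hlpAc {y | y ∈ Y ∧ (y < v ∨ v < y)} (k - 1)) : hlpR (insert v Y) Y k := by
  intro f hf hd
  have h1 : hlpLk v f ∈ hlpCh {y | y ∈ Y ∧ (y < v ∨ v < y)} (k - 1) := by
    refine hlpLk_mem hf ?_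
    rintro y (rfl | hy) h
    · exact absurd h (by simp)
    · exact ⟨hy, h⟩
  have h2 : hlpD (hlpLk v f) = 0 := by
    have := hlpLk_D v f
    rw [hlpLk_eq_zero hd hv] at this
    exact neg_eq_zero.1 this.symm
  obtain ⟨g, hg, hg'⟩ := hac _ h1 h2
  rw [sub_add_cancel] at hg
  refine ⟨-hlpIns v g, neg_mem (hlpIns_mem hg ?_ (by simp) ?_), ?_⟩
  · rintro y ⟨_, h | h⟩
    · exact Or.inl h.le
    · exact Or.inr h.le
  · rintro y ⟨h, _⟩; exact Or.inr h
  · rw [map_neg, hlpD_ins, hg']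
    have : f - -(g - hlpIns v (hlpLk v f)) = (f - hlpIns v (hlpLk v f)) + g := by abel
    rw [this]
    refine add_mem ?_ (hlpCh_mono (fun y hy => hy.1) _ hg)
    intro s hs
    rw [Pi.sub_apply, hlpIns_lk_apply] at hs
    split_ifs at hs with h
    · simp at hs
    · rw [sub_zero] at hs
      obtain ⟨h1, h2⟩ := hf s hs
      refine ⟨fun y hy => (h1 hy).resolve_left ?_, h2⟩
      rintro rfl
      exact h hy

theorem hlpAc_cone {L : Set α} {b : α} (hb : b ∈ L) (h : ∀ y ∈ L, y ≤ b ∨ b ≤ y) (k : ℤ) :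
    hlpAc L k := by
  intro f hf hd
  refine ⟨hlpIns b f, hlpIns_mem hf h hb subset_rfl, ?_⟩
  rw [hlpD_ins, hd, map_zero, sub_zero]

end Ops

section Transport

variable {α : Type u} [PartialOrder α]

/-- realization of formal sums as functions -/
noncomputable def hlpI {T : Type u} (p : T → Finset α) : (T →₀ ℤ) →+ (Finset α → ℤ) :=
  Finsupp.coeFnAddHom.comp (Finsupp.mapDomain.addMonoidHom p)

theorem hlpI_apply {T : Type u} (p : T → Finset α) (f : T →₀ ℤ) :
    hlpI p f = ⇑(Finsupp.mapDomain p f) := rfl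

theorem hlpI_inj {T : Type u} {p : T → Finset α} (hp : Function.Injective p) :
    Function.Injective (hlpI p) := by
  intro f g h
  rw [hlpI_apply, hlpI_apply] at h
  exact Finsupp.mapDomain_injective hp (DFunLike.coe_injective h)

theorem hlpI_single {T : Type u} (p : T → Finset α) (t : T) (c : ℤ) :
    hlpI p (Finsupp.single t c) = Pi.single (p t) c := by
  rw [hlpI_apply, Finsupp.mapDomain_single, Finsupp.single_eq_pi_single]

theorem hlpLk_single (u : α) (s : Finset α) :
    hlpLk u (Pi.single s 1) = if u ∈ s then hlpS s u • Pi.single (s.erase u) 1 else 0 := by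
  ext t
  rw [hlpLk_apply]
  by_cases hs : u ∈ s
  · rw [if_pos hs]
    by_cases ht : u ∈ t
    · rw [if_pos ht, Pi.smul_apply, Pi.single_apply, if_neg, smul_zero]
      rintro rfl; simp at ht
    · rw [if_neg ht, Pi.smul_apply, Pi.single_apply, Pi.single_apply]
      by_cases h : insert u t = s
      · have h' : t = s.erase u := by rw [← h, Finset.erase_insert ht]
        rw [if_pos h, if_pos h', h', hlpS_erase_self]; rfl
      · have h' : t ≠ s.erase u := by
          rintro rfl; exact h (Finset.insert_erase hs)
        rw [if_neg h, if_neg h']; simp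
  · rw [if_neg hs]
    split_ifs with ht
    · rfl
    · rw [Pi.single_apply, if_neg]
      · simp
      · rintro rfl; simp at hs

theorem hlpS_chain {s : Finset α} (hs : IsChain (· ≤ ·) (↑s : Set α)) {v : α} (hv : v ∈ s) :
    chainSgn α s v = hlpS s v := by
  unfold chainSgn hlpS
  congr 2
  ext a
  simp only [Finset.mem_filter, and_congr_right_iff]
  intro ha
  constructor
  · intro h
    exact lt_of_le_of_ne (toLinearExtension.monotone h.le) (fun h' => h.ne h')
  · intro h
    have hne : a ≠ v := by rintro rfl; exact lt_irrefl _ h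
    rcases hs ha hv hne with h' | h'
    · exact lt_of_le_of_ne h' hne
    · exact absurd (toLinearExtension.monotone h') (not_le_of_gt h)

/-- truncation -/
noncomputable def hlpT : (Finset α → ℤ) →+ (Finset α → ℤ) where
  toFun f t := if t = ∅ then 0 else f t
  map_zero' := by ext t; simp
  map_add' f g := by ext t; simp only [Pi.add_apply]; split_ifs <;> ring

theorem hlpT_apply (f : Finset α → ℤ) (t : Finset α) : hlpT f t = if t = ∅ then 0 else f t := rfl

theorem hlpT_single (s : Finset α) (c : ℤ) :
    hlpT (Pi.single s c) = if s = ∅ then 0 else Pi.single s c := by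
  ext t
  rw [hlpT_apply]
  by_cases hs : s = ∅
  · subst hs
    by_cases ht : t = ∅ <;> simp [ht]
  · by_cases ht : t = ∅
    · subst ht; simp [hs, Ne.symm hs]
    · simp [hs, ht]

theorem hlpLk_T (u : α) (f : Finset α → ℤ) : hlpLk u (hlpT f) = hlpLk u f := by
  ext t
  simp [hlpLk_apply, hlpT_apply]

variable [Fintype α]

theorem hlpD_T (f : Finset α → ℤ) : hlpD (hlpT f) = hlpD f := by
  simp [hlpD_apply, hlpLk_T]

theorem hlpT_mem {S : Set α} {k : ℤ} {f : Finset α → ℤ} (hf : f ∈ hlpCh S k) :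
    hlpT f ∈ hlpCh S k := by
  intro s hs
  rw [hlpT_apply] at hs
  split_ifs at hs
  · exact absurd rfl hs
  · exact hf s hs

/-- truncated boundary -/
noncomputable def hlpTD : (Finset α → ℤ) →+ (Finset α → ℤ) := hlpT.comp hlpD

theorem hlpTD_apply (f : Finset α → ℤ) : hlpTD f = hlpT (hlpD f) := rfl

theorem hlpTD_TD (f : Finset α → ℤ) : hlpTD (hlpTD f) = 0 := by
  rw [hlpTD_apply, hlpTD_apply, hlpD_T, hlpD_D, map_zero]

theorem hlpD_single (s : Finset α) :
    hlpD (Pi.single s 1) = ∑ v ∈ s.attach, hlpS s v.1 • (Pi.single (s.erase v.1) 1 : Finset α → ℤ) := by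
  rw [hlpD_apply]
  simp only [hlpLk_single]
  rw [Finset.sum_ite_mem, Finset.univ_inter]
  exact (Finset.sum_attach s (fun v => hlpS s v • (Pi.single (s.erase v) 1 : Finset α → ℤ))).symm

theorem hlpI_rd (S : Set α) (n : ℤ) (f : RCgrp α S n) :
    hlpI (fun s : RChains α S (n - 1) => s.1) (rd α S n f) =
      hlpD (hlpI (fun s : RChains α S n => s.1) f) := by
  have : (hlpI (fun s : RChains α S (n - 1) => s.1)).comp (rd α S n) =
      hlpD.comp (hlpI (fun s : RChains α S n => s.1)) := by
    ext s : 2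
    simp only [AddMonoidHom.comp_apply, Finsupp.singleAddHom_apply]
    rw [hlpI_single, hlpD_single, rd]
    simp only [LinearMap.toAddMonoidHom_coe, Finsupp.lift_apply, Finsupp.sum_single_index, zero_smul,
      one_smul]
    refine (map_sum (hlpI (fun s : RChains α S (n - 1) => s.1)) _ _).trans ?_
    refine Finset.sum_congr rfl fun v _ => ?_
    rw [hlpS_chain s.2.2.1 v.2]
    refine (map_zsmul (hlpI (fun s : RChains α S (n - 1) => s.1)) _ _).trans ?_
    congr 1
    exact hlpI_single _ _ _
  exact DFunLike.congr_fun this f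

theorem hlpI_fd (n : ℤ) (f : FCgrp α Set.univ ∅ n) :
    hlpI (fun s : FChains α Set.univ ∅ (n - 1) => s.1) (fd α Set.univ ∅ n f) =
      hlpTD (hlpI (fun s : FChains α Set.univ ∅ n => s.1) f) := by
  have : (hlpI (fun s : FChains α Set.univ ∅ (n - 1) => s.1)).comp (fd α Set.univ ∅ n) =
      hlpTD.comp (hlpI (fun s : FChains α Set.univ ∅ n => s.1)) := by
    ext s : 2
    simp only [AddMonoidHom.comp_apply, Finsupp.singleAddHom_apply]
    rw [hlpI_single, hlpTD_apply, hlpD_single, fd]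
    simp only [LinearMap.toAddMonoidHom_coe, Finsupp.lift_apply, Finsupp.sum_single_index, zero_smul,
      one_smul]
    refine (map_sum (hlpI (fun s : FChains α Set.univ ∅ (n - 1) => s.1)) _ _).trans ?_
    rw [map_sum]
    refine Finset.sum_congr rfl fun v _ => ?_
    rw [hlpS_chain s.2.2.1 v.2]
    refine (map_zsmul (hlpI (fun s : FChains α Set.univ ∅ (n - 1) => s.1)) _ _).trans ?_
    rw [map_zsmul, hlpT_single]
    congr 1
    by_cases h : s.1.erase v.1 = ∅
    · rw [if_pos h, dif_neg]
      · exact map_zero (hlpI (fun s : FChains α Set.univ ∅ (n - 1) => s.1))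
      · rw [h]; simp
    · rw [if_neg h, dif_pos]
      · exact hlpI_single _ _ _
      · exact fun h2 => h (Finset.coe_eq_empty.1 (Set.subset_empty_iff.1 h2))
  exact DFunLike.congr_fun this f

theorem hlpI_range {T : Type u} {p : T → Finset α} (hp : Function.Injective p)
    (z : Finset α → ℤ) : (∃ x, hlpI p x = z) ↔ ∀ s, z s ≠ 0 → ∃ t, p t = s := by
  constructor
  · rintro ⟨x, rfl⟩ s hs
    by_contra h
    apply hs
    rw [hlpI_apply]
    exact Finsupp.mapDomain_of_notMem_range _ _ h
  · intro h
    refine ⟨Finsupp.comapDomain p (Finsupp.equivFunOnFinite.symm z) hp.injOn, ?_⟩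
    rw [hlpI_apply, Finsupp.mapDomain_comapDomain _ hp]
    · rfl
    · intro s hs
      exact h s (by simpa using hs)

theorem hlp_RHcls (S : Set α) (n : ℤ) :
    ∃ π : (hlpCh S n ⊓ hlpD.ker : AddSubgroup (Finset α → ℤ)) →+ RH α S n,
      Function.Surjective π ∧ ∀ z, π z = 0 ↔ ∃ w ∈ hlpCh S (n + 1), hlpD w = z := by
  refine hlp_clsMap hlpD (RCgrp α S) (rd α S) (fun n => hlpI (fun s : RChains α S n => s.1))
    (hlpCh S) (fun n => hlpI_inj Subtype.val_injective) ?_ (fun n x => hlpI_rd S n x) n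
  intro n z
  have hj : Function.Injective (fun s : RChains α S n => s.1) := Subtype.val_injective
  refine Iff.trans ?_ (hlpI_range hj z).symm
  constructor
  · intro h s hs
    exact ⟨⟨s, h s hs⟩, rfl⟩
  · intro h s hs
    obtain ⟨t, rfl⟩ := h s hs
    exact t.2

theorem hlp_RH_iff (S : Set α) (n : ℤ) : Subsingleton (RH α S n) ↔ hlpAc S n := by
  obtain ⟨π, hs, hk⟩ := hlp_RHcls S n
  constructor
  · intro h f hf hd
    exact (hk ⟨f, hf, hd⟩).1 (Subsingleton.elim _ _)
  · intro h
    refine subsingleton_of_forall_eq 0 ?_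
    intro q
    obtain ⟨⟨f, hf, hd⟩, rfl⟩ := hs q
    exact (hk _).2 (h f hf hd)

/-- nonempty chains -/
def hlpC' (S : Set α) (n : ℤ) : AddSubgroup (Finset α → ℤ) where
  carrier := {f | f ∈ hlpCh S n ∧ f ∅ = 0}
  zero_mem' := ⟨zero_mem _, rfl⟩
  add_mem' := fun {a b} ha hb => ⟨add_mem ha.1 hb.1, by simp [ha.2, hb.2]⟩
  neg_mem' := fun {a} ha => ⟨neg_mem ha.1, by simp [ha.2]⟩

theorem hlpC'_range (n : ℤ) (z : Finset α → ℤ) : z ∈ hlpC' Set.univ n ↔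
    ∃ x, hlpI (fun s : FChains α Set.univ ∅ n => s.1) x = z := by
  have hj : Function.Injective (fun s : FChains α Set.univ ∅ n => s.1) := Subtype.val_injective
  refine Iff.trans ?_ (hlpI_range hj z).symm
  constructor
  · rintro ⟨h, h'⟩ s hs
    refine ⟨⟨s, (h s hs).1, (h s hs).2.1, (h s hs).2.2, ?_⟩, rfl⟩
    intro h0
    have : s = ∅ := by simpa [Set.subset_empty_iff] using h0
    exact hs (this ▸ h')
  · intro h
    constructor
    · intro s hs
      obtain ⟨t, rfl⟩ := h s hs
      exact ⟨t.2.1, t.2.2.1, t.2.2.2.1⟩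
    · by_contra h0
      obtain ⟨t, ht⟩ := h _ h0
      apply t.2.2.2.2
      rw [show t.1 = ∅ from ht]; simp

end Transport

section Comb

variable {α : Type u} [PartialOrder α] [Fintype α]

theorem hlp_rank {ρ : α → ℕ} {a b : α} (hab : a ⋖ b)
    (hb : ∀ k : ℤ, k ≠ (ρ b : ℤ) - 1 → hlpAc {y | y < b} k)
    (ha : ¬ hlpAc {y | y < a} ((ρ a : ℤ) - 1))
    (hadm : ∀ k, hlpAc ({y | y < b} \ {a}) k) : (ρ b : ℤ) = ρ a + 1 := by
  by_contra hne
  apply ha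
  intro f hf hd
  have hfL : f ∈ hlpCh ({y | y < b} \ {a}) ((ρ a : ℤ) - 1) := by
    refine hlpCh_mono ?_ _ hf
    intro y hy
    exact ⟨lt_trans hy hab.lt, ne_of_lt hy⟩
  obtain ⟨g, hg, hgf⟩ := hadm _ f hfL hd
  have hins : hlpIns a f ∈ hlpCh {y | y < b} ((ρ a : ℤ) - 1 + 1) :=
    hlpIns_mem hf (fun y hy => Or.inl (le_of_lt hy)) hab.lt (fun y hy => lt_trans hy hab.lt)
  obtain ⟨h, hh, hhc⟩ := hb ((ρ a : ℤ) - 1 + 1) (by intro h; apply hne; linarith) (g - hlpIns a f)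
    (sub_mem (hlpCh_mono Set.sdiff_subset _ hg) hins)
    (by rw [map_sub, hlpD_ins, hd, map_zero, sub_zero, hgf, sub_self])
  have h1 := hlpLk_D a h
  have hga : hlpLk a g = 0 := hlpLk_eq_zero hg (by simp)
  have hfa : hlpLk a f = 0 := hlpLk_eq_zero hf (by simp)
  have h2 := hlpLk_ins_self a f
  rw [hfa, map_zero, add_zero] at h2
  rw [hhc, map_sub, hga, h2, zero_sub, neg_inj] at h1
  refine ⟨hlpLk a h, ?_, h1.symm⟩
  have := hlpLk_mem (T := {y | y < a}) (v := a) hh (by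
    rintro y hy (h | h)
    · exact h
    · exact absurd hy (hab.2 h))
  simpa using this

/-- the filtration -/
def hlpF (ρ : α → ℕ) (M : Set (α × α)) (n : ℤ) : Set α :=
  {x | (ρ x : ℤ) ≤ n ∧ ¬((ρ x : ℤ) = n ∧ ∃ b, (x, b) ∈ M)}

theorem hlpF_mono (ρ : α → ℕ) (M : Set (α × α)) {m n : ℤ} (h : m ≤ n) :
    hlpF ρ M m ⊆ hlpF ρ M n := by
  rintro x ⟨h1, h2⟩
  refine ⟨h1.trans h, ?_⟩
  rintro ⟨h3, h4⟩
  exact h2 ⟨by linarith, h4⟩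

/-- the filtration without critical points -/
def hlpF' (ρ : α → ℕ) (M : Set (α × α)) (n : ℤ) : Set α :=
  {x | x ∈ hlpF ρ M n ∧ ¬((ρ x : ℤ) = n ∧ IsCritical M x)}

theorem hlpF_below {ρ : α → ℕ} {M : Set (α × α)} {n : ℤ} {y : α} (h : (ρ y : ℤ) < n) :
    y ∈ hlpF' ρ M n :=
  ⟨⟨h.le, fun h' => absurd h'.1 h.ne⟩, fun h' => absurd h'.1 h.ne⟩

theorem hlpF'_cases {ρ : α → ℕ} {M : Set (α × α)} {n : ℤ} {y : α} (h : y ∈ hlpF' ρ M n)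
    (hn : (ρ y : ℤ) = n) : ∃ a, (a, y) ∈ M := by
  obtain ⟨⟨_, h1⟩, h2⟩ := h
  by_contra hc
  push Not at hc
  refine h2 ⟨hn, ?_⟩
  rintro ⟨a, b⟩ he
  refine ⟨?_, ?_⟩
  · rintro rfl; exact h1 ⟨hn, b, he⟩
  · rintro rfl; exact hc _ he

theorem hlpR_pairs {ρ : α → ℕ} (hρ : StrictMono ρ) {M : Set (α × α)} (hM : IsMorseMatching α M)
    (hr : ∀ a b, (a, b) ∈ M → ρ b = ρ a + 1)
    (hadm : ∀ a b, (a, b) ∈ M → ∀ k, hlpAc ({y | y < b} \ {a}) k) (n k : ℤ) :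
    ∀ (N : ℕ) (Y : Set α), Y.ncard = N → hlpF ρ M (n - 1) ⊆ Y → Y ⊆ hlpF' ρ M n → IsLowerSet Y →
      (∀ a b, (a, b) ∈ M → (a ∈ Y ↔ b ∈ Y)) → hlpR Y (hlpF ρ M (n - 1)) k := by
  intro N
  induction N using Nat.strong_induction_on with
  | _ N ih =>
  intro Y hN hsub hsup hlow hcl
  by_cases hY : Y ⊆ hlpF ρ M (n - 1)
  · rw [Set.Subset.antisymm hY hsub]; exact hlpR_refl _ _
  obtain ⟨⟨hcov, hmat⟩, hacy⟩ := hM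
  let A : Set α := {a | a ∈ Y ∧ (ρ a : ℤ) = n - 1 ∧ ∃ b, (a, b) ∈ M}
  have hA : A.Nonempty := by
    obtain ⟨y, hy, hy'⟩ := Set.not_subset.1 hY
    by_cases hyn : (ρ y : ℤ) = n
    · obtain ⟨a, ha⟩ := hlpF'_cases (hsup hy) hyn
      refine ⟨a, (hcl _ _ ha).2 hy, ?_, y, ha⟩
      have := hr _ _ ha
      rw [this] at hyn
      push_cast at hyn; linarith
    · have h1 : (ρ y : ℤ) ≤ n := (hsup hy).1.1
      have h2 : (ρ y : ℤ) ≤ n - 1 := by omega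
      by_contra hc
      refine hy' ⟨h2, fun h3 => hc ⟨y, hy, h3.1, h3.2⟩⟩
  have : Std.Irrefl (Relation.TransGen (MorseStep M)) := ⟨hacy⟩
  have hwf : WellFounded (Relation.TransGen (MorseStep M)) :=
    Finite.wellFounded_of_trans_of_irrefl _
  obtain ⟨a, ⟨haY, han, b, hab⟩, hmin⟩ := hwf.has_min A hA
  have hbY : b ∈ Y := (hcl _ _ hab).1 haY
  have hbn : (ρ b : ℤ) = n := by
    rw [hr _ _ hab]; push_cast; linarith
  have hablt : a < b := (hcov _ hab).lt
  have hup : ∀ y ∈ Y, a < y → y = b := by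
    intro y hy hay
    by_contra hyb
    have h1 : (ρ a : ℤ) < ρ y := by exact_mod_cast hρ hay
    have h2 : (ρ y : ℤ) ≤ n := (hsup hy).1.1
    have hyn : (ρ y : ℤ) = n := by omega
    obtain ⟨a', ha'⟩ := hlpF'_cases (hsup hy) hyn
    have hra := hr _ _ ha'
    refine hmin a' ⟨(hcl _ _ ha').2 hy, by omega, y, ha'⟩ ?_
    refine Relation.TransGen.tail (Relation.TransGen.single (Or.inl ha')) (Or.inr ⟨⟨hay, ?_⟩, ?_⟩)
    · intro c hc1 hc2
      have := hρ hc1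
      have := hρ hc2
      omega
    · intro hm
      have := hmat a _ hm _ hab (Or.inl rfl) (Or.inl rfl)
      exact hyb (Prod.ext_iff.1 this).2
  have hbmax : ∀ y ∈ Y, ¬ b < y := by
    intro y hy hby
    have := hρ hby
    have h2 : (ρ y : ℤ) ≤ n := (hsup hy).1.1
    omega
  let Y' : Set α := Y \ {a, b}
  have hYY' : Y = insert a (insert b Y') := by
    ext y
    simp only [Y', Set.mem_insert_iff, Set.mem_sdiff, Set.mem_singleton_iff]
    constructor
    · intro h; tauto
    · rintro (rfl | rfl | h)
      · exact haY
      · exact hbY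
      · exact h.1
  have hsub' : hlpF ρ M (n - 1) ⊆ Y' := by
    intro y hy
    refine ⟨hsub hy, ?_⟩
    rintro (rfl | rfl)
    · exact hy.2 ⟨han, b, hab⟩
    · have := hy.1; omega
  have hR' : hlpR Y' (hlpF ρ M (n - 1)) k := by
    refine ih Y'.ncard ?_ Y' rfl hsub' (Set.sdiff_subset.trans hsup) ?_ ?_
    · rw [← hN]
      refine Set.ncard_lt_ncard ⟨Set.sdiff_subset, ?_⟩ (Set.toFinite _)
      intro h
      exact (h haY).2 (by simp)
    · intro y x hxy hy
      refine ⟨hlow hxy hy.1, ?_⟩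
      rintro (rfl | rfl)
      · rcases eq_or_lt_of_le hxy with rfl | hlt
        · exact hy.2 (by simp)
        · exact hy.2 (by simp [hup y hy.1 hlt])
      · rcases eq_or_lt_of_le hxy with rfl | hlt
        · exact hy.2 (by simp)
        · exact hbmax y hy.1 hlt
    · intro c e hce
      have key : (c = a ∨ c = b) ↔ (e = a ∨ e = b) := by
        constructor
        · intro h
          have := hmat c _ hce _ hab (Or.inl rfl) h
          right; exact (Prod.ext_iff.1 this).2
        · intro h
          have := hmat e _ hce _ hab (Or.inr rfl) h
          left; exact (Prod.ext_iff.1 this).1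
      simp only [Y', Set.mem_sdiff, Set.mem_insert_iff, Set.mem_singleton_iff, key, hcl _ _ hce]
  have hbY' : b ∉ Y' := fun h => h.2 (by simp)
  have haY' : a ∉ insert b Y' := by
    rintro (h | h)
    · exact hablt.ne h
    · exact h.2 (by simp)
  have hRb : hlpR (insert b Y') Y' k := by
    refine hlpR_insert hbY' ?_
    convert hadm _ _ hab (k - 1) using 1
    ext y
    simp only [Y', Set.mem_sdiff, Set.mem_insert_iff, Set.mem_singleton_iff, Set.mem_ofPred_eq]
    constructor
    · rintro ⟨⟨h1, h2⟩, h3 | h3⟩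
      · exact ⟨h3, fun h => h2 (Or.inl h)⟩
      · exact absurd h3 (hbmax y h1)
    · rintro ⟨h1, h2⟩
      exact ⟨⟨hlow h1.le hbY, by rintro (h | h); exacts [h2 h, h1.ne h]⟩, Or.inl h1⟩
  have hRa : hlpR (insert a (insert b Y')) (insert b Y') k := by
    refine hlpR_insert haY' (hlpAc_cone (b := b) (show _ ∧ _ from ⟨Or.inl rfl, Or.inr hablt⟩) ?_ _)
    rintro y ⟨hy, h | h⟩
    · exact Or.inl (h.trans hablt).le
    · refine Or.inl (hup y ?_ h).le
      rw [hYY']; exact Or.inr hy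
  rw [hYY']
  exact hlpR_trans (Set.subset_insert _ _) (hsub'.trans (Set.subset_insert _ _)) hRa
    (hlpR_trans (Set.subset_insert _ _) hsub' hRb hR')

theorem hlpF_sub {ρ : α → ℕ} {M : Set (α × α)} (n : ℤ) : hlpF ρ M (n - 1) ⊆ hlpF' ρ M n := by
  intro y hy
  have := hy.1
  exact hlpF_below (by omega)

theorem hlpR_F' {ρ : α → ℕ} (hρ : StrictMono ρ) {M : Set (α × α)} (hM : IsMorseMatching α M)
    (hr : ∀ a b, (a, b) ∈ M → ρ b = ρ a + 1)
    (hadm : ∀ a b, (a, b) ∈ M → ∀ k, hlpAc ({y | y < b} \ {a}) k) (n k : ℤ) :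
    hlpR (hlpF' ρ M n) (hlpF ρ M (n - 1)) k := by
  refine hlpR_pairs hρ hM hr hadm n k _ _ rfl (hlpF_sub n) subset_rfl ?_ ?_
  · intro y x hxy hy
    rcases eq_or_lt_of_le hxy with rfl | hlt
    · exact hy
    · have h1 := hρ hlt
      have h2 := hy.1.1
      exact hlpF_below (by omega)
  · intro a b hab
    have h1 := hr _ _ hab
    constructor
    · rintro ⟨⟨h2, h3⟩, _⟩
      have h4 : (ρ a : ℤ) ≠ n := fun h => h3 ⟨h, b, hab⟩
      refine ⟨⟨by omega, ?_⟩, ?_⟩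
      · rintro ⟨_, c, hc⟩
        have := hM.1.2 b _ hab _ hc (Or.inr rfl) (Or.inl rfl)
        have h5 := (hM.1.1 _ hab).lt
        rw [Prod.ext_iff] at this
        exact h5.ne this.1
      · rintro ⟨_, hc⟩
        exact (hc _ hab).2 rfl
    · intro hb
      have := hb.1.1
      exact hlpF_below (by omega)

theorem hlpR_F {ρ : α → ℕ} (hρ : StrictMono ρ) {M : Set (α × α)} (hM : IsMorseMatching α M)
    (hr : ∀ a b, (a, b) ∈ M → ρ b = ρ a + 1)
    (hq : ∀ x, ∀ k : ℤ, k ≠ (ρ x : ℤ) - 1 → hlpAc {y | y < x} k)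
    (hadm : ∀ a b, (a, b) ∈ M → ∀ k, hlpAc ({y | y < b} \ {a}) k) (n k : ℤ) (hk : k ≠ n) :
    hlpR (hlpF ρ M n) (hlpF ρ M (n - 1)) k := by
  have key : ∀ T : Finset α, (∀ x ∈ T, (ρ x : ℤ) = n ∧ IsCritical M x) →
      hlpR (hlpF' ρ M n ∪ ↑T) (hlpF' ρ M n) k := by
    intro T
    induction T using Finset.induction_on with
    | empty => intro _; simpa using hlpR_refl _ _
    | insert x T hx ih =>
      intro hT
      have ih' := ih (fun y hy => hT y (Finset.mem_insert_of_mem hy))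
      have hxT := hT x (Finset.mem_insert_self _ _)
      have hx' : x ∉ hlpF' ρ M n ∪ ↑T := by
        rintro (h | h)
        · exact h.2 hxT
        · exact hx h
      rw [Finset.coe_insert, Set.union_insert]
      refine hlpR_trans (Set.subset_insert _ _) Set.subset_union_left (hlpR_insert hx' ?_) ih'
      convert hq x (k - 1) (by have := hxT.1; omega) using 1
      ext y
      simp only [Set.mem_ofPred_eq]
      constructor
      · rintro ⟨h1, h2 | h2⟩
        · exact h2
        · have h3 := hρ h2
          have h4 := hxT.1
          rcases h1 with h1 | h1
          · have := h1.1.1; omega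
          · have := (hT y (Finset.mem_insert_of_mem h1)).1; omega
      · intro h
        have h3 := hρ h
        have h4 := hxT.1
        exact ⟨Or.inl (hlpF_below (by omega)), Or.inl h⟩
  have h1 := key (Finset.univ.filter fun x => x ∈ hlpF ρ M n ∧ (ρ x : ℤ) = n ∧ IsCritical M x)
    (by intro x hx; exact (Finset.mem_filter.1 hx).2.2)
  have h2 : hlpF' ρ M n ∪
      ↑(Finset.univ.filter fun x => x ∈ hlpF ρ M n ∧ (ρ x : ℤ) = n ∧ IsCritical M x) =
      hlpF ρ M n := by
    ext y
    simp only [hlpF', Set.mem_union, Set.mem_ofPred_eq, Finset.coe_filter, Finset.mem_univ, true_and]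
    by_cases h : (ρ y : ℤ) = n ∧ IsCritical M y <;> simp [h]
  rw [h2] at h1
  exact hlpR_trans (fun y hy => hy.1) (hlpF_sub n) h1 (hlpR_F' hρ hM hr hadm n k)

theorem hlp_push {ρ : α → ℕ} {M : Set (α × α)}
    (hR : ∀ n k : ℤ, k ≠ n → hlpR (hlpF ρ M n) (hlpF ρ M (n - 1)) k) (k : ℤ) :
    ∀ (N : ℕ), ∀ z ∈ hlpCh (hlpF ρ M (k + N)) k, hlpD z ∈ hlpCh (hlpF ρ M (k - 1)) (k - 1) →
      ∃ w ∈ hlpCh Set.univ (k + 1), z - hlpD w ∈ hlpCh (hlpF ρ M k) k := by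
  intro N
  induction N with
  | zero =>
    intro z hz _
    exact ⟨0, zero_mem _, by simpa using hz⟩
  | succ N ih =>
    intro z hz hd
    obtain ⟨g, hg, hg'⟩ := hR (k + (N + 1 : ℕ)) k (by push_cast; omega) z hz
      (hlpCh_mono (hlpF_mono _ _ (by push_cast; omega)) _ hd)
    rw [show k + ((N + 1 : ℕ) : ℤ) - 1 = k + N by push_cast; ring] at hg'
    obtain ⟨w, hw, hw'⟩ := ih _ hg' (by rw [map_sub, hlpD_D, sub_zero]; exact hd)
    refine ⟨g + w, add_mem (hlpCh_mono (Set.subset_univ _) _ hg) hw, ?_⟩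
    rw [map_add, ← sub_sub]; exact hw'

theorem hlp_push' {ρ : α → ℕ} {M : Set (α × α)}
    (hR : ∀ n k : ℤ, k ≠ n → hlpR (hlpF ρ M n) (hlpF ρ M (n - 1)) k) (k : ℤ)
    (z : Finset α → ℤ) (hz : z ∈ hlpCh Set.univ k)
    (hd : hlpD z ∈ hlpCh (hlpF ρ M (k - 1)) (k - 1)) :
    ∃ w ∈ hlpCh Set.univ (k + 1), z - hlpD w ∈ hlpCh (hlpF ρ M k) k := by
  refine hlp_push hR k (k.natAbs + ∑ x, ρ x + 1) z (hlpCh_mono ?_ _ hz) hd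
  intro x _
  have h1 : ρ x ≤ ∑ x, ρ x := Finset.single_le_sum (f := ρ) (fun _ _ => Nat.zero_le _) (Finset.mem_univ x)
  have h2 : (ρ x : ℤ) < k + (k.natAbs + ∑ x, ρ x + 1 : ℕ) := by
    have : 0 ≤ k + k.natAbs := by omega
    have h1' : (ρ x : ℤ) ≤ (∑ x, ρ x : ℕ) := by exact_mod_cast h1
    rw [Nat.cast_add, Nat.cast_add]
    push_cast at *
    linarith
  exact (hlpF_below (M := M) h2).1

theorem hlp_dim {ρ : α → ℕ} (hρ : StrictMono ρ) {S : Set α} {n : ℕ} {k : ℤ}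
    (hS : ∀ x ∈ S, ρ x < n) (hk : (n : ℤ) ≤ k) {f : Finset α → ℤ} (hf : f ∈ hlpCh S k) : f = 0 := by
  ext s
  by_contra h
  obtain ⟨h1, h2, h3⟩ := hf s h
  have : s.card ≤ (Finset.range n).card := by
    refine Finset.card_le_card_of_injOn ρ ?_ ?_
    · intro x hx
      simpa using hS x (h1 hx)
    · intro x hx y hy hxy
      by_contra hne
      rcases h2 hx hy hne with h | h
      · exact (hρ (lt_of_le_of_ne h hne)).ne hxy
      · exact (hρ (lt_of_le_of_ne h (Ne.symm hne))).ne hxy.symm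
  rw [Finset.card_range] at this
  omega

/-- the Morse complex -/
def hlpE' (ρ : α → ℕ) (M : Set (α × α)) (n : ℤ) : AddSubgroup (Finset α → ℤ) where
  carrier := {f | f ∈ hlpC' (hlpF ρ M n) n ∧ hlpD f ∈ hlpCh (hlpF ρ M (n - 1)) (n - 1)}
  zero_mem' := ⟨zero_mem _, by rw [map_zero]; exact zero_mem _⟩
  add_mem' := fun {a b} ha hb => ⟨add_mem ha.1 hb.1, by rw [map_add]; exact add_mem ha.2 hb.2⟩
  neg_mem' := fun {a} ha => ⟨neg_mem ha.1, by rw [map_neg]; exact neg_mem ha.2⟩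

theorem hlpE'_TD {ρ : α → ℕ} {M : Set (α × α)} {n : ℤ} {f : Finset α → ℤ} (hf : f ∈ hlpE' ρ M n) :
    hlpTD f ∈ hlpE' ρ M (n - 1) := by
  refine ⟨⟨hlpT_mem hf.2, by simp [hlpTD_apply, hlpT_apply]⟩, ?_⟩
  rw [hlpTD_apply, hlpD_T, hlpD_D]; exact zero_mem _

theorem hlpCh_neg {S : Set α} {n : ℤ} (hn : n < 0) {f : Finset α → ℤ} (hf : f ∈ hlpC' S n) :
    f = 0 := by
  ext s
  by_contra h
  have h1 := (hf.1 s h).2.2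
  have : s = ∅ := by rw [← Finset.card_eq_zero]; omega
  subst this
  exact h hf.2

theorem hlpE'_lk {ρ : α → ℕ} (hρ : StrictMono ρ) {M : Set (α × α)} {n : ℤ} {f : Finset α → ℤ}
    (hf : f ∈ hlpE' ρ M n) {x : α} (hx : (ρ x : ℤ) = n) :
    hlpLk x f ∈ (hlpCh {a | a < x} (n - 1) ⊓ hlpD.ker : AddSubgroup _) := by
  refine ⟨hlpLk_mem hf.1.1 ?_, ?_⟩
  · rintro y hy (h | h)
    · exact h
    · have := hρ h
      have := hy.1
      omega
  · show hlpD _ = 0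
    have := hlpLk_D x f
    rw [hlpLk_eq_zero hf.2 (by intro h; have := h.1; omega)] at this
    exact neg_eq_zero.1 this.symm

theorem hlpE'_inj {ρ : α → ℕ} (hρ : StrictMono ρ) {M : Set (α × α)}
    (hR : ∀ n k : ℤ, hlpR (hlpF' ρ M n) (hlpF ρ M (n - 1)) k)
    {n : ℤ} {f : Finset α → ℤ} (hf : f ∈ hlpE' ρ M n)
    (h : ∀ x, IsCritical M x → (ρ x : ℤ) = n → hlpLk x f = 0) : f = 0 := by
  by_cases hn : n < 0
  · exact hlpCh_neg hn hf.1
  push Not at hn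
  lift n to ℕ using hn
  have h1 : f ∈ hlpCh (hlpF' ρ M n) n := by
    intro s hs
    refine ⟨fun y hy => ⟨(hf.1.1 s hs).1 hy, ?_⟩, (hf.1.1 s hs).2⟩
    rintro ⟨h1, h2⟩
    have h3 := congrFun (congrArg (hlpIns y) (h y h2 h1)) s
    rw [hlpIns_lk_apply, if_pos (Finset.mem_coe.1 hy), map_zero] at h3
    exact hs h3
  obtain ⟨g, hg, hg'⟩ := hR n n f h1 hf.2
  have hg0 : g = 0 := hlp_dim hρ (n := n + 1)
    (fun x hx => by have := hx.1.1; omega) (by push_cast; exact le_rfl) hg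
  rw [hg0, map_zero, sub_zero] at hg'
  exact hlp_dim hρ (n := n) (fun x hx => by have := hx.1; omega) le_rfl hg'

theorem hlpE'_surj {ρ : α → ℕ} (hρ : StrictMono ρ) {M : Set (α × α)}
    (hR : ∀ n k : ℤ, hlpR (hlpF' ρ M n) (hlpF ρ M (n - 1)) k)
    {n : ℤ} (c : {x : α // IsCritical M x ∧ (ρ x : ℤ) = n} → (Finset α → ℤ))
    (hc : ∀ x, c x ∈ hlpCh {a | a < x.1} (n - 1)) (hd : ∀ x, hlpD (c x) = 0) :
    ∃ f ∈ hlpE' ρ M n, ∀ x, hlpLk x.1 f = c x := by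
  by_cases hn : n < 0
  · refine ⟨0, zero_mem _, ?_⟩
    rintro ⟨x, _, hx⟩
    omega
  push Not at hn
  have hF : ∀ x : {x : α // IsCritical M x ∧ (ρ x : ℤ) = n}, x.1 ∈ hlpF ρ M n := by
    rintro ⟨x, hx, hxn⟩
    refine ⟨hxn.le, ?_⟩
    rintro ⟨_, b, hb⟩
    exact (hx _ hb).1 rfl
  have hlow : ∀ x : {x : α // IsCritical M x ∧ (ρ x : ℤ) = n}, {a | a < x.1} ⊆ hlpF' ρ M n := by
    rintro ⟨x, hx, hxn⟩ y hy
    have : ρ y < ρ x := hρ hy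
    exact hlpF_below (by omega)
  let z : Finset α → ℤ := ∑ x, hlpIns x.1 (c x)
  have hz : z ∈ hlpCh (hlpF ρ M n) n := by
    refine sum_mem fun x _ => ?_
    have := hlpIns_mem (T := hlpF ρ M n) (hc x) (fun y hy => Or.inl (le_of_lt hy)) (hF x)
      ((hlow x).trans fun y hy => hy.1)
    simpa using this
  have hdz : hlpD z = ∑ x, c x := by
    simp only [z, map_sum]
    refine Finset.sum_congr rfl fun x _ => ?_
    rw [hlpD_ins, hd, map_zero, sub_zero]
  obtain ⟨w, hw, hw'⟩ := hR n (n - 1) (hlpD z)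
    (by rw [hdz]; exact sum_mem fun x _ => hlpCh_mono (hlow x) _ (hc x))
    (by rw [hlpD_D]; exact zero_mem _)
  rw [sub_add_cancel] at hw
  refine ⟨z - w, ⟨⟨sub_mem hz (hlpCh_mono (fun y hy => hy.1) _ hw), ?_⟩, ?_⟩, ?_⟩
  · by_contra h0
    have h1 := (sub_mem hz (hlpCh_mono (fun y hy => hy.1) _ hw) : z - w ∈ hlpCh (hlpF ρ M n) n) ∅ h0
    have := h1.2.2
    simp at this
    omega
  · rw [map_sub]; exact hw'
  · intro x
    rw [map_sub, hlpLk_eq_zero hw (v := x.1) (fun h => h.2 ⟨x.2.2, x.2.1⟩), sub_zero]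
    simp only [z, map_sum]
    have h0 : ∀ y : {x : α // IsCritical M x ∧ (ρ x : ℤ) = n}, hlpLk x.1 (c y) = 0 := by
      intro y
      refine hlpLk_eq_zero (hc y) ?_
      intro h
      have := hρ h
      have := x.2.2
      have := y.2.2
      omega
    rw [Finset.sum_eq_single x]
    · have := hlpLk_ins_self x.1 (c x)
      rwa [h0, map_zero, add_zero] at this
    · intro y _ hy
      have := hlpLk_ins (u := x.1) (v := y.1) (fun h => hy (Subtype.ext h.symm)) (c y)
      rwa [h0, map_zero, add_zero] at this
    · simp

end Comb

theorem hlp_empty {α : Type u} [PartialOrder α] [Fintype α] {S : Set α} {k : ℤ} (hk : 0 ≤ k)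
    {f : Finset α → ℤ} (hf : f ∈ hlpCh S k) : f ∅ = 0 := by
  by_contra h
  have := (hf _ h).2.2
  rw [Finset.card_empty] at this
  push_cast at this
  omega

theorem hlpT_eq {α : Type u} [PartialOrder α] {f : Finset α → ℤ} (hf : f ∅ = 0) : hlpT f = f := by
  ext t
  rw [hlpT_apply]
  split_ifs with h
  · rw [h, hf]
  · rfl

theorem hlp_equiv {α : Type u} [PartialOrder α] [Fintype α] {ρ : α → ℕ} (hρ : StrictMono ρ)
    {M : Set (α × α)} (hR : ∀ n k : ℤ, hlpR (hlpF' ρ M n) (hlpF ρ M (n - 1)) k) (n : ℤ) :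
    Nonempty ((hlpE' ρ M n) ≃+ Π₀ x : {x : α // IsCritical M x ∧ (ρ x : ℤ) = n},
      RH α {a | a < (x : α)} (n - 1)) := by
  have hcls := fun x : {x : α // IsCritical M x ∧ (ρ x : ℤ) = n} =>
    hlp_RHcls {a | a < (x : α)} (n - 1)
  choose π hs hk using hcls
  have hi : ∀ x z, π x z = 0 → z = 0 := by
    intro x z h
    obtain ⟨w, hw, hw'⟩ := (hk x z).1 h
    have : w = 0 := by
      refine hlp_dim hρ (n := ρ x.1) (fun y hy => hρ hy) ?_ hw
      have := x.2.2
      omega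
    apply Subtype.ext
    rw [← hw', this, map_zero]; rfl
  let Ψ : (hlpE' ρ M n) →+ Π₀ x : {x : α // IsCritical M x ∧ (ρ x : ℤ) = n},
      RH α {a | a < (x : α)} (n - 1) :=
    AddMonoidHom.mk' (fun f => DFinsupp.equivFunOnFintype.symm
      (fun x => π x ⟨hlpLk x.1 f.1, hlpE'_lk hρ f.2 x.2.2⟩)) (by
        intro f g
        ext x
        rw [DFinsupp.add_apply]
        show π x _ = π x _ + π x _
        rw [← map_add]
        congr 1
        apply Subtype.ext
        exact map_add (hlpLk x.1) _ _)
  have hΨ : ∀ f x, Ψ f x = π x ⟨hlpLk x.1 f.1, hlpE'_lk hρ f.2 x.2.2⟩ := fun _ _ => rfl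
  refine ⟨AddEquiv.ofBijective Ψ ⟨?_, ?_⟩⟩
  · rw [injective_iff_map_eq_zero]
    rintro ⟨f, hf⟩ h
    apply Subtype.ext
    refine hlpE'_inj hρ hR hf ?_
    intro x hx hxn
    have h1 := hi ⟨x, hx, hxn⟩ _ ((hΨ ⟨f, hf⟩ ⟨x, hx, hxn⟩).symm.trans (by rw [h]; rfl))
    exact congrArg Subtype.val h1
  · intro q
    choose c hc using fun x => hs x (q x)
    obtain ⟨f, hf, hfc⟩ := hlpE'_surj hρ hR (fun x => (c x).1) (fun x => (c x).2.1)
      (fun x => (c x).2.2)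
    refine ⟨⟨f, hf⟩, ?_⟩
    ext x
    rw [hΨ, ← hc x]
    congr 1
    exact Subtype.ext (hfc x)

/-- Let `X` be a finite quasicellular poset with quasicellular morphism `ρ` and let `M` be a
homologically admissible Morse matching on the Hasse diagram of `X`.  Then there is a chain
complex whose degree-`n` group is `⊕_{x critical, ρ(x) = n} H̃^f_{n-1}(Û_x)` whose homology is
isomorphic to `H^f_*(X)`. -/
theorem stmt7 {α : Type u} [PartialOrder α] [Fintype α] (ρ : α → ℕ)
    (hρ : IsQuasicellular α ρ) (M : Set (α × α)) (hM : IsMorseMatching α M)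
    (hadm : IsHomologicallyAdmissible α M) :
    ∃ d : (n : ℤ) →
        ((Π₀ x : {x : α // IsCritical M x ∧ (ρ x : ℤ) = n},
            RH α {a | a < (x : α)} (n - 1)) →+
          Π₀ x : {x : α // IsCritical M x ∧ (ρ x : ℤ) = n - 1},
            RH α {a | a < (x : α)} (n - 1 - 1)),
      (∀ n : ℤ, (d (n - 1)).comp (d n) = 0) ∧
        ∀ n : ℤ, Nonempty
          (gradedHomology
            (fun n => Π₀ x : {x : α // IsCritical M x ∧ (ρ x : ℤ) = n},
              RH α {a | a < (x : α)} (n - 1)) d n ≃+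
            HF α Set.univ n) := by
  obtain ⟨hmono, hanti, hqc⟩ := hρ
  have hst : StrictMono ρ := by
    intro x y hxy
    refine lt_of_le_of_ne (hmono hxy.le) ?_
    intro h
    exact hanti (ρ y) h rfl hxy.ne hxy.le
  have hq : ∀ x, ∀ k : ℤ, k ≠ (ρ x : ℤ) - 1 → hlpAc {y | y < x} k :=
    fun x k hk => (hlp_RH_iff _ _).1 ((hqc x).1 k hk)
  have had : ∀ a b, (a, b) ∈ M → ∀ k, hlpAc ({y | y < b} \ {a}) k :=
    fun a b hab k => (hlp_RH_iff _ _).1 (hadm (a, b) hab k)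
  have hr : ∀ a b, (a, b) ∈ M → ρ b = ρ a + 1 := by
    intro a b hab
    have := hlp_rank (ρ := ρ) (hM.1.1 _ hab) (hq b)
      (fun h => (hqc a).2 ((hlp_RH_iff _ _).2 h)) (had a b hab)
    exact_mod_cast this
  have hR' := hlpR_F' hst hM hr had
  have hR := hlpR_F hst hM hr hq had
  have Φ := fun n => Classical.choice (hlp_equiv hst hR' n)
  let tD : ∀ n : ℤ, hlpE' ρ M n →+ hlpE' ρ M (n - 1) := fun n =>
    (hlpTD.comp (hlpE' ρ M n).subtype).codRestrict (hlpE' ρ M (n - 1)) (fun f => hlpE'_TD f.2)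
  let ι : ∀ n : ℤ, (Π₀ x : {x : α // IsCritical M x ∧ (ρ x : ℤ) = n},
      RH α {a | a < (x : α)} (n - 1)) →+ (Finset α → ℤ) :=
    fun n => (hlpE' ρ M n).subtype.comp (Φ n).symm.toAddMonoidHom
  have hιi : ∀ n, Function.Injective (ι n) := fun n =>
    Subtype.val_injective.comp (Φ n).symm.injective
  have hcomm : ∀ n x, ι (n - 1) (((Φ (n - 1)).toAddMonoidHom.comp
      ((tD n).comp (Φ n).symm.toAddMonoidHom)) x) = hlpTD (ι n x) := by
    intro n x
    show (((Φ (n - 1)).symm ((Φ (n - 1)) ((tD n) ((Φ n).symm x))) : hlpE' ρ M (n - 1)) :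
      Finset α → ℤ) = _
    rw [AddEquiv.symm_apply_apply]
    rfl
  refine ⟨fun n => (Φ (n - 1)).toAddMonoidHom.comp ((tD n).comp (Φ n).symm.toAddMonoidHom),
    ?_, ?_⟩
  · intro n
    apply AddMonoidHom.ext
    intro x
    apply hιi
    refine ((hcomm (n - 1) _).trans (congrArg hlpTD (hcomm n x))).trans ?_
    rw [hlpTD_TD]
    exact (map_zero (ι (n - 1 - 1))).symm
  · intro n
    refine hlp_homIso hlpTD _ _ ι (hlpE' ρ M) hιi ?_ hcomm
      (FCgrp α Set.univ ∅) (fd α Set.univ ∅)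
      (fun n => hlpI (fun s : FChains α Set.univ ∅ n => s.1)) (hlpC' Set.univ)
      (fun n => hlpI_inj Subtype.val_injective) hlpC'_range (fun n x => hlpI_fd n x) hlpTD_TD
      ?_ n ?_ ?_
    · intro n z
      constructor
      · intro hz
        exact ⟨Φ n ⟨z, hz⟩, by simp [ι]⟩
      · rintro ⟨x, rfl⟩
        exact ((Φ n).symm x).2
    · intro n f hf
      exact ⟨hlpCh_mono (Set.subset_univ _) _ hf.1.1, hf.1.2⟩
    · intro z hz hd
      by_cases hn : n < 0
      · exact ⟨0, zero_mem _, by rw [hlpCh_neg hn hz, map_zero, sub_zero]; exact zero_mem _⟩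
      push Not at hn
      have hDz : hlpD z ∈ hlpCh (hlpF ρ M (n - 1)) (n - 1) := by
        intro s hs
        have hs0 : s = ∅ := by
          by_contra h
          have := congrFun hd s
          rw [hlpTD_apply, hlpT_apply, if_neg h] at this
          exact hs this
        refine ⟨by rw [hs0]; simp, (hlpD_mem hz.1 s hs).2⟩
      obtain ⟨w, hw, hw'⟩ := hlp_push' hR n z hz.1 hDz
      refine ⟨w, ⟨hw, hlp_empty (by omega) hw⟩, ?_⟩
      have hDw : hlpD w ∈ hlpCh Set.univ n := by simpa using hlpD_mem hw
      rw [hlpTD_apply, hlpT_eq (hlp_empty hn hDw)]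
      refine ⟨⟨hw', hlp_empty hn hw'⟩, ?_⟩
      rw [map_sub, hlpD_D, sub_zero]
      exact hDz
    · intro w hw hwE
      by_cases hn : n < 0
      · exact ⟨0, zero_mem _, by rw [hlpCh_neg hn hwE.1, map_zero]⟩
      push Not at hn
      have hDw : hlpD w ∈ hlpCh Set.univ n := by simpa using hlpD_mem hw.1
      have hE := hwE.1.1
      rw [hlpTD_apply, hlpT_eq (hlp_empty hn hDw)] at hE
      have hE' : hlpD w ∈ hlpCh (hlpF ρ M (n + 1 - 1)) (n + 1 - 1) := by
        rw [add_sub_cancel_right]; exact hE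
      obtain ⟨u, hu, hu'⟩ := hlp_push' hR (n + 1) w hw.1 hE'
      have hDD : hlpD (w - hlpD u) = hlpD w := by rw [map_sub, hlpD_D, sub_zero]
      refine ⟨w - hlpD u, ⟨⟨hu', hlp_empty (by omega) hu'⟩, ?_⟩, ?_⟩
      · rw [hDD]; exact hE'
      · rw [hlpTD_apply, hlpTD_apply, hDD]
end

section
/- Let X be a finite poset which is quasicellular with quasicellular morphism ρ, and let M be a homologically admissible Morse matching on the Hasse diagram of X. Set X_{−1} = ∅ and, for n ≥ 0, X_n = {x ∈ X : ρ(x) ≤ n} ∪ {z : (y,z) ∈ M for some y with ρ(y) = n}, and let A_n be the set of critical points x of X with ρ(x) = n. Then for every n ≥ 0 and every i ∈ ℤ: H^f_i(X_n, X_{n−1}) ≅ ⊕_{x ∈ A_n} H̃^f_{n−1}(Û_x) if i = n, and H^f_i(X_n, X_{n−1}) = 0 if i ≠ n. -/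
open scoped Classical

universe u

/-- The filtration `X_p = {x | ρ(x) ≤ p} ∪ {z | (y, z) ∈ M for some y with ρ(y) = p}`
(empty for `p < 0`). -/
def morseFiltration {α : Type u} [PartialOrder α] (ρ : α → ℕ) (M : Set (α × α)) (p : ℤ) :
    Set α :=
  {x | (ρ x : ℤ) ≤ p} ∪ {z | ∃ y, (y, z) ∈ M ∧ (ρ y : ℤ) = p}

set_option linter.unusedSectionVars false
set_option linter.unusedVariables false

namespace QC

variable {α : Type u} [PartialOrder α]

/-- Ungraded restricted differential. -/
noncomputable def D (P : Finset α → Prop) : (Finset α →₀ ℤ) →ₗ[ℤ] (Finset α →₀ ℤ) :=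
  Finsupp.lift (Finset α →₀ ℤ) ℤ (Finset α) (fun s =>
    ∑ v ∈ s, chainSgn α s v • if P (s.erase v) then Finsupp.single (s.erase v) (1 : ℤ) else 0)

noncomputable def C (P : Finset α → Prop) (n : ℤ) : Submodule ℤ (Finset α →₀ ℤ) :=
  Finsupp.supported ℤ ℤ {s | P s ∧ (s.card : ℤ) = n + 1}

noncomputable def pr (P : Finset α → Prop) : (Finset α →₀ ℤ) →ₗ[ℤ] (Finset α →₀ ℤ) :=
  Finsupp.lift (Finset α →₀ ℤ) ℤ (Finset α) (fun s => if P s then Finsupp.single s (1 : ℤ) else 0)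

theorem D_single (P : Finset α → Prop) (s : Finset α) : D P (Finsupp.single s 1) =
    ∑ v ∈ s, chainSgn α s v • if P (s.erase v) then Finsupp.single (s.erase v) (1 : ℤ) else 0 := by
  simp [D]

theorem pr_single (P : Finset α → Prop) (s : Finset α) : pr P (Finsupp.single s 1) =
    if P s then Finsupp.single s (1 : ℤ) else 0 := by
  simp [pr]

theorem single_mem_C {P : Finset α → Prop} {n : ℤ} {s : Finset α} (h : P s)
    (hn : (s.card : ℤ) = n + 1) : Finsupp.single s (1 : ℤ) ∈ C P n :=
  Finsupp.single_mem_supported ℤ 1 ⟨h, hn⟩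

theorem C_induct {P : Finset α → Prop} {n : ℤ} (N : Submodule ℤ (Finset α →₀ ℤ))
    (h : ∀ s, P s → (s.card : ℤ) = n + 1 → Finsupp.single s (1 : ℤ) ∈ N)
    {c : Finset α →₀ ℤ} (hc : c ∈ C P n) : c ∈ N := by
  have : C P n ≤ N := by
    rw [C, Finsupp.supported_eq_span_single, Submodule.span_le]
    rintro _ ⟨s, hs, rfl⟩
    exact h s hs.1 hs.2
  exact this hc

theorem C_ext {P : Finset α → Prop} {n : ℤ} (f g : (Finset α →₀ ℤ) →ₗ[ℤ] (Finset α →₀ ℤ))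
    (h : ∀ s, P s → (s.card : ℤ) = n + 1 → f (Finsupp.single s (1 : ℤ)) = g (Finsupp.single s 1))
    {c : Finset α →₀ ℤ} (hc : c ∈ C P n) : f c = g c :=
  C_induct (LinearMap.eqLocus f g) (fun s h1 h2 => h s h1 h2) hc

theorem C_map {P Q : Finset α → Prop} {n m : ℤ} (f : (Finset α →₀ ℤ) →ₗ[ℤ] (Finset α →₀ ℤ))
    (h : ∀ s, P s → (s.card : ℤ) = n + 1 → f (Finsupp.single s (1 : ℤ)) ∈ C Q m)
    {c : Finset α →₀ ℤ} (hc : c ∈ C P n) : f c ∈ C Q m :=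
  C_induct ((C Q m).comap f) (fun s h1 h2 => h s h1 h2) hc

theorem C_mono {P Q : Finset α → Prop} {n : ℤ} (h : ∀ s, P s → Q s) {c : Finset α →₀ ℤ}
    (hc : c ∈ C P n) : c ∈ C Q n :=
  C_map LinearMap.id (fun s h1 h2 => single_mem_C (h s h1) h2) hc

theorem card_erase' {s : Finset α} {v : α} (hv : v ∈ s) {n : ℤ} (h : (s.card : ℤ) = n + 1 + 1) :
    ((s.erase v).card : ℤ) = n + 1 := by
  rw [Finset.cast_card_erase_of_mem hv, h]; ring

theorem D_mem {P : Finset α → Prop} {n : ℤ} {c : Finset α →₀ ℤ} (hc : c ∈ C P (n + 1)) :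
    D P c ∈ C P n := by
  refine C_map (D P) (fun s h1 h2 => ?_) hc
  rw [D_single]
  refine Submodule.sum_mem _ fun v hv => Submodule.smul_mem _ _ ?_
  split_ifs with h
  · exact single_mem_C h (card_erase' hv h2)
  · exact Submodule.zero_mem _

def Good (P : Finset α → Prop) : Prop :=
  (∀ s, P s → IsChain (· ≤ ·) (↑s : Set α)) ∧
    ∀ s v w, P s → P ((s.erase v).erase w) → P (s.erase v)

theorem sgn_erase_of_lt {s : Finset α} {v w : α} (h : v < w) :
    chainSgn α (s.erase w) v = chainSgn α s v := by
  unfold chainSgn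
  congr 2
  ext a
  simp only [Finset.mem_filter, Finset.mem_erase]
  constructor
  · rintro ⟨⟨_, h1⟩, h2⟩; exact ⟨h1, h2⟩
  · rintro ⟨h1, h2⟩; exact ⟨⟨(h2.trans h).ne, h1⟩, h2⟩

theorem sgn_erase_of_gt {s : Finset α} {v w : α} (h : v < w) (hv : v ∈ s) :
    chainSgn α (s.erase v) w = - chainSgn α s w := by
  unfold chainSgn
  have : s.filter (fun a => a < w) = insert v ((s.erase v).filter (fun a => a < w)) := by
    ext a
    simp only [Finset.mem_filter, Finset.mem_erase, Finset.mem_insert]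
    by_cases e : a = v
    · subst e; simp [h, hv]
    · simp [e]
  rw [this, Finset.card_insert_of_notMem (by simp), pow_succ]
  ring

theorem sgn_swap {s : Finset α} (hs : IsChain (· ≤ ·) (↑s : Set α)) {v w : α} (hv : v ∈ s)
    (hw : w ∈ s) (hne : v ≠ w) :
    chainSgn α s v * chainSgn α (s.erase v) w = - (chainSgn α s w * chainSgn α (s.erase w) v) := by
  rcases hs hv hw hne with h | h
  · have h := lt_of_le_of_ne h hne
    rw [sgn_erase_of_lt h, sgn_erase_of_gt h hv]; ring
  · have h := lt_of_le_of_ne h hne.symm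
    rw [sgn_erase_of_lt h, sgn_erase_of_gt h hw]; ring

theorem DD {P : Finset α → Prop} (hP : Good P) {n : ℤ} {c : Finset α →₀ ℤ} (hc : c ∈ C P n) :
    D P (D P c) = 0 := by
  refine C_ext (D P ∘ₗ D P) 0 (fun s h1 h2 => ?_) hc
  have key : D P (D P (Finsupp.single s 1)) = ∑ v ∈ s, ∑ w ∈ s,
      if v ≠ w ∧ P ((s.erase v).erase w) then
        (chainSgn α s v * chainSgn α (s.erase v) w) • Finsupp.single ((s.erase v).erase w) (1 : ℤ)
      else 0 := by
    rw [D_single, map_sum]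
    refine Finset.sum_congr rfl fun v hv => ?_
    rw [map_smul]
    have e : D P (if P (s.erase v) then Finsupp.single (s.erase v) (1 : ℤ) else 0) =
        ∑ w ∈ s.erase v, chainSgn α (s.erase v) w • if P ((s.erase v).erase w) then
          Finsupp.single ((s.erase v).erase w) (1 : ℤ) else 0 := by
      by_cases h : P (s.erase v)
      · rw [if_pos h, D_single]
      · rw [if_neg h, map_zero]
        symm
        refine Finset.sum_eq_zero fun w _ => ?_
        rw [if_neg (fun h' => h (hP.2 s v w h1 h')), smul_zero]
    rw [e, Finset.smul_sum, ← Finset.filter_ne', Finset.sum_filter]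
    refine Finset.sum_congr rfl fun w hw => ?_
    rw [Finset.filter_ne']
    by_cases h : w = v
    · simp [h]
    · by_cases h' : P ((s.erase v).erase w)
      · simp only [ne_eq, h, not_false_eq_true, if_true, h', Ne.symm h, and_self, smul_smul]
      · simp [h']
  have neg : D P (D P (Finsupp.single s 1)) = - D P (D P (Finsupp.single s 1)) := by
    conv_lhs => rw [key, Finset.sum_comm]
    rw [key, ← Finset.sum_neg_distrib]
    refine Finset.sum_congr rfl fun v hv => ?_
    rw [← Finset.sum_neg_distrib]
    refine Finset.sum_congr rfl fun w hw => ?_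
    rw [Finset.erase_right_comm (a := w) (b := v)]
    by_cases h : v = w
    · simp [h]
    · by_cases h' : P ((s.erase v).erase w)
      · rw [if_pos ⟨Ne.symm h, h'⟩, if_pos ⟨h, h'⟩, sgn_swap (hP.1 s h1) hw hv (Ne.symm h), neg_smul]
      · simp [h']
  simpa using self_eq_neg.mp neg

/-- cycles -/
noncomputable abbrev Z (P : Finset α → Prop) (n : ℤ) : Submodule ℤ (Finset α →₀ ℤ) :=
  C P n ⊓ LinearMap.ker (D P)

/-- boundaries -/
noncomputable abbrev B (P : Finset α → Prop) (n : ℤ) : Submodule ℤ (Finset α →₀ ℤ) :=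
  (C P (n + 1)).map (D P)

abbrev H (P : Finset α → Prop) (n : ℤ) : Type u := (Z P n) ⧸ (B P n).submoduleOf (Z P n)

theorem mem_Z {P : Finset α → Prop} {n : ℤ} {c : Finset α →₀ ℤ} :
    c ∈ Z P n ↔ c ∈ C P n ∧ D P c = 0 := by
  rw [Z, Submodule.mem_inf, LinearMap.mem_ker]

theorem mem_B {P : Finset α → Prop} {n : ℤ} {c : Finset α →₀ ℤ} :
    c ∈ B P n ↔ ∃ b ∈ C P (n + 1), D P b = c := by
  rw [B, Submodule.mem_map]

theorem mem_sub {A V : Type*} [Ring A] [AddCommGroup V] [Module A V] (K L : Submodule A V) (z : L) :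
    z ∈ K.submoduleOf L ↔ (z : V) ∈ K := by
  rw [Submodule.submoduleOf, Submodule.mem_comap, Submodule.subtype_apply]

theorem mk_eq_zero {P : Finset α → Prop} {n : ℤ} (z : Z P n) :
    ((B P n).submoduleOf (Z P n)).mkQ z = 0 ↔ (z : Finset α →₀ ℤ) ∈ B P n := by
  rw [Submodule.mkQ_apply, Submodule.Quotient.mk_eq_zero, mem_sub]

theorem mk_eq_mk {P : Finset α → Prop} {n : ℤ} (z w : Z P n) :
    ((B P n).submoduleOf (Z P n)).mkQ z = ((B P n).submoduleOf (Z P n)).mkQ w ↔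
      (z : Finset α →₀ ℤ) - w ∈ B P n := by
  rw [Submodule.mkQ_apply, Submodule.mkQ_apply, Submodule.Quotient.eq, mem_sub,
    Submodule.coe_sub]

theorem H_iso {P : Finset α → Prop} {n : ℤ} {W : Type*} [AddCommGroup W] [Module ℤ W]
    (f : Z P n →ₗ[ℤ] W) (hs : ∀ w, ∃ z, f z = w)
    (hk : ∀ z, f z = 0 ↔ (z : Finset α →₀ ℤ) ∈ B P n) : Nonempty (H P n ≃+ W) := by
  have e : (B P n).submoduleOf (Z P n) = LinearMap.ker f := by
    ext z
    rw [LinearMap.mem_ker, hk, mem_sub]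
  exact ⟨((Submodule.quotEquivOfEq _ _ e).trans (f.quotKerEquivOfSurjective hs)).toAddEquiv⟩

/-- acyclicity in one degree -/
def Acyc (P : Finset α → Prop) (n : ℤ) : Prop :=
  ∀ c ∈ C P n, D P c = 0 → ∃ b ∈ C P (n + 1), D P b = c

theorem acyc_iff {P : Finset α → Prop} {n : ℤ} : Acyc P n ↔ Subsingleton (H P n) := by
  rw [Submodule.Quotient.subsingleton_iff, Submodule.eq_top_iff']
  constructor
  · intro h x
    have hx := x.2
    rw [mem_Z] at hx
    rw [mem_sub, mem_B]
    exact h x.1 hx.1 hx.2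
  · intro h c hc hd
    have := h ⟨c, mem_Z.2 ⟨hc, hd⟩⟩
    rwa [mem_sub, mem_B] at this

/-! Extension step. -/

section ext
variable {P Q : Finset α → Prop}

theorem D_sub (hQP : ∀ s, Q s → P s) (hQ : ∀ s v, Q s → P (s.erase v) → Q (s.erase v)) {n : ℤ}
    {c : Finset α →₀ ℤ} (hc : c ∈ C Q n) : D P c = D Q c := by
  refine C_ext _ _ (fun s h1 h2 => ?_) hc
  rw [D_single, D_single]
  refine Finset.sum_congr rfl fun v _ => ?_
  rw [show P (s.erase v) = Q (s.erase v) from propext ⟨hQ s v h1, hQP _⟩]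

theorem pr_mem {R : Finset α → Prop} (hRP : ∀ s, R s → P s) {n : ℤ} {c : Finset α →₀ ℤ}
    (hc : c ∈ C P n) : pr R c ∈ C R n := by
  refine C_map _ (fun s h1 h2 => ?_) hc
  rw [pr_single]
  split_ifs with h
  · exact single_mem_C h h2
  · exact Submodule.zero_mem _

theorem pr_self {n : ℤ} {c : Finset α →₀ ℤ} (hc : c ∈ C P n) : pr P c = c := by
  refine C_ext (pr P) LinearMap.id (fun s h1 h2 => ?_) hc
  rw [pr_single, if_pos h1]; rfl

theorem pr_Q {n : ℤ} {c : Finset α →₀ ℤ} (hc : c ∈ C Q n) : pr (fun s => P s ∧ ¬ Q s) c = 0 := by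
  refine C_ext (pr (fun s => P s ∧ ¬ Q s)) 0 (fun s h1 h2 => ?_) hc
  rw [pr_single, if_neg (by tauto)]; rfl

theorem pr_D (hQ : ∀ s v, Q s → P (s.erase v) → Q (s.erase v)) {n : ℤ}
    {c : Finset α →₀ ℤ} (hc : c ∈ C P n) :
    pr (fun s => P s ∧ ¬ Q s) (D P c) =
      D (fun s => P s ∧ ¬ Q s) (pr (fun s => P s ∧ ¬ Q s) c) := by
  refine C_ext (pr (fun s => P s ∧ ¬ Q s) ∘ₗ D P)
    (D (fun s => P s ∧ ¬ Q s) ∘ₗ pr (fun s => P s ∧ ¬ Q s)) (fun s h1 h2 => ?_) hc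
  rw [LinearMap.comp_apply, LinearMap.comp_apply, D_single, pr_single, map_sum]
  by_cases h : Q s
  · rw [if_neg (by tauto), map_zero]
    refine Finset.sum_eq_zero fun v _ => ?_
    rw [map_smul]
    by_cases h' : P (s.erase v)
    · rw [if_pos h', pr_single, if_neg (by have := hQ s v h h'; tauto), smul_zero]
    · rw [if_neg h', map_zero, smul_zero]
  · rw [if_pos ⟨h1, h⟩, D_single]
    refine Finset.sum_congr rfl fun v _ => ?_
    rw [map_smul]
    by_cases h' : P (s.erase v)
    · rw [if_pos h', pr_single]
    · rw [if_neg h', map_zero, if_neg (by tauto)]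

theorem mem_Q_of_pr {n : ℤ} {c : Finset α →₀ ℤ} (hc : c ∈ C P n)
    (h : pr (fun s => P s ∧ ¬ Q s) c = 0) : c ∈ C Q n := by
  have e : c - pr (fun s => P s ∧ ¬ Q s) c ∈ C Q n := by
    refine C_map (LinearMap.id - pr (fun s => P s ∧ ¬ Q s)) (fun s h1 h2 => ?_) hc
    rw [LinearMap.sub_apply, pr_single, LinearMap.id_apply]
    by_cases h : Q s
    · rw [if_neg (by tauto), sub_zero]; exact single_mem_C h h2
    · rw [if_pos ⟨h1, h⟩, sub_self]; exact Submodule.zero_mem _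
  rwa [h, sub_zero] at e

/-- the key diagram chase -/
theorem chase (hP : Good P)
    (hQ : ∀ s v, Q s → P (s.erase v) → Q (s.erase v)) {n : ℤ}
    (hR : Acyc (fun s => P s ∧ ¬ Q s) n) {c : Finset α →₀ ℤ} (hc : c ∈ C P n)
    (hd : pr (fun s => P s ∧ ¬ Q s) (D P c) = 0) :
    ∃ b ∈ C P (n + 1), c - D P b ∈ C Q n ∧ D P (D P b) = 0 := by
  obtain ⟨b, hb, hbc⟩ := hR (pr (fun s => P s ∧ ¬ Q s) c) (pr_mem (fun s h => h.1) hc)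
    (by rw [← pr_D hQ hc, hd])
  have hb' : b ∈ C P (n + 1) := C_mono (fun s h => h.1) hb
  refine ⟨b, hb', mem_Q_of_pr (P := P) (Submodule.sub_mem _ hc (D_mem hb')) ?_, DD hP hb'⟩
  rw [map_sub, pr_D hQ hb', pr_self hb, hbc, sub_self]

theorem acyc_ext (hP : Good P) (hQP : ∀ s, Q s → P s)
    (hQ : ∀ s v, Q s → P (s.erase v) → Q (s.erase v)) {n : ℤ} (aQ : Acyc Q n)
    (hR : Acyc (fun s => P s ∧ ¬ Q s) n) : Acyc P n := by
  intro c hc hd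
  obtain ⟨b, hb, h1, h2⟩ := chase hP hQ hR hc (by rw [hd, map_zero])
  obtain ⟨a, ha, ha'⟩ := aQ _ h1 (by rw [← D_sub hQP hQ h1, map_sub, hd, h2, sub_zero])
  refine ⟨a + b, Submodule.add_mem _ (C_mono hQP ha) hb, ?_⟩
  rw [map_add, D_sub hQP hQ ha, ha']; abel

theorem Z_le (hQP : ∀ s, Q s → P s)
    (hQ : ∀ s v, Q s → P (s.erase v) → Q (s.erase v)) (n : ℤ) : Z Q n ≤ Z P n := by
  intro c hc
  rw [mem_Z] at hc ⊢
  exact ⟨C_mono hQP hc.1, by rw [D_sub hQP hQ hc.1, hc.2]⟩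

theorem H_ext (hP : Good P) (hQP : ∀ s, Q s → P s)
    (hQ : ∀ s v, Q s → P (s.erase v) → Q (s.erase v))
    (hR : ∀ n, Acyc (fun s => P s ∧ ¬ Q s) n) (n : ℤ) : Nonempty (H Q n ≃+ H P n) := by
  refine H_iso (((B P n).submoduleOf (Z P n)).mkQ ∘ₗ Submodule.inclusion (Z_le hQP hQ n)) ?_ ?_
  · intro w
    obtain ⟨⟨c, hc⟩, rfl⟩ := Submodule.mkQ_surjective _ w
    have hc' := hc
    rw [mem_Z] at hc'
    obtain ⟨hc1, hd⟩ := hc'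
    obtain ⟨b, hb, h1, h2⟩ := chase hP hQ (hR n) hc1 (by rw [hd, map_zero])
    have hz : c - D P b ∈ Z Q n := by
      rw [mem_Z, ← D_sub hQP hQ h1, map_sub, hd, h2, sub_zero]
      exact ⟨h1, rfl⟩
    refine ⟨⟨c - D P b, hz⟩, ?_⟩
    rw [LinearMap.comp_apply, mk_eq_mk, Submodule.coe_inclusion, mem_B]
    refine ⟨-b, Submodule.neg_mem _ hb, ?_⟩
    rw [map_neg, sub_sub_cancel_left]
  · intro z
    have hz := z.2
    rw [mem_Z] at hz
    rw [LinearMap.comp_apply, mk_eq_zero, Submodule.coe_inclusion, mem_B, mem_B]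
    constructor
    · rintro ⟨b, hb, hbc⟩
      obtain ⟨e, he, h1, h2⟩ := chase hP hQ (hR (n + 1)) hb (by rw [hbc]; exact pr_Q hz.1)
      refine ⟨b - D P e, h1, ?_⟩
      rw [← D_sub hQP hQ h1, map_sub, h2, sub_zero, hbc]
    · rintro ⟨b, hb, hbc⟩
      exact ⟨b, C_mono hQP hb, by rw [D_sub hQP hQ hb, hbc]⟩

end ext

/-! Bridge. -/

theorem e_cast {G : ℤ → Type*} [∀ n, AddCommGroup (G n)] {W : Type*} [AddCommGroup W]
    (e : ∀ n, G n →+ W) {m n : ℤ} (h : m = n) (x : G m) : e n (castAddEquiv G h x) = e m x := by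
  subst h; rfl

theorem bridge {G : ℤ → Type*} [∀ n, AddCommGroup (G n)] (d : (n : ℤ) → G n →+ G (n - 1))
    (P : Finset α → Prop) (e : ∀ n, G n →+ (Finset α →₀ ℤ))
    (inj : ∀ n, Function.Injective (e n)) (rng : ∀ n c, c ∈ C P n ↔ ∃ g, e n g = c)
    (comm : ∀ n g, e (n - 1) (d n g) = D P (e n g)) (n : ℤ) :
    Nonempty (gradedHomology G d n ≃+ H P n) := by
  have hz : ∀ g : (d n).ker, e n g ∈ Z P n := by
    intro g
    rw [mem_Z, ← comm, g.2, map_zero]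
    exact ⟨(rng n _).2 ⟨_, rfl⟩, rfl⟩
  let f0 : (d n).ker →+ Z P n := AddMonoidHom.mk' (fun g => ⟨e n g, hz g⟩) (by
    intro a b
    apply Subtype.ext
    simp only [AddSubgroup.coe_add, map_add, Submodule.coe_add])
  let f : (d n).ker →+ H P n := ((B P n).submoduleOf (Z P n)).mkQ.toAddMonoidHom.comp f0
  have f_eq : ∀ g, f g = ((B P n).submoduleOf (Z P n)).mkQ (f0 g) := fun g => rfl
  have hs : Function.Surjective f := by
    intro w
    obtain ⟨⟨c, hc⟩, rfl⟩ := Submodule.mkQ_surjective _ w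
    have hc' := hc
    rw [mem_Z] at hc'
    obtain ⟨g, rfl⟩ := (rng n c).1 hc'.1
    refine ⟨⟨g, ?_⟩, rfl⟩
    rw [AddMonoidHom.mem_ker]
    apply inj
    rw [comm, hc'.2, map_zero]
  have hk : (boundariesOf G d n).addSubgroupOf (d n).ker = f.ker := by
    ext g
    rw [AddMonoidHom.mem_ker, f_eq, mk_eq_zero, mem_B, AddSubgroup.mem_addSubgroupOf]
    change _ ↔ ∃ b ∈ C P (n + 1), D P b = e n g
    unfold boundariesOf
    rw [AddSubgroup.mem_map]
    constructor
    · rintro ⟨x, ⟨y, rfl⟩, hx⟩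
      refine ⟨e (n + 1) y, (rng _ _).2 ⟨y, rfl⟩, ?_⟩
      rw [← comm, ← hx]
      exact (e_cast e (show n + 1 - 1 = n by ring) _).symm
    · rintro ⟨b, hb, hbg⟩
      obtain ⟨y, rfl⟩ := (rng _ _).1 hb
      refine ⟨d (n + 1) y, ⟨y, rfl⟩, inj n ?_⟩
      rw [← hbg, ← comm]
      exact e_cast e (show n + 1 - 1 = n by ring) _
  exact ⟨(QuotientAddGroup.quotientAddEquivOfEq hk).trans
    (QuotientAddGroup.quotientKerEquivOfSurjective f hs)⟩

def RP (S : Set α) (s : Finset α) : Prop := (↑s : Set α) ⊆ S ∧ IsChain (· ≤ ·) (↑s : Set α)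

def FP (S A : Set α) (s : Finset α) : Prop :=
  (↑s : Set α) ⊆ S ∧ IsChain (· ≤ ·) (↑s : Set α) ∧ ¬ (↑s : Set α) ⊆ A

theorem rng_aux {P : Finset α → Prop} {n : ℤ} {T : Type u} (v : T → Finset α)
    (hv : ∀ s, (P s ∧ (s.card : ℤ) = n + 1) ↔ ∃ t, v t = s) (c : Finset α →₀ ℤ) :
    c ∈ C P n ↔ ∃ g : T →₀ ℤ, Finsupp.mapDomain.addMonoidHom v g = c := by
  constructor
  · intro hc
    have : c ∈ LinearMap.range (Finsupp.lmapDomain ℤ ℤ v) := by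
      refine C_induct _ (fun s h1 h2 => ?_) hc
      obtain ⟨t, rfl⟩ := (hv s).1 ⟨h1, h2⟩
      exact ⟨Finsupp.single t 1, by simp⟩
    obtain ⟨g, hg⟩ := this
    exact ⟨g, hg⟩
  · rintro ⟨g, rfl⟩
    induction g using Finsupp.induction_linear with
    | zero => rw [map_zero]; exact Submodule.zero_mem _
    | add f g hf hg => rw [map_add]; exact Submodule.add_mem _ hf hg
    | single t b =>
      have h := (hv (v t)).2 ⟨t, rfl⟩
      have : Finsupp.mapDomain.addMonoidHom v (Finsupp.single t b) =
        b • Finsupp.single (v t) (1 : ℤ) := by simp [Finsupp.mapDomain.addMonoidHom]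
      rw [this]
      exact Submodule.smul_mem _ _ (single_mem_C h.1 h.2)

def rval (S : Set α) (n : ℤ) (s : RChains α S n) : Finset α := s.1

def fval (S A : Set α) (n : ℤ) (s : FChains α S A n) : Finset α := s.1

theorem lift_single {X V : Type*} [AddCommGroup V] (f : X → V) (s : X) :
    (Finsupp.lift V ℤ X f).toAddMonoidHom (Finsupp.single s 1) = f s := by
  change Finsupp.lift V ℤ X f (Finsupp.single s 1) = f s
  rw [Finsupp.lift_apply, Finsupp.sum_single_index, one_smul]
  exact zero_smul _ _

theorem md_single {X Y : Type*} (f : X → Y) (s : X) (b : ℤ) :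
    Finsupp.mapDomain.addMonoidHom f (Finsupp.single s b) = Finsupp.single (f s) b :=
  Finsupp.mapDomain_single

theorem sum_aux {P : Finset α → Prop} {T : Type*} (v : T → Finset α) (s : Finset α)
    (g : {x // x ∈ s} → (T →₀ ℤ)) (hg : ∀ x, Finsupp.mapDomain.addMonoidHom v (g x) =
      if P (s.erase x.1) then Finsupp.single (s.erase x.1) (1 : ℤ) else 0) :
    Finsupp.mapDomain.addMonoidHom v (∑ x ∈ s.attach, chainSgn α s x.1 • g x) =
      D P (Finsupp.single s 1) := by
  rw [map_sum, D_single, ← Finset.sum_attach s]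
  refine Finset.sum_congr rfl fun x _ => ?_
  rw [map_zsmul, hg]

theorem comm_aux {P : Finset α → Prop} {T T' : Type*} (v : T → Finset α) (v' : T' → Finset α)
    (f : T → (T' →₀ ℤ)) (h : ∀ s, Finsupp.mapDomain.addMonoidHom v' (f s) =
      D P (Finsupp.single (v s) 1)) (g : T →₀ ℤ) :
    Finsupp.mapDomain.addMonoidHom v' ((Finsupp.lift _ ℤ T f).toAddMonoidHom g) =
      D P (Finsupp.mapDomain.addMonoidHom v g) := by
  have : (Finsupp.mapDomain.addMonoidHom v').comp (Finsupp.lift _ ℤ T f).toAddMonoidHom =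
        (D P).toAddMonoidHom.comp (Finsupp.mapDomain.addMonoidHom v) := by
    refine Finsupp.addHom_ext' fun s => AddMonoidHom.ext_int ?_
    rw [AddMonoidHom.comp_apply, AddMonoidHom.comp_apply, AddMonoidHom.comp_apply,
      AddMonoidHom.comp_apply, Finsupp.singleAddHom_apply, lift_single, md_single, h]
    rfl
  exact DFunLike.congr_fun this g

theorem bridgeR (S : Set α) (n : ℤ) : Nonempty (RH α S n ≃+ H (RP S) n) := by
  refine bridge (rd α S) (RP S)
    (fun n => Finsupp.mapDomain.addMonoidHom (rval S n))
    (fun n => Finsupp.mapDomain_injective Subtype.val_injective)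
    (fun n c => rng_aux _ (fun s => ?_) c) (fun n g => ?_) n
  · constructor
    · rintro ⟨⟨h1, h2⟩, h3⟩; exact ⟨⟨s, h1, h2, h3⟩, rfl⟩
    · rintro ⟨t, rfl⟩; exact ⟨⟨t.2.1, t.2.2.1⟩, t.2.2.2⟩
  · refine comm_aux (rval S n) (rval S (n - 1)) _ (fun s => ?_) g
    refine sum_aux (rval S (n - 1)) s.1 _ fun v => ?_
    have hh := erase_spec α s.2.1 s.2.2.1 s.2.2.2 v.2
    rw [if_pos (show RP S (s.1.erase v.1) from ⟨hh.1, hh.2.1⟩)]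
    exact md_single _ _ _

theorem bridgeF (S A : Set α) (n : ℤ) : Nonempty (FH α S A n ≃+ H (FP S A) n) := by
  refine bridge (fd α S A) (FP S A)
    (fun n => Finsupp.mapDomain.addMonoidHom (fval S A n))
    (fun n => Finsupp.mapDomain_injective Subtype.val_injective)
    (fun n c => rng_aux _ (fun s => ?_) c) (fun n g => ?_) n
  · constructor
    · rintro ⟨⟨h1, h2, h4⟩, h3⟩; exact ⟨⟨s, h1, h2, h3, h4⟩, rfl⟩
    · rintro ⟨t, rfl⟩; exact ⟨⟨t.2.1, t.2.2.1, t.2.2.2.2⟩, t.2.2.2.1⟩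
  · refine comm_aux (fval S A n) (fval S A (n - 1)) _ (fun s => ?_) g
    refine sum_aux (fval S A (n - 1)) s.1 _ fun v => ?_
    have hh := erase_spec α s.2.1 s.2.2.1 s.2.2.2.1 v.2
    by_cases h : ¬(↑(s.1.erase v.1) : Set α) ⊆ A
    · rw [if_pos (show FP S A (s.1.erase v.1) from ⟨hh.1, hh.2.1, h⟩), dif_pos h]
      exact md_single _ _ _
    · rw [if_neg (show ¬ FP S A (s.1.erase v.1) from fun h' => h h'.2.2), dif_neg h]
      exact map_zero _

theorem acycR {S : Set α} {n : ℤ} : Acyc (RP S) n ↔ Subsingleton (RH α S n) := by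
  obtain ⟨e⟩ := bridgeR S n
  rw [acyc_iff]
  exact e.toEquiv.symm.subsingleton_congr

/-! Links. -/

section link
variable [Fintype α] (p : α → Prop) (L : α → Set α)

def LP (s : Finset α) : Prop :=
  IsChain (· ≤ ·) (↑s : Set α) ∧ ∃ x, p x ∧ x ∈ s ∧ (↑(s.erase x) : Set α) ⊆ L x

noncomputable def ins (x : α) : (Finset α →₀ ℤ) →ₗ[ℤ] (Finset α →₀ ℤ) :=
  Finsupp.lift (Finset α →₀ ℤ) ℤ (Finset α) (fun s => Finsupp.single (insert x s) (1 : ℤ))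

noncomputable def cmp (x : α) : (Finset α →₀ ℤ) →ₗ[ℤ] (Finset α →₀ ℤ) :=
  Finsupp.lift (Finset α →₀ ℤ) ℤ (Finset α)
    (fun s => if x ∈ s then Finsupp.single (s.erase x) (1 : ℤ) else 0)

theorem ins_single (x : α) (s : Finset α) :
    ins x (Finsupp.single s 1) = Finsupp.single (insert x s) (1 : ℤ) := by simp [ins]

theorem cmp_single (x : α) (s : Finset α) : cmp x (Finsupp.single s 1) =
    if x ∈ s then Finsupp.single (s.erase x) (1 : ℤ) else 0 := by simp [cmp]

variable {p L}

theorem chain_insert {x : α} {t : Finset α} (h : IsChain (· ≤ ·) (↑t : Set α))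
    (hx : ∀ a ∈ t, a ≤ x) : IsChain (· ≤ ·) (↑(insert x t) : Set α) := by
  rw [Finset.coe_insert]
  exact h.insert fun b hb _ => Or.inr (hx b hb)

theorem LP_insert (hL : ∀ x, p x → ∀ a ∈ L x, a < x) {x : α} (hx : p x) {t : Finset α}
    (ht : RP (L x) t) : LP p L (insert x t) := by
  refine ⟨chain_insert ht.2 fun a ha => (hL x hx a (ht.1 ha)).le, x, hx, by simp, ?_⟩
  intro a ha
  simp only [Finset.coe_erase, Finset.coe_insert, Set.mem_sdiff, Set.mem_insert_iff,
    Set.mem_singleton_iff] at ha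
  exact ht.1 (by have := ha.1; simp only [ha.2, false_or] at this; exact this)

theorem LP_erase (hd : ∀ x y, p x → p y → y ∉ L x) {x : α} (hx : p x) {s : Finset α}
    (hs : LP p L s) (hxs : x ∈ s) : RP (L x) (s.erase x) := by
  obtain ⟨hc, y, hy, hys, hsub⟩ := hs
  have : x = y := by
    by_contra hne
    exact hd y x hy hx (hsub (by simp [hne, hxs]))
  subst this
  exact ⟨hsub, hc.mono (by simp)⟩

theorem ins_mem (hL : ∀ x, p x → ∀ a ∈ L x, a < x) {x : α} (hx : p x) {n : ℤ}
    {b : Finset α →₀ ℤ} (hb : b ∈ C (RP (L x)) n) : ins x b ∈ C (LP p L) (n + 1) := by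
  refine C_map _ (fun s h1 h2 => ?_) hb
  rw [ins_single]
  refine single_mem_C (LP_insert hL hx h1) ?_
  rw [Finset.card_insert_of_notMem (fun h => (hL x hx x (h1.1 h)).false)]
  push_cast
  rw [h2]

theorem cmp_mem (hd : ∀ x y, p x → p y → y ∉ L x) {x : α} (hx : p x) {n : ℤ}
    {c : Finset α →₀ ℤ} (hc : c ∈ C (LP p L) (n + 1)) : cmp x c ∈ C (RP (L x)) n := by
  refine C_map _ (fun s h1 h2 => ?_) hc
  rw [cmp_single]
  split_ifs with h
  · exact single_mem_C (LP_erase hd hx h1 h) (card_erase' h h2)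
  · exact Submodule.zero_mem _

theorem D_ins (hL : ∀ x, p x → ∀ a ∈ L x, a < x) (hd : ∀ x y, p x → p y → y ∉ L x)
    {x : α} (hx : p x) {n : ℤ}
    {b : Finset α →₀ ℤ} (hb : b ∈ C (RP (L x)) n) :
    D (LP p L) (ins x b) = ins x (D (RP (L x)) b) := by
  refine C_ext (D (LP p L) ∘ₗ ins x) (ins x ∘ₗ D (RP (L x))) (fun t h1 h2 => ?_) hb
  have hxt : x ∉ t := fun h => (hL x hx x (h1.1 h)).false
  rw [LinearMap.comp_apply, LinearMap.comp_apply, ins_single, D_single, D_single,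
    Finset.sum_insert hxt, Finset.erase_insert hxt, map_sum, if_neg, smul_zero, zero_add]
  · refine Finset.sum_congr rfl fun v hv => ?_
    have hvx : v < x := hL x hx v (h1.1 hv)
    have h3 : RP (L x) (t.erase v) :=
      ⟨fun a ha => h1.1 (Finset.mem_of_mem_erase ha), h1.2.mono (by simp)⟩
    rw [map_smul, if_pos h3, ins_single, Finset.erase_insert_of_ne hvx.ne',
      if_pos (LP_insert hL hx h3), ← sgn_erase_of_lt hvx, Finset.erase_insert hxt]
  · rintro ⟨_, y, hy, hyt, _⟩
    exact hd x y hx hy (h1.1 hyt)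

theorem cmp_ins (hd : ∀ x y, p x → p y → y ∉ L x) {x y : α} (hx : p x) (hy : p y) {n : ℤ}
    {b : Finset α →₀ ℤ} (hb : b ∈ C (RP (L y)) n) :
    cmp x (ins y b) = if x = y then b else 0 := by
  have : cmp x (ins y b) = (if x = y then LinearMap.id else 0 : (Finset α →₀ ℤ) →ₗ[ℤ] (Finset α →₀ ℤ)) b := by
    refine C_ext (cmp x ∘ₗ ins y) _ (fun t h1 h2 => ?_) hb
    have hxt : x ∉ t := fun h => hd y x hy hx (h1.1 h)
    rw [LinearMap.comp_apply, ins_single, cmp_single]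
    by_cases h : x = y
    · subst h
      simp [Finset.erase_insert hxt]
    · simp [h, hxt]
  rw [this]
  split_ifs <;> rfl

theorem sum_ins_cmp (hd : ∀ x y, p x → p y → y ∉ L x) {n : ℤ}
    {c : Finset α →₀ ℤ} (hc : c ∈ C (LP p L) n) :
    ∑ x : {x // p x}, ins x.1 (cmp x.1 c) = c := by
  have : (∑ x : {x // p x}, ins x.1 ∘ₗ cmp x.1) c =
      (LinearMap.id : (Finset α →₀ ℤ) →ₗ[ℤ] (Finset α →₀ ℤ)) c := by
    refine C_ext _ _ (fun s h1 h2 => ?_) hc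
    rw [LinearMap.sum_apply]
    obtain ⟨hch, x, hx, hxs, hsub⟩ := id h1
    rw [Finset.sum_eq_single (⟨x, hx⟩ : {x // p x})]
    · rw [LinearMap.comp_apply, cmp_single, if_pos hxs, ins_single, Finset.insert_erase hxs]; rfl
    · intro y _ hne
      rw [LinearMap.comp_apply, cmp_single, if_neg, map_zero]
      intro hys
      refine hd x y.1 hx y.2 (hsub ?_)
      rw [Finset.mem_coe, Finset.mem_erase]
      exact ⟨fun h => hne (Subtype.ext h), hys⟩
    · intro h; exact absurd (Finset.mem_univ _) h
  rw [LinearMap.sum_apply] at this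
  exact this

theorem D_cmp (hL : ∀ x, p x → ∀ a ∈ L x, a < x) (hd : ∀ x y, p x → p y → y ∉ L x)
    {x : α} (hx : p x) {n : ℤ}
    {c : Finset α →₀ ℤ} (hc : c ∈ C (LP p L) (n + 1 + 1)) :
    D (RP (L x)) (cmp x c) = cmp x (D (LP p L) c) := by
  conv_rhs => rw [← sum_ins_cmp hd hc]
  rw [map_sum, map_sum, Finset.sum_eq_single (⟨x, hx⟩ : {x // p x})]
  · rw [D_ins hL hd hx (cmp_mem hd hx hc), cmp_ins hd hx hx (D_mem (cmp_mem hd hx hc)), if_pos rfl]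
  · intro y _ hne
    rw [D_ins hL hd y.2 (cmp_mem hd y.2 hc), cmp_ins hd hx y.2 (D_mem (cmp_mem hd y.2 hc)),
      if_neg]
    intro h
    exact hne (Subtype.ext h.symm)
  · intro h; exact absurd (Finset.mem_univ _) h

theorem cmp_Z (hL : ∀ x, p x → ∀ a ∈ L x, a < x) (hd : ∀ x y, p x → p y → y ∉ L x)
    {x : α} (hx : p x) (n : ℤ) : ∀ c ∈ Z (LP p L) (n + 1), cmp x c ∈ Z (RP (L x)) n := by
  intro c hc
  rw [mem_Z] at hc ⊢
  refine ⟨cmp_mem hd hx hc.1, ?_⟩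
  obtain ⟨m, rfl⟩ : ∃ m, n = m + 1 := ⟨n - 1, by ring⟩
  rw [D_cmp hL hd hx hc.1, hc.2, map_zero]

theorem link_iso (hL : ∀ x, p x → ∀ a ∈ L x, a < x) (hd : ∀ x y, p x → p y → y ∉ L x) (n : ℤ) :
    Nonempty (H (LP p L) (n + 1) ≃+ ((x : {x // p x}) → H (RP (L x.1)) n)) := by
  refine H_iso (LinearMap.pi fun x : {x // p x} =>
    ((B (RP (L x.1)) n).submoduleOf (Z (RP (L x.1)) n)).mkQ ∘ₗ
      (cmp x.1).restrict (cmp_Z hL hd x.2 n)) ?_ ?_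
  · intro w
    choose z hz using fun x => Submodule.mkQ_surjective _ (w x)
    have hz' : ∀ x : {x // p x}, (z x).1 ∈ C (RP (L x.1)) n ∧ D (RP (L x.1)) (z x).1 = 0 :=
      fun x => mem_Z.1 (z x).2
    have hm : ∑ x : {x // p x}, ins x.1 (z x).1 ∈ Z (LP p L) (n + 1) := by
      refine Submodule.sum_mem _ fun x _ => ?_
      rw [mem_Z, D_ins hL hd x.2 (hz' x).1, (hz' x).2, map_zero]
      exact ⟨ins_mem hL x.2 (hz' x).1, rfl⟩
    refine ⟨⟨_, hm⟩, ?_⟩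
    funext x
    rw [LinearMap.pi_apply, LinearMap.comp_apply, ← hz x]
    congr 1
    apply Subtype.ext
    rw [LinearMap.coe_restrict_apply]
    simp only []
    rw [map_sum, Finset.sum_eq_single x]
    · rw [cmp_ins hd x.2 x.2 (hz' x).1, if_pos rfl]
    · intro y _ hne
      rw [cmp_ins hd x.2 y.2 (hz' y).1, if_neg]
      intro h
      exact hne (Subtype.ext h.symm)
    · intro h; exact absurd (Finset.mem_univ _) h
  · intro z
    have hz := mem_Z.1 z.2
    rw [funext_iff, mem_B]
    constructor
    · intro h
      have h' : ∀ x : {x // p x}, ∃ b ∈ C (RP (L x.1)) (n + 1), D (RP (L x.1)) b = cmp x.1 z.1 := by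
        intro x
        have := h x
        rw [LinearMap.pi_apply, LinearMap.comp_apply, Pi.zero_apply, mk_eq_zero, mem_B,
          LinearMap.coe_restrict_apply] at this
        exact this
      choose b hb hbz using h'
      have hm : ∑ x : {x // p x}, ins x.1 (b x) ∈ C (LP p L) (n + 1 + 1) :=
        Submodule.sum_mem _ fun x _ => ins_mem hL x.2 (hb x)
      refine ⟨_, hm, ?_⟩
      rw [map_sum, ← sum_ins_cmp hd hz.1]
      refine Finset.sum_congr rfl fun x _ => ?_
      rw [D_ins hL hd x.2 (hb x), hbz]
    · rintro ⟨b, hb, hbz⟩ x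
      rw [LinearMap.pi_apply, LinearMap.comp_apply, Pi.zero_apply, mk_eq_zero, mem_B,
        LinearMap.coe_restrict_apply]
      exact ⟨cmp x.1 b, cmp_mem hd x.2 hb, by rw [D_cmp hL hd x.2 hb, hbz]⟩

end link

theorem link_acyc [Fintype α] {x : α} {S : Set α} (hS : ∀ a ∈ S, a < x) {n : ℤ} (h : Acyc (RP S) (n - 1)) :
    Acyc (LP (fun a => a = x) (fun _ => S)) n := by
  obtain ⟨m, rfl⟩ : ∃ m, n = m + 1 := ⟨n - 1, by ring⟩
  rw [add_sub_cancel_right, acyc_iff] at h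
  obtain ⟨e⟩ := link_iso (p := fun a => a = x) (L := fun _ => S)
    (by rintro _ rfl; exact hS) (by rintro _ _ _ rfl h; exact (hS _ h).false) m
  rw [acyc_iff]
  exact e.toEquiv.subsingleton

/-! Cones. -/

noncomputable def hmt (z : α) : (Finset α →₀ ℤ) →ₗ[ℤ] (Finset α →₀ ℤ) :=
  Finsupp.lift (Finset α →₀ ℤ) ℤ (Finset α)
    (fun s => if z ∈ s then 0 else (-1 : ℤ) ^ s.card • Finsupp.single (insert z s) (1 : ℤ))

theorem hmt_single (z : α) (s : Finset α) : hmt z (Finsupp.single s 1) =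
    if z ∈ s then 0 else (-1 : ℤ) ^ s.card • Finsupp.single (insert z s) (1 : ℤ) := by
  rw [hmt, Finsupp.lift_apply, Finsupp.sum_single_index, one_smul]
  exact zero_smul _ _

theorem sgn_top {s : Finset α} {z : α} (hz : ∀ a ∈ s, a ≤ z) :
    chainSgn α s z = (-1) ^ (s.erase z).card := by
  unfold chainSgn
  congr 2
  ext a
  simp only [Finset.mem_filter, Finset.mem_erase]
  constructor
  · rintro ⟨h1, h2⟩; exact ⟨h2.ne, h1⟩
  · rintro ⟨h1, h2⟩; exact ⟨h2, lt_of_le_of_ne (hz a h2) h1⟩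

theorem cone_acyc {P : Finset α → Prop} {z : α} (h1 : ∀ s, P s → P (insert z s))
    (h2 : ∀ s, P s → P (s.erase z)) (h3 : ∀ s, P s → ∀ a ∈ s, a ≤ z) (n : ℤ) : Acyc P n := by
  intro c hc hd
  have key : D P (hmt z c) + hmt z (D P c) = c := by
    refine C_ext (D P ∘ₗ hmt z + hmt z ∘ₗ D P) LinearMap.id (fun s hs _ => ?_) hc
    rw [LinearMap.add_apply, LinearMap.comp_apply, LinearMap.comp_apply, hmt_single, D_single,
      LinearMap.id_apply]
    by_cases hz : z ∈ s
    · rw [if_pos hz, map_zero, zero_add, map_sum, Finset.sum_eq_single z]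
      · rw [map_smul, if_pos (h2 s hs), hmt_single, if_neg (by simp), Finset.insert_erase hz,
          sgn_top (h3 s hs), smul_smul, ← mul_pow]
        simp
      · intro v _ hne
        rw [map_smul]
        split_ifs
        · rw [hmt_single, if_pos (Finset.mem_erase.2 ⟨hne.symm, hz⟩), smul_zero]
        · rw [map_zero, smul_zero]
      · intro h; exact absurd hz h
    · rw [if_neg hz, map_smul, D_single, Finset.sum_insert hz, Finset.erase_insert hz, if_pos hs,
        sgn_top (h3 _ (h1 s hs)), Finset.erase_insert hz, smul_add, smul_smul, ← mul_pow, map_sum,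
        add_assoc, Finset.smul_sum, ← Finset.sum_add_distrib, Finset.sum_eq_zero]
      · simp
      · intro v hv
        have hne : z ≠ v := fun h => hz (h ▸ hv)
        have hlt : v < z := lt_of_le_of_ne (h3 s hs v hv) hne.symm
        have hzv : z ∉ s.erase v := fun h => hz (Finset.mem_of_mem_erase h)
        rw [map_smul, Finset.erase_insert_of_ne hne, ← sgn_erase_of_lt hlt,
          Finset.erase_insert hz]
        by_cases h : P (s.erase v)
        · rw [if_pos h, if_pos (h1 _ h), hmt_single, if_neg hzv, smul_smul, smul_smul, ← add_smul,
            ← Finset.card_erase_add_one hv, pow_succ]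
          convert zero_smul ℤ _ using 2
          ring
        · rw [if_neg h, if_neg, map_zero, smul_zero, smul_zero, add_zero]
          intro h'
          have := h2 _ h'
          rw [Finset.erase_insert hzv] at this
          exact h this
  refine ⟨hmt z c, ?_, by rw [hd, map_zero, add_zero] at key; exact key⟩
  refine C_map _ (fun s hs hn => ?_) hc
  rw [hmt_single]
  split_ifs with hz
  · exact Submodule.zero_mem _
  · refine Submodule.smul_mem _ _ (single_mem_C (h1 s hs) ?_)
    rw [Finset.card_insert_of_notMem hz]
    push_cast
    rw [hn]

theorem goodR (S : Set α) : Good (RP S) :=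
  ⟨fun s h => h.2, fun s v w h _ => ⟨fun a ha => h.1 (Finset.mem_of_mem_erase ha),
    h.2.mono (by simp)⟩⟩

theorem goodF (S A : Set α) : Good (FP S A) :=
  ⟨fun s h => h.2.1, fun s v w h h' => ⟨fun a ha => h.1 (Finset.mem_of_mem_erase ha),
    h.2.1.mono (by simp), fun hA => h'.2.2 fun a ha => hA (Finset.mem_of_mem_erase ha)⟩⟩

theorem FP_closed {S S' A : Set α} (s : Finset α) (v : α) (h : FP S' A s)
    (h' : FP S A (s.erase v)) : FP S' A (s.erase v) :=
  ⟨fun a ha => h.1 (Finset.mem_of_mem_erase ha), h'.2.1, h'.2.2⟩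

theorem rank_lt {ρ : α → ℕ} (hρ : IsQuasicellular α ρ) {a b : α} (h : a < b) : ρ a < ρ b :=
  lt_of_le_of_ne (hρ.1 h.le) fun e => hρ.2.1 (ρ b) (show a ∈ {x | ρ x = ρ b} from e)
    (show b ∈ {x | ρ x = ρ b} from rfl) h.ne h.le

theorem rank_edge [Fintype α] {ρ : α → ℕ} (hρ : IsQuasicellular α ρ) {M : Set (α × α)}
    (hM : IsMatching α M) (hadm : IsHomologicallyAdmissible α M) {y z : α} (h : (y, z) ∈ M) :
    ρ z = ρ y + 1 := by
  by_contra hne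
  refine (hρ.2.2 z).2 ?_
  rw [← acycR]
  have hcov : y ⋖ z := hM.1 _ h
  refine acyc_ext (Q := RP ({a | a < z} \ {y})) (goodR _) ?_ ?_ (acycR.2 (hadm _ h _)) ?_
  · rintro s ⟨h1, h2⟩
    exact ⟨fun a ha => (h1 ha).1, h2⟩
  · rintro s v ⟨h1, h2⟩ ⟨h3, h4⟩
    exact ⟨fun a ha => h1 (Finset.mem_of_mem_erase ha), h4⟩
  · have e : (fun s => RP {a | a < z} s ∧ ¬ RP ({a | a < z} \ {y}) s) =
        LP (fun a => a = y) (fun _ => {a | a < y}) := by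
      funext s
      apply propext
      constructor
      · rintro ⟨⟨h1, h2⟩, h3⟩
        have hy : y ∈ s := by
          by_contra hy
          exact h3 ⟨fun a ha => ⟨h1 ha, fun e => hy (by rw [← show a = y from e]; exact ha)⟩, h2⟩
        refine ⟨h2, y, rfl, hy, fun a ha => ?_⟩
        rw [Finset.mem_coe, Finset.mem_erase] at ha
        rcases h2 ha.2 hy ha.1 with h | h
        · exact lt_of_le_of_ne h ha.1
        · exact absurd (h1 ha.2) (hcov.2 (lt_of_le_of_ne h ha.1.symm))
      · rintro ⟨h2, x, rfl, hx, hsub⟩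
        refine ⟨⟨fun a ha => ?_, h2⟩, fun h => (h.1 hx).2 rfl⟩
        by_cases e : a = x
        · subst e; exact hcov.1
        · exact lt_trans (hsub (Finset.mem_erase.2 ⟨e, ha⟩)) hcov.1
    rw [e]
    exact link_acyc (fun a ha => ha) (acycR.2 ((hρ.2.2 y).1 _ (by omega)))

theorem pair_acyc [Fintype α] {S : Set α} {y z : α} (hyz : y < z) (hy : ∀ a ∈ S, ¬ y ≤ a)
    (hz : ∀ a ∈ S, ¬ z ≤ a) (hsub : ∀ a, a < z → a ≠ y → a ∈ S)
    (hA : ∀ n, Acyc (RP ({a | a < z} \ {y})) n) (n : ℤ) : Acyc (FP (S ∪ {y, z}) S) n := by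
  refine acyc_ext (Q := fun s => FP (S ∪ {y, z}) S s ∧ y ∉ s) (goodF _ _) (fun s h => h.1)
    (fun s v h h' => ⟨h', fun h'' => h.2 (Finset.mem_of_mem_erase h'')⟩) ?_ ?_
  · have e : (fun s => FP (S ∪ {y, z}) S s ∧ y ∉ s) =
        LP (fun a => a = z) (fun _ => {a | a < z} \ {y}) := by
      funext s
      apply propext
      constructor
      · rintro ⟨⟨h1, h2, h3⟩, h4⟩
        have hzs : z ∈ s := by
          by_contra hzs
          refine h3 fun a ha => ?_
          rcases h1 ha with h | h | h
          · exact h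
          · exact absurd ha (by rw [h]; exact h4)
          · exact absurd ha (by rw [show a = z from h]; exact hzs)
        refine ⟨h2, z, rfl, hzs, fun a ha => ?_⟩
        rw [Finset.mem_coe, Finset.mem_erase] at ha
        have hay : a ≠ y := fun h => h4 (h ▸ ha.2)
        refine ⟨?_, hay⟩
        have haS : a ∈ S := by
          rcases h1 ha.2 with h | h | h
          · exact h
          · exact absurd h hay
          · exact absurd h ha.1
        rcases h2 ha.2 hzs ha.1 with h | h
        · exact lt_of_le_of_ne h ha.1
        · exact absurd h (hz a haS)
      · rintro ⟨h2, x, rfl, hx, hs⟩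
        refine ⟨⟨fun a ha => ?_, h2, fun h => hz x (h hx) le_rfl⟩, fun h => ?_⟩
        · by_cases e : a = x
          · right; right; exact e
          · have := hs (Finset.mem_erase.2 ⟨e, ha⟩)
            exact Or.inl (hsub a this.1 this.2)
        · exact (hs (Finset.mem_erase.2 ⟨hyz.ne, h⟩)).2 rfl
    rw [e]
    exact link_acyc (fun a ha => ha.1) (hA _)
  · have key : ∀ s, (FP (S ∪ {y, z}) S s ∧ ¬ (FP (S ∪ {y, z}) S s ∧ y ∉ s)) ↔
        ((↑s : Set α) ⊆ S ∪ {y, z} ∧ IsChain (· ≤ ·) (↑s : Set α) ∧ y ∈ s) := by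
      intro s
      constructor
      · rintro ⟨h1, h2⟩
        exact ⟨h1.1, h1.2.1, by by_contra h; exact h2 ⟨h1, h⟩⟩
      · rintro ⟨h1, h2, h3⟩
        exact ⟨⟨h1, h2, fun h => hy y (h h3) le_rfl⟩, fun h => h.2 h3⟩
    have hle : ∀ s : Finset α, ((↑s : Set α) ⊆ S ∪ {y, z} ∧ IsChain (· ≤ ·) (↑s : Set α) ∧ y ∈ s) →
        ∀ a ∈ s, a ≤ z := by
      rintro s ⟨h1, h2, h3⟩ a ha
      rcases h1 ha with h | h | h
      · have hay : a ≠ y := fun e => hy a h e.ge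
        rcases h2 ha h3 hay with h' | h'
        · exact h'.trans hyz.le
        · exact absurd h' (hy a h)
      · rw [h]; exact hyz.le
      · exact le_of_eq h
    refine cone_acyc (z := z) (fun s h => ?_) (fun s h => ?_) (fun s h => ?_) n
    · rw [key] at h ⊢
      refine ⟨?_, chain_insert h.2.1 (hle s h), Finset.mem_insert_of_mem h.2.2⟩
      intro a ha
      rw [Finset.mem_coe, Finset.mem_insert] at ha
      rcases ha with rfl | ha
      · right; right; rfl
      · exact h.1 ha
    · rw [key] at h ⊢
      exact ⟨fun a ha => h.1 (Finset.mem_of_mem_erase ha), h.2.1.mono (by simp),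
        Finset.mem_erase.2 ⟨hyz.ne, h.2.2⟩⟩
    · rw [key] at h
      exact hle s h

def ST (M : Set (α × α)) (B0 : Set α) (T : Finset α) : Set α :=
  B0 ∪ {a | ∃ y ∈ T, a = y ∨ (y, a) ∈ M}

theorem pairs_acyc [Fintype α] {ρ : α → ℕ} (hρ : IsQuasicellular α ρ) {M : Set (α × α)}
    (hM : IsMorseMatching α M) (hadm : IsHomologicallyAdmissible α M) (n : ℕ) (B0 : Set α)
    (hB : ∀ a ∈ B0, ρ a ≤ n) (hB' : ∀ y z, (y, z) ∈ M → ρ y = n → y ∉ B0)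
    (k : ℤ) (T : Finset α) :
    (∀ y ∈ T, ρ y = n ∧ ∃ z, (y, z) ∈ M) →
    (∀ y ∈ T, ∀ z, (y, z) ∈ M → ∀ a, a < z → a ≠ y → a ∈ B0 ∨ a ∈ T) →
    Acyc (FP (ST M B0 T) B0) k := by
  induction T using Finset.strongInduction with
  | H T ih =>
  intro hT hcl
  by_cases hne : T.Nonempty
  · have hwf : WellFounded (Relation.TransGen (MorseStep M)) := by
      haveI : IsTrans α (Relation.TransGen (MorseStep M)) := ⟨fun _ _ _ => Relation.TransGen.trans⟩
      haveI : Std.Irrefl (Relation.TransGen (MorseStep M)) := ⟨hM.2⟩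
      exact Finite.wellFounded_of_trans_of_irrefl _
    obtain ⟨y, hyT, hmin⟩ := hwf.has_min (↑T : Set α) hne
    obtain ⟨hyn, z, hyz⟩ := hT y hyT
    have uniq : ∀ y' z', (y', z') ∈ M → (y = y' ∨ y = z' ∨ z = y' ∨ z = z') → y' = y ∧ z' = z := by
      intro y' z' h' hor
      have : ((y', z') : α × α) = (y, z) := by
        rcases hor with h | h | h | h
        · exact hM.1.2 y _ h' _ hyz (Or.inl h) (Or.inl rfl)
        · exact hM.1.2 y _ h' _ hyz (Or.inr h) (Or.inl rfl)
        · exact hM.1.2 z _ h' _ hyz (Or.inl h) (Or.inr rfl)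
        · exact hM.1.2 z _ h' _ hyz (Or.inr h) (Or.inr rfl)
      exact ⟨congrArg Prod.fst this, congrArg Prod.snd this⟩
    have hlt : y < z := (hM.1.1 _ hyz).1
    have hzn : ρ z = n + 1 := by rw [rank_edge hρ hM.1 hadm hyz, hyn]
    -- no other pair lies above `y`
    have habove : ∀ y' ∈ T, ∀ z', (y', z') ∈ M → y' ≠ y → ¬ y ≤ z' := by
      intro y' hy' z' hm hne' hle
      have hyz' : y < z' := lt_of_le_of_ne hle fun e => hne' (uniq y' z' hm (Or.inr (Or.inl e))).1
      have hz'n : ρ z' = n + 1 := by rw [rank_edge hρ hM.1 hadm hm, (hT y' hy').1]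
      refine hmin y' hy' (Relation.TransGen.tail (Relation.TransGen.single (Or.inl hm))
        (Or.inr ⟨⟨hyz', fun c h1 h2 => ?_⟩, fun h => ?_⟩))
      · have := rank_lt hρ h1
        have := rank_lt hρ h2
        omega
      · have := hM.1.2 z' _ hm _ h (Or.inr rfl) (Or.inr rfl)
        exact hne' (congrArg Prod.fst this)
    have hST : ST M B0 T = ST M B0 (T.erase y) ∪ {y, z} := by
      ext a
      simp only [ST, Set.mem_union, Set.mem_setOf_eq, Set.mem_insert_iff, Set.mem_singleton_iff]
      constructor
      · rintro (h | ⟨y', h1, h2⟩)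
        · exact Or.inl (Or.inl h)
        · by_cases e : y' = y
          · subst e
            rcases h2 with h2 | h2
            · exact Or.inr (Or.inl h2)
            · exact Or.inr (Or.inr (uniq _ _ h2 (Or.inl rfl)).2)
          · exact Or.inl (Or.inr ⟨y', Finset.mem_erase.2 ⟨e, h1⟩, h2⟩)
      · rintro ((h | ⟨y', h1, h2⟩) | h | h)
        · exact Or.inl h
        · exact Or.inr ⟨y', Finset.mem_of_mem_erase h1, h2⟩
        · exact Or.inr ⟨y, hyT, Or.inl h⟩
        · exact Or.inr ⟨y, hyT, Or.inr (by rw [h]; exact hyz)⟩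
    have hS' : ∀ a ∈ ST M B0 (T.erase y), ¬ y ≤ a ∧ ¬ z ≤ a := by
      have low : ∀ a, ρ a ≤ n → a ≠ y → ¬ y ≤ a ∧ ¬ z ≤ a := by
        intro a h1 h2
        constructor
        · intro h
          have := rank_lt hρ (lt_of_le_of_ne h h2.symm)
          omega
        · intro h
          have := hρ.1 h
          omega
      rintro a (h | ⟨y', h1, h2⟩)
      · exact low a (hB a h) fun e => hB' y z hyz hyn (e ▸ h)
      · rw [Finset.mem_erase] at h1
        rcases h2 with rfl | h2
        · exact low a (hT a h1.2).1.le h1.1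
        · have := habove y' h1.2 a h2 h1.1
          exact ⟨this, fun h => this (hlt.le.trans h)⟩
    refine acyc_ext (Q := FP (ST M B0 (T.erase y)) B0) (goodF _ _) ?_
      (fun s v h h' => FP_closed s v h h')
      (ih (T.erase y) (Finset.erase_ssubset hyT)
        (fun y' h => hT y' (Finset.mem_of_mem_erase h)) ?_) ?_
    · rintro s ⟨h1, h2⟩
      exact ⟨fun a ha => by rw [hST]; exact Or.inl (h1 ha), h2⟩
    · intro y' hy' z' hm a ha1 ha2
      rw [Finset.mem_erase] at hy'
      rcases hcl y' hy'.2 z' hm a ha1 ha2 with h | h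
      · exact Or.inl h
      · refine Or.inr (Finset.mem_erase.2 ⟨?_, h⟩)
        rintro rfl
        exact habove y' hy'.2 z' hm hy'.1 ha1.le
    · have e : (fun s => FP (ST M B0 T) B0 s ∧ ¬ FP (ST M B0 (T.erase y)) B0 s) =
          FP (ST M B0 (T.erase y) ∪ {y, z}) (ST M B0 (T.erase y)) := by
        rw [hST]
        funext s
        apply propext
        constructor
        · rintro ⟨⟨h1, h2, h3⟩, h4⟩
          exact ⟨h1, h2, fun h => h4 ⟨h, h2, h3⟩⟩
        · rintro ⟨h1, h2, h3⟩
          exact ⟨⟨h1, h2, fun h => h3 fun a ha => Or.inl (h ha)⟩, fun h => h3 h.1⟩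
      rw [e]
      refine pair_acyc hlt (fun a ha => (hS' a ha).1) (fun a ha => (hS' a ha).2) ?_
        (fun k => acycR.2 (hadm _ hyz k)) k
      intro a h1 h2
      rcases hcl y hyT z hyz a h1 h2 with h | h
      · exact Or.inl h
      · exact Or.inr ⟨a, Finset.mem_erase.2 ⟨h2, h⟩, Or.inl rfl⟩
  · rw [Finset.not_nonempty_iff_eq_empty] at hne
    subst hne
    intro c hc _
    have : c = 0 := by
      refine C_ext LinearMap.id 0 (fun s h1 h2 => ?_) hc
      exfalso
      refine h1.2.2 fun a ha => ?_
      rcases h1.1 ha with h | ⟨y, hy, _⟩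
      · exact h
      · exact absurd hy (Finset.notMem_empty y)
    exact ⟨0, Submodule.zero_mem _, by rw [map_zero, this]⟩

theorem main_iso [Fintype α] {ρ : α → ℕ} (hρ : IsQuasicellular α ρ) {M : Set (α × α)}
    (hM : IsMorseMatching α M) (hadm : IsHomologicallyAdmissible α M) (n : ℕ) (i : ℤ) :
    Nonempty (FH α (morseFiltration ρ M (n : ℤ)) (morseFiltration ρ M ((n : ℤ) - 1)) i ≃+
      ((x : {x : α // IsCritical M x ∧ ρ x = n}) → RH α {a | a < (x : α)} (i - 1))) := by
  set X := morseFiltration ρ M (n : ℤ) with hX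
  set Y := morseFiltration ρ M ((n : ℤ) - 1) with hY
  set B0 : Set α := Y ∪ {x | IsCritical M x ∧ ρ x = n} with hB0
  have memX : ∀ a, a ∈ X ↔ ρ a ≤ n ∨ ∃ y, (y, a) ∈ M ∧ ρ y = n := by
    intro a
    simp only [hX, morseFiltration, Set.mem_union, Set.mem_setOf_eq, Nat.cast_le, Nat.cast_inj]
  have memY : ∀ a, a ∈ Y ↔ ρ a < n ∨ ∃ y, (y, a) ∈ M ∧ ρ y + 1 = n := by
    intro a
    simp only [hY, morseFiltration, Set.mem_union, Set.mem_setOf_eq]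
    refine or_congr (by omega) (exists_congr fun y => and_congr Iff.rfl (by omega))
  have rankY : ∀ a ∈ Y, ρ a ≤ n := by
    intro a ha
    rcases (memY a).1 ha with h | ⟨y, h1, h2⟩
    · exact h.le
    · rw [rank_edge hρ hM.1 hadm h1, h2]
  have rankB : ∀ a ∈ B0, ρ a ≤ n := by
    rintro a (h | h)
    · exact rankY a h
    · exact h.2.le
  have BX : ∀ a ∈ B0, a ∈ X := fun a ha => (memX a).2 (Or.inl (rankB a ha))
  have critY : ∀ x, IsCritical M x → ρ x = n → x ∉ Y := by
    intro x h1 h2 h3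
    rcases (memY x).1 h3 with h | ⟨y, h, _⟩
    · omega
    · exact (h1 _ h).2 rfl
  -- trichotomy in rank n
  have tri : ∀ a, ρ a ≤ n → a ∈ B0 ∨ (ρ a = n ∧ ∃ z, (a, z) ∈ M) := by
    intro a ha
    rcases lt_or_eq_of_le ha with h | h
    · exact Or.inl (Or.inl ((memY a).2 (Or.inl h)))
    · by_cases hc : IsCritical M a
      · exact Or.inl (Or.inr ⟨hc, h⟩)
      · unfold IsCritical at hc
        push Not at hc
        obtain ⟨⟨y, z⟩, he, hh⟩ := hc
        by_cases e : a = y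
        · subst e; exact Or.inr ⟨h, z, he⟩
        · have : a = z := hh e
          subst this
          refine Or.inl (Or.inl ((memY a).2 (Or.inr ⟨y, he, ?_⟩)))
          rw [← rank_edge hρ hM.1 hadm he, h]
  have hR : ∀ k, Acyc (fun s => FP X Y s ∧ ¬ FP B0 Y s) k := by
    intro k
    have hXS : X = ST M B0 (Finset.univ.filter fun y => ρ y = n ∧ ∃ z, (y, z) ∈ M) := by
      ext a
      simp only [ST, Set.mem_union, Set.mem_setOf_eq, Finset.mem_filter, Finset.mem_univ, true_and]
      constructor
      · intro ha
        rcases (memX a).1 ha with h | ⟨y, h1, h2⟩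
        · rcases tri a h with h' | h'
          · exact Or.inl h'
          · exact Or.inr ⟨a, h', Or.inl rfl⟩
        · exact Or.inr ⟨y, ⟨h2, a, h1⟩, Or.inr h1⟩
      · rintro (h | ⟨y, ⟨h1, h2⟩, rfl | h3⟩)
        · exact BX a h
        · exact (memX a).2 (Or.inl h1.le)
        · exact (memX a).2 (Or.inr ⟨y, h3, h1⟩)
    have e : (fun s => FP X Y s ∧ ¬ FP B0 Y s) = FP X B0 := by
      funext s
      apply propext
      constructor
      · rintro ⟨⟨h1, h2, h3⟩, h4⟩
        exact ⟨h1, h2, fun h => h4 ⟨h, h2, h3⟩⟩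
      · rintro ⟨h1, h2, h3⟩
        exact ⟨⟨h1, h2, fun h => h3 fun a ha => Or.inl (h ha)⟩, fun h => h3 h.1⟩
    rw [e, hXS]
    refine pairs_acyc hρ hM hadm n B0 rankB ?_ k _ (fun y hy => (Finset.mem_filter.1 hy).2) ?_
    · rintro y z h1 h2 (h | h)
      · rcases (memY y).1 h with h' | ⟨y', h', _⟩
        · omega
        · have := congrArg Prod.snd (hM.1.2 y _ h1 _ h' (Or.inl rfl) (Or.inr rfl))
          exact (hM.1.1 _ h1).1.ne this.symm
      · exact (h.1 _ h1).1 rfl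
    · intro y hy z hyz a h1 h2
      have hyn := (Finset.mem_filter.1 hy).2.1
      have := rank_lt hρ h1
      rw [rank_edge hρ hM.1 hadm hyz] at this
      rcases tri a (by omega) with h | h
      · exact Or.inl h
      · exact Or.inr (Finset.mem_filter.2 ⟨Finset.mem_univ _, h⟩)
  have hLP : FP B0 Y = LP (fun x => IsCritical M x ∧ ρ x = n) (fun x => {a | a < x}) := by
    funext s
    apply propext
    constructor
    · rintro ⟨h1, h2, h3⟩
      obtain ⟨x, hxs, hxY⟩ := Set.not_subset.1 h3
      have hx : IsCritical M x ∧ ρ x = n := (h1 hxs).resolve_left hxY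
      refine ⟨h2, x, hx, hxs, fun a ha => ?_⟩
      rw [Finset.mem_coe, Finset.mem_erase] at ha
      rcases h2 ha.2 hxs ha.1 with h | h
      · exact lt_of_le_of_ne h ha.1
      · have h4 := rank_lt hρ (lt_of_le_of_ne h ha.1.symm)
        have h5 := rankB a (h1 ha.2)
        have h6 := hx.2
        omega
    · rintro ⟨h2, x, hx, hxs, hsub⟩
      refine ⟨fun a ha => ?_, h2, fun h => critY x hx.1 hx.2 (h hxs)⟩
      by_cases e : a = x
      · subst e; exact Or.inr hx
      · have h4 := rank_lt hρ (show a < x from hsub (Finset.mem_erase.2 ⟨e, ha⟩))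
        rw [hx.2] at h4
        exact Or.inl ((memY a).2 (Or.inl h4))
  obtain ⟨e1⟩ := bridgeF X Y i
  obtain ⟨e2⟩ := H_ext (P := FP X Y) (Q := FP B0 Y) (goodF _ _)
    (fun s h => ⟨fun a ha => BX a (h.1 ha), h.2⟩) (fun s v h h' => FP_closed s v h h') hR i
  obtain ⟨j, rfl⟩ : ∃ j, i = j + 1 := ⟨i - 1, by ring⟩
  rw [hLP] at e2
  obtain ⟨e3⟩ := link_iso (p := fun x => IsCritical M x ∧ ρ x = n) (L := fun x => {a | a < x})
    (fun x _ a ha => ha) (fun x y hx hy h => by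
      have := rank_lt hρ (show y < x from h)
      rw [hx.2, hy.2] at this
      exact lt_irrefl _ this) j
  rw [add_sub_cancel_right]
  exact ⟨(e1.trans e2.symm).trans (e3.trans
    (AddEquiv.piCongrRight fun x => (Classical.choice (bridgeR {a | a < x.1} j)).symm))⟩

end QC

/-- Let `X` be a finite quasicellular poset with quasicellular morphism `ρ`, `M` a
homologically admissible Morse matching, `X_n` the associated filtration, and `A_n` the set
of critical points of degree `n`.  Then `H^f_i(X_n, X_{n-1})` is `⊕_{x ∈ A_n} H̃^f_{n-1}(Û_x)`
for `i = n` and vanishes for `i ≠ n`. -/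
theorem stmt8 {α : Type u} [PartialOrder α] [Fintype α] (ρ : α → ℕ)
    (hρ : IsQuasicellular α ρ) (M : Set (α × α)) (hM : IsMorseMatching α M)
    (hadm : IsHomologicallyAdmissible α M) (n : ℕ) (i : ℤ) :
    (i = (n : ℤ) → Nonempty
      (FH α (morseFiltration ρ M (n : ℤ)) (morseFiltration ρ M ((n : ℤ) - 1)) i ≃+
        Π₀ x : {x : α // IsCritical M x ∧ ρ x = n}, RH α {a | a < (x : α)} ((n : ℤ) - 1))) ∧
    (i ≠ (n : ℤ) →
      Subsingleton (FH α (morseFiltration ρ M (n : ℤ)) (morseFiltration ρ M ((n : ℤ) - 1)) i)) := by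
  obtain ⟨e⟩ := QC.main_iso hρ hM hadm n i
  constructor
  · rintro rfl
    let e' : (Π₀ x : {x : α // IsCritical M x ∧ ρ x = n}, RH α {a | a < (x : α)} ((n : ℤ) - 1)) ≃+
        ((x : {x : α // IsCritical M x ∧ ρ x = n}) → RH α {a | a < (x : α)} ((n : ℤ) - 1)) :=
      { DFinsupp.equivFunOnFintype with map_add' := fun f g => DFinsupp.coe_add f g }
    exact ⟨e.trans e'.symm⟩
  · intro hne
    haveI : ∀ x : {x : α // IsCritical M x ∧ ρ x = n},
        Subsingleton (RH α {a | a < (x : α)} (i - 1)) := by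
      intro x
      refine (hρ.2.2 x.1).1 _ ?_
      rw [x.2.2]
      omega
    exact e.toEquiv.subsingleton
end

section
/- Let X be a finite poset which is quasicellular with quasicellular morphism ρ, let M be a homologically admissible Morse matching on the Hasse diagram of X, and let n ≥ 0. Let S = {(y,z) ∈ M : ρ(y) = n}. Define a relation ⪯ on S by: (a,b) ⪯ (a',b') if and only if (a,b) = (a',b') or there exist l ≥ 1 and (a_0,b_0),…,(a_l,b_l) ∈ S with (a_0,b_0) = (a,b), (a_l,b_l) = (a',b'), and a_j < b_{j+1} for all 0 ≤ j ≤ l−1. Then ⪯ is a partial order on S (in particular, ⪯ is antisymmetric). -/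
open scoped Classical

universe u

/-- The relation `⪯` on the set `S = {(y, z) ∈ M | ρ(y) = n}`: `(a,b) ⪯ (a',b')` iff they are
equal or there is a sequence `(a_0,b_0), …, (a_l,b_l)` in `S` (with `l ≥ 1`) from `(a,b)` to
`(a',b')` such that `a_j < b_{j+1}` for all `j`. -/
def morseRel {α : Type u} [PartialOrder α] (M : Set (α × α)) (ρ : α → ℕ) (n : ℕ)
    (e f : {p : α × α // p ∈ M ∧ ρ p.1 = n}) : Prop :=
  e = f ∨ ∃ (l : ℕ) (c : Fin (l + 2) → {p : α × α // p ∈ M ∧ ρ p.1 = n}),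
    c 0 = e ∧ c (Fin.last (l + 1)) = f ∧
      ∀ j : Fin (l + 1), (c j.castSucc).1.1 < (c j.succ).1.2

set_option linter.unusedSectionVars false

section Helpers

variable {α : Type u} [PartialOrder α]

/-- chains as a set of finsets -/
def ChS (S : Set α) (n : ℤ) : Set (Finset α) :=
  {s | (↑s : Set α) ⊆ S ∧ IsChain (· ≤ ·) (↑s : Set α) ∧ (s.card : ℤ) = n + 1}

noncomputable def bigD : (Finset α →₀ ℤ) →ₗ[ℤ] (Finset α →₀ ℤ) :=
  Finsupp.lift (Finset α →₀ ℤ) ℤ (Finset α) (fun s =>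
    ∑ v ∈ s, chainSgn α s v • Finsupp.single (s.erase v) (1 : ℤ))

noncomputable def bigK (a : α) : (Finset α →₀ ℤ) →ₗ[ℤ] (Finset α →₀ ℤ) :=
  Finsupp.lift (Finset α →₀ ℤ) ℤ (Finset α) (fun s => Finsupp.single (insert a s) (1 : ℤ))

noncomputable def bigP (a : α) : (Finset α →₀ ℤ) →ₗ[ℤ] (Finset α →₀ ℤ) :=
  Finsupp.lift (Finset α →₀ ℤ) ℤ (Finset α) (fun s =>
    if a ∈ s then Finsupp.single (s.erase a) (1 : ℤ) else 0)

theorem bigD_single (s : Finset α) : bigD (Finsupp.single s (1 : ℤ)) =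
    ∑ v ∈ s, chainSgn α s v • Finsupp.single (s.erase v) (1 : ℤ) := by
  simp [bigD]

theorem bigK_single (a : α) (s : Finset α) : bigK a (Finsupp.single s (1 : ℤ)) =
    Finsupp.single (insert a s) (1 : ℤ) := by
  simp [bigK]

theorem bigP_single (a : α) (s : Finset α) : bigP a (Finsupp.single s (1 : ℤ)) =
    if a ∈ s then Finsupp.single (s.erase a) (1 : ℤ) else 0 := by
  simp [bigP]

theorem supp_induction {T : Set (Finset α)} {p : (Finset α →₀ ℤ) → Prop}
    (h0 : p 0) (hadd : ∀ x y, p x → p y → p (x + y)) (hsmul : ∀ (c : ℤ) x, p x → p (c • x))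
    (h1 : ∀ s ∈ T, p (Finsupp.single s 1)) {x : Finset α →₀ ℤ}
    (hx : x ∈ Finsupp.supported ℤ ℤ T) : p x := by
  rw [Finsupp.supported_eq_span_single] at hx
  induction hx using Submodule.span_induction with
  | mem x h => obtain ⟨s, hs, rfl⟩ := h; exact h1 s hs
  | zero => exact h0
  | add x y _ _ hx hy => exact hadd _ _ hx hy
  | smul c x _ hx => exact hsmul c x hx

theorem supp_eq {T : Set (Finset α)}
    (f g : (Finset α →₀ ℤ) →ₗ[ℤ] (Finset α →₀ ℤ))
    (h1 : ∀ s ∈ T, f (Finsupp.single s 1) = g (Finsupp.single s 1)) {x : Finset α →₀ ℤ}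
    (hx : x ∈ Finsupp.supported ℤ ℤ T) : f x = g x :=
  supp_induction (p := fun x => f x = g x) (by simp)
    (fun x y h h' => by simp only [map_add, h, h'])
    (fun c x h => by simp only [map_smul, h]) h1 hx

theorem supp_mem {T : Set (Finset α)} (N : Submodule ℤ (Finset α →₀ ℤ))
    (f : (Finset α →₀ ℤ) →ₗ[ℤ] (Finset α →₀ ℤ))
    (h1 : ∀ s ∈ T, f (Finsupp.single s 1) ∈ N) {x : Finset α →₀ ℤ}
    (hx : x ∈ Finsupp.supported ℤ ℤ T) : f x ∈ N :=
  supp_induction (p := fun x => f x ∈ N) (by simp)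
    (fun x y h h' => by simpa only [map_add] using N.add_mem h h')
    (fun c x h => by simpa only [map_smul] using N.smul_mem c h) h1 hx

/-- finsets of cardinality `m` lying below `a` -/
def Bel (a : α) (m : ℕ) : Set (Finset α) := {s | s.card = m ∧ ∀ x ∈ s, x < a}

theorem cone_single (a : α) (t : Finset α) (ht : ∀ x ∈ t, x < a) :
    bigD (bigK a (Finsupp.single t 1)) =
      bigK a (bigD (Finsupp.single t 1)) + (-1 : ℤ) ^ t.card • Finsupp.single t (1 : ℤ) := by
  have hat : a ∉ t := fun h => lt_irrefl _ (ht a h)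
  rw [bigK_single, bigD_single, bigD_single, Finset.sum_insert hat, map_sum, add_comm]
  congr 1
  · refine Finset.sum_congr rfl fun v hv => ?_
    have hva : a ≠ v := fun h => hat (h ▸ hv)
    rw [map_smul, bigK_single, Finset.erase_insert_of_ne hva]
    congr 1
    unfold chainSgn
    rw [Finset.filter_insert, if_neg (not_lt_of_gt (ht v hv))]
  · rw [Finset.erase_insert hat]
    congr 1
    unfold chainSgn
    rw [Finset.filter_insert, if_neg (lt_irrefl a), Finset.filter_true_of_mem ht]

theorem cone_Bel (a : α) (m : ℕ) {x : Finset α →₀ ℤ}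
    (hx : x ∈ Finsupp.supported ℤ ℤ (Bel a m)) :
    bigD (bigK a x) = bigK a (bigD x) + (-1 : ℤ) ^ m • x := by
  refine supp_eq (bigD ∘ₗ bigK a) (bigK a ∘ₗ bigD + (-1 : ℤ) ^ m • LinearMap.id) ?_ hx
  rintro s ⟨rfl, hs⟩
  exact cone_single a s hs

theorem bigD_sq_single (m : ℕ) : ∀ s : Finset α, s.card = m → IsChain (· ≤ ·) (↑s : Set α) →
    bigD (bigD (Finsupp.single s 1)) = 0 := by
  induction m with
  | zero =>
    intro s hs _
    rw [Finset.card_eq_zero] at hs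
    subst hs
    simp [bigD_single]
  | succ m ih =>
    intro s hs hc
    have hne : s.Nonempty := by rw [← Finset.card_pos]; omega
    obtain ⟨a, ha⟩ := s.exists_maximal hne
    set t := s.erase a with htd
    have hst : s = insert a t := by rw [htd, Finset.insert_erase ha.1]
    have htc : t.card = m := by rw [htd, Finset.card_erase_of_mem ha.1]; omega
    have hta : ∀ x ∈ t, x < a := by
      intro x hx
      rw [htd, Finset.mem_erase] at hx
      refine lt_of_le_of_ne ?_ hx.1
      rcases hc.total hx.2 ha.1 with h | h
      · exact h
      · exact ha.2 hx.2 h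
    have htch : IsChain (· ≤ ·) (↑t : Set α) :=
      hc.mono (Finset.coe_subset.mpr (Finset.erase_subset _ _))
    rw [hst, ← bigK_single, cone_single a t hta, map_add, map_smul, htc]
    cases m with
    | zero =>
      rw [Finset.card_eq_zero] at htc
      rw [htc]
      simp [bigD_single]
    | succ m =>
      have hB : bigD (Finsupp.single t 1) ∈ Finsupp.supported ℤ ℤ (Bel a m) := by
        rw [bigD_single]
        refine Submodule.sum_mem _ fun v hv => Submodule.smul_mem _ _ ?_
        refine Finsupp.single_mem_supported ℤ _ ⟨?_, ?_⟩
        · rw [Finset.card_erase_of_mem hv]; omega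
        · intro x hx; exact hta x (Finset.mem_of_mem_erase hx)
      rw [cone_Bel a m hB, ih t htc htch, map_zero, zero_add, ← add_smul, pow_succ]
      simp

theorem bigD_sq {S : Set α} {n : ℤ} {x : Finset α →₀ ℤ}
    (hx : x ∈ Finsupp.supported ℤ ℤ (ChS S n)) : bigD (bigD x) = 0 := by
  refine supp_induction (p := fun x => bigD (bigD x) = 0) (by simp only [map_zero])
    (fun x y h h' => by simp only [map_add, h, h', add_zero])
    (fun c x h => by simp only [map_smul, h, smul_zero]) ?_ hx
  intro s hs
  exact bigD_sq_single s.card s rfl hs.2.1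

/-! the bridge -/

noncomputable def emb (S : Set α) (n : ℤ) : RCgrp α S n →ₗ[ℤ] (Finset α →₀ ℤ) :=
  Finsupp.lmapDomain ℤ ℤ (fun s : RChains α S n => (Subtype.val s : Finset α))

theorem emb_single (S : Set α) (n : ℤ) (s : RChains α S n) (c : ℤ) :
    emb S n (Finsupp.single s c) = Finsupp.single (Subtype.val s) c :=
  Finsupp.mapDomain_single

theorem emb_range (S : Set α) (n : ℤ) {z : Finset α →₀ ℤ}
    (hz : z ∈ Finsupp.supported ℤ ℤ (ChS S n)) :
    ∃ y : RCgrp α S n, emb S n y = z := by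
  refine supp_induction
    (p := fun z => ∃ y : RCgrp α S n, emb S n y = z) ?_ ?_ ?_ ?_ hz
  · exact ⟨0, map_zero _⟩
  · rintro _ _ ⟨y, rfl⟩ ⟨y', rfl⟩
    exact ⟨y + y', map_add _ _ _⟩
  · rintro c _ ⟨y, rfl⟩
    exact ⟨c • y, map_smul _ _ _⟩
  · intro s hs
    exact ⟨Finsupp.single ⟨s, hs⟩ 1, emb_single _ _ _ _⟩

theorem emb_mem (S : Set α) (n : ℤ) (y : RCgrp α S n) :
    emb S n y ∈ Finsupp.supported ℤ ℤ (ChS S n) := by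
  induction y using Finsupp.induction_linear with
  | zero => rw [map_zero]; exact Submodule.zero_mem _
  | add f g hf hg => rw [map_add]; exact Submodule.add_mem _ hf hg
  | single s c =>
    rw [emb_single]
    exact Finsupp.single_mem_supported ℤ _ s.2

theorem emb_inj (S : Set α) (n : ℤ) : Function.Injective (emb S n) :=
  Finsupp.mapDomain_injective Subtype.val_injective

theorem rd_single (S : Set α) (n : ℤ) (s : RChains α S n) (c : ℤ) :
    rd α S n (Finsupp.single s c) = c • ∑ v ∈ s.1.attach,
      chainSgn α s.1 v.1 •
        Finsupp.single
          (⟨s.1.erase v.1, erase_spec α s.2.1 s.2.2.1 s.2.2.2 v.2⟩ : RChains α S (n - 1))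
          (1 : ℤ) := by
  have h := Finsupp.sum_single_index (a := s) (b := c) (h := fun (s : RChains α S n) (c : ℤ) =>
    c • ∑ v ∈ s.1.attach, chainSgn α s.1 v.1 •
        Finsupp.single
          (⟨s.1.erase v.1, erase_spec α s.2.1 s.2.2.1 s.2.2.2 v.2⟩ : RChains α S (n - 1))
          (1 : ℤ)) (zero_smul _ _)
  exact h

theorem emb_rd (S : Set α) (n : ℤ) (y : RCgrp α S n) :
    emb S (n - 1) (rd α S n y) = bigD (emb S n y) := by
  induction y using Finsupp.induction_linear with
  | zero => simp only [map_zero]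
  | add f g hf hg => simp only [map_add, hf, hg]
  | single s c =>
    rw [emb_single]
    have h1 : (Finsupp.single s.1 c : Finset α →₀ ℤ) = c • Finsupp.single s.1 1 := by simp
    rw [h1, map_smul, bigD_single, rd_single]
    refine ((emb S (n - 1)).map_smul c _).trans ?_
    congr 1
    refine (map_sum (emb S (n - 1)) _ _).trans ?_
    rw [← Finset.sum_attach s.1]
    refine Finset.sum_congr rfl fun v _ => ?_
    refine ((emb S (n - 1)).map_smul _ _).trans ?_
    exact congrArg (fun w => chainSgn α s.1 v.1 • w) (emb_single S (n - 1) _ _)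

theorem emb_cast (S : Set α) {m n : ℤ} (h : m = n) (y : RCgrp α S m) :
    emb S n (castAddEquiv (RCgrp α S) h y) = emb S m y := by
  subst h; rfl

theorem RH_iff (S : Set α) (n : ℤ) : Subsingleton (RH α S n) ↔
    ∀ z ∈ Finsupp.supported ℤ ℤ (ChS S n), bigD z = 0 →
      ∃ u ∈ Finsupp.supported ℤ ℤ (ChS S (n + 1)), bigD u = z := by
  have h0 : Subsingleton (RH α S n) ↔
      (boundariesOf (RCgrp α S) (rd α S) n).addSubgroupOf (rd α S n).ker = ⊤ :=
    QuotientAddGroup.subsingleton_iff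
  rw [h0, AddSubgroup.addSubgroupOf_eq_top]
  constructor
  · intro h z hz hDz
    obtain ⟨y, rfl⟩ := emb_range S n hz
    have hy : y ∈ (rd α S n).ker := by
      rw [AddMonoidHom.mem_ker]
      apply emb_inj
      rw [emb_rd, hDz, map_zero]
    obtain ⟨_, ⟨u, rfl⟩, hu⟩ := h hy
    refine ⟨_, emb_mem S (n + 1) u, ?_⟩
    rw [← emb_rd, ← hu]
    exact (emb_cast S _ _).symm
  · intro h y hy
    rw [AddMonoidHom.mem_ker] at hy
    obtain ⟨u, hu, hDu⟩ := h _ (emb_mem S n y) (by rw [← emb_rd, hy, map_zero])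
    obtain ⟨u, rfl⟩ := emb_range S (n + 1) hu
    refine ⟨_, ⟨u, rfl⟩, ?_⟩
    apply emb_inj
    rw [← emb_rd] at hDu
    exact (emb_cast S _ _).trans hDu

theorem ChS_bel {a b : α} (hab : a ⋖ b) {k : ℤ} {s : Finset α} (hs : s ∈ ChS {y | y < b} k)
    (ha : a ∈ s) : ∀ x ∈ s, x ≠ a → x < a := by
  intro x hx hxa
  rcases hs.2.1.total hx ha with h | h
  · exact lt_of_le_of_ne h hxa
  · exact absurd (hs.1 hx) (hab.2 (lt_of_le_of_ne h (Ne.symm hxa)))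

theorem key {a b : α} (hab : a ⋖ b) (m : ℕ)
    (h1 : Subsingleton (RH α ({y | y < b} \ {a}) ((m : ℤ) - 1)))
    (h2 : Subsingleton (RH α {y | y < a} ((m : ℤ) - 1 - 1))) :
    Subsingleton (RH α {y | y < b} ((m : ℤ) - 1)) := by
  rw [RH_iff] at h1 h2 ⊢
  intro z hz hDz
  have hPz : bigP a z ∈ Finsupp.supported ℤ ℤ (ChS {y | y < a} ((m : ℤ) - 1 - 1)) := by
    refine supp_mem _ (bigP a) ?_ hz
    intro s hs
    rw [bigP_single]
    split_ifs with ha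
    · refine Finsupp.single_mem_supported ℤ _ ⟨?_, ?_⟩
      · intro x hx
        have hx' := Finset.mem_erase.1 (Finset.mem_coe.1 hx)
        exact ChS_bel hab hs ha x hx'.2 hx'.1
      · exact (erase_spec α hs.1 hs.2.1 hs.2.2 ha).2
    · exact Submodule.zero_mem _
  have hDP : bigD (bigP a z) = bigP a (bigD z) := by
    refine supp_eq (bigD ∘ₗ bigP a) (bigP a ∘ₗ bigD) ?_ hz
    intro s hs
    simp only [LinearMap.comp_apply]
    rw [bigP_single, bigD_single, map_sum]
    split_ifs with ha
    · rw [bigD_single, ← Finset.sum_erase_add s _ ha, map_smul, bigP_single,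
        if_neg (Finset.notMem_erase a s), smul_zero, add_zero]
      refine Finset.sum_congr rfl fun v hv => ?_
      have hv' := Finset.mem_erase.1 hv
      have hva := ChS_bel hab hs ha v hv'.2 hv'.1
      rw [map_smul, bigP_single, if_pos (Finset.mem_erase.2 ⟨hv'.1.symm, ha⟩),
        Finset.erase_right_comm]
      congr 1
      unfold chainSgn
      congr 2
      ext x
      simp only [Finset.mem_filter, Finset.mem_erase]
      constructor
      · rintro ⟨⟨_, h⟩, h'⟩; exact ⟨h, h'⟩
      · rintro ⟨h, h'⟩; exact ⟨⟨(h'.trans hva).ne, h⟩, h'⟩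
    · rw [map_zero]
      symm
      refine Finset.sum_eq_zero fun v hv => ?_
      rw [map_smul, bigP_single, if_neg (fun h => ha (Finset.mem_of_mem_erase h)), smul_zero]
  obtain ⟨v, hv, hDv⟩ := h2 _ hPz (by rw [hDP, hDz, map_zero])
  rw [show (m : ℤ) - 1 - 1 + 1 = (m : ℤ) - 1 by ring] at hv
  have hvB : v ∈ Finsupp.supported ℤ ℤ (Bel a m) := by
    refine Finsupp.supported_mono ?_ hv
    intro s hs
    exact ⟨by have := hs.2.2; omega, fun x hx => hs.1 hx⟩
  have hcone := cone_Bel a m hvB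
  have hKv : bigK a v ∈ Finsupp.supported ℤ ℤ (ChS {y | y < b} ((m : ℤ) - 1 + 1)) := by
    refine supp_mem _ (bigK a) ?_ hv
    intro s hs
    rw [bigK_single]
    have has : a ∉ s := fun h => lt_irrefl _ (hs.1 h)
    refine Finsupp.single_mem_supported ℤ _ ⟨?_, ?_, ?_⟩
    · intro x hx
      rcases Finset.mem_insert.1 (Finset.mem_coe.1 hx) with h | h
      · subst h; exact hab.1
      · exact lt_trans (hs.1 h) hab.1
    · rw [Finset.coe_insert]
      exact hs.2.1.insert fun x hx _ => Or.inr (le_of_lt (hs.1 hx))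
    · rw [Finset.card_insert_of_notMem has]
      have := hs.2.2
      push_cast
      omega
  have hzK : z - bigK a (bigP a z) ∈
      Finsupp.supported ℤ ℤ (ChS ({y | y < b} \ {a}) ((m : ℤ) - 1)) := by
    refine supp_mem _ (LinearMap.id - bigK a ∘ₗ bigP a) ?_ hz
    intro s hs
    simp only [LinearMap.sub_apply, LinearMap.comp_apply, LinearMap.id_apply]
    rw [bigP_single]
    split_ifs with ha
    · rw [bigK_single, Finset.insert_erase ha, sub_self]
      exact Submodule.zero_mem _
    · rw [map_zero, sub_zero]
      refine Finsupp.single_mem_supported ℤ _ ⟨?_, hs.2⟩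
      intro x hx
      exact ⟨hs.1 hx, fun h => ha (h ▸ hx)⟩
  have hv2 : v ∈ Finsupp.supported ℤ ℤ (ChS ({y | y < b} \ {a}) ((m : ℤ) - 1)) := by
    refine Finsupp.supported_mono ?_ hv
    intro s hs
    exact ⟨fun x hx => ⟨lt_trans (hs.1 hx) hab.1, ne_of_lt (hs.1 hx)⟩, hs.2⟩
  have hz' : z - bigD (bigK a v) ∈
      Finsupp.supported ℤ ℤ (ChS ({y | y < b} \ {a}) ((m : ℤ) - 1)) := by
    rw [hcone, hDv, ← sub_sub]
    exact Submodule.sub_mem _ hzK (Submodule.smul_mem _ _ hv2)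
  obtain ⟨u, hu, hDu⟩ := h1 _ hz' (by rw [map_sub, hDz, bigD_sq hKv, sub_zero])
  refine ⟨u + bigK a v, Submodule.add_mem _ (Finsupp.supported_mono ?_ hu) hKv, ?_⟩
  · intro s hs
    exact ⟨fun x hx => (hs.1 hx).1, hs.2⟩
  · rw [map_add, hDu, sub_add_cancel]

theorem rho_strict {ρ : α → ℕ} (hρ : IsQuasicellular α ρ) : StrictMono ρ := by
  intro x y hxy
  refine lt_of_le_of_ne (hρ.1 hxy.le) fun h => ?_
  exact hρ.2.1 (ρ y) (show x ∈ {x | ρ x = ρ y} from h) (show y ∈ {x | ρ x = ρ y} from rfl)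
    hxy.ne hxy.le

theorem rho_edge {ρ : α → ℕ} (hρ : IsQuasicellular α ρ) {a b : α} (hab : a ⋖ b)
    (h : ∀ k : ℤ, Subsingleton (RH α ({y | y < b} \ {a}) k)) : ρ b = ρ a + 1 := by
  by_contra hne
  exact (hρ.2.2 b).2 (key hab (ρ b) (h _) ((hρ.2.2 a).1 _ (by omega)))

theorem morse_of_refl {M : Set (α × α)} {ρ : α → ℕ} {n : ℕ}
    {e f : {p : α × α // p ∈ M ∧ ρ p.1 = n}}
    (h : Relation.ReflTransGen (fun e f : {p : α × α // p ∈ M ∧ ρ p.1 = n} => e.1.1 < f.1.2) e f) :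
    morseRel M ρ n e f := by
  induction h with
  | refl => exact Or.inl rfl
  | @tail f g _ hfg ih =>
    right
    rcases ih with rfl | ⟨l, c, h0, hl, hc⟩
    · refine ⟨0, ![e, g], rfl, rfl, ?_⟩
      intro j
      fin_cases j
      exact hfg
    · refine ⟨l + 1, Fin.snoc (α := fun _ => {p : α × α // p ∈ M ∧ ρ p.1 = n}) c g, ?_, ?_, ?_⟩
      · rw [← h0]
        exact Fin.snoc_castSucc (α := fun _ => {p : α × α // p ∈ M ∧ ρ p.1 = n}) g c 0
      · exact Fin.snoc_last _ _
      · intro j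
        rw [Fin.snoc_castSucc]
        induction j using Fin.lastCases with
        | last =>
          rw [Fin.succ_last, Fin.snoc_last, hl]
          exact hfg
        | cast j =>
          rw [Fin.succ_castSucc, Fin.snoc_castSucc]
          exact hc j

theorem refl_of_morse {M : Set (α × α)} {ρ : α → ℕ} {n : ℕ}
    {e f : {p : α × α // p ∈ M ∧ ρ p.1 = n}} (h : morseRel M ρ n e f) :
    Relation.ReflTransGen (fun e f : {p : α × α // p ∈ M ∧ ρ p.1 = n} => e.1.1 < f.1.2) e f := by
  rcases h with rfl | ⟨l, c, rfl, rfl, hc⟩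
  · exact .refl
  · have : ∀ j : Fin (l + 2), Relation.ReflTransGen
        (fun e f : {p : α × α // p ∈ M ∧ ρ p.1 = n} => e.1.1 < f.1.2) (c 0) (c j) := by
      intro j
      induction j using Fin.induction with
      | zero => exact .refl
      | succ j ih => exact ih.tail (hc j)
    exact this _

theorem step_path {M : Set (α × α)} {ρ : α → ℕ} (hρ : IsQuasicellular α ρ)
    (hM : IsMorseMatching α M) (hadm : IsHomologicallyAdmissible α M) {n : ℕ}
    {e f : {p : α × α // p ∈ M ∧ ρ p.1 = n}} (h : e.1.1 < f.1.2) :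
    e = f ∨ Relation.TransGen (MorseStep M) f.1.2 e.1.2 := by
  by_cases hef : e = f
  · exact Or.inl hef
  right
  have hf := rho_edge hρ (hM.1.1 _ f.2.1) (hadm _ f.2.1)
  have hcov : e.1.1 ⋖ f.1.2 := by
    refine ⟨h, fun c h1 h2 => ?_⟩
    have h1' := rho_strict hρ h1
    have h2' := rho_strict hρ h2
    have := e.2.2
    have := f.2.2
    omega
  have hnot : (e.1.1, f.1.2) ∉ M := by
    intro hm
    have h1 := hM.1.2 e.1.1 _ hm _ e.2.1 (Or.inl rfl) (Or.inl rfl)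
    have h2 := hM.1.2 f.1.2 _ hm _ f.2.1 (Or.inr rfl) (Or.inr rfl)
    exact hef (Subtype.ext (h1.symm.trans h2))
  have s1 : MorseStep M f.1.2 e.1.1 := Or.inr ⟨hcov, hnot⟩
  have s2 : MorseStep M e.1.1 e.1.2 := Or.inl e.2.1
  exact (Relation.TransGen.single s1).tail s2

theorem path_of_refl {M : Set (α × α)} {ρ : α → ℕ} (hρ : IsQuasicellular α ρ)
    (hM : IsMorseMatching α M) (hadm : IsHomologicallyAdmissible α M) {n : ℕ}
    {e f : {p : α × α // p ∈ M ∧ ρ p.1 = n}}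
    (h : Relation.ReflTransGen (fun e f : {p : α × α // p ∈ M ∧ ρ p.1 = n} => e.1.1 < f.1.2) e f) :
    e = f ∨ Relation.TransGen (MorseStep M) f.1.2 e.1.2 := by
  induction h with
  | refl => exact Or.inl rfl
  | tail _ hfg ih =>
    rcases step_path hρ hM hadm hfg with h | h
    · subst h; exact ih
    · rcases ih with rfl | ih
      · exact Or.inr h
      · exact Or.inr (h.trans ih)

end Helpers

/-- For a finite quasicellular poset with a homologically admissible Morse matching `M`, the
relation `⪯` on `S = {(y, z) ∈ M | ρ(y) = n}` is a partial order (in particular, it is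
antisymmetric). -/
theorem stmt9 {α : Type u} [PartialOrder α] [Fintype α] (ρ : α → ℕ)
    (hρ : IsQuasicellular α ρ) (M : Set (α × α)) (hM : IsMorseMatching α M)
    (hadm : IsHomologicallyAdmissible α M) (n : ℕ) :
    IsPartialOrder {p : α × α // p ∈ M ∧ ρ p.1 = n} (morseRel M ρ n) := by
  refine { refl := fun e => Or.inl rfl, trans := ?_, antisymm := ?_ }
  · intro e f g h1 h2
    exact morse_of_refl ((refl_of_morse h1).trans (refl_of_morse h2))
  · intro e f h1 h2
    rcases path_of_refl hρ hM hadm (refl_of_morse h1) with h | h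
    · exact h
    rcases path_of_refl hρ hM hadm (refl_of_morse h2) with h' | h'
    · exact h'.symm
    exact absurd (h.trans h') (hM.2 _)
end

section
/- Let X be a finite poset and let V ⊆ X be a lower set (equivalently, an open subset of X in the topology whose open sets are the down-sets of X). Then μ(X) = μ(V) − Σ_{x ∈ X∖V} μ(Û_x). -/
open scoped Classical

/-- The Möbius function of the subposet `X` of the finite poset `α`: the number of chains of
`X` of odd cardinality minus the number of chains of `X` of even cardinality (the empty chain
counting as a chain of even cardinality, so `mu α ∅ = -1`). -/
noncomputable def mu (α : Type*) [PartialOrder α] [Fintype α] (X : Set α) : ℤ :=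
  ∑ s ∈ Finset.univ.filter
      (fun s : Finset α => (↑s : Set α) ⊆ X ∧ IsChain (· ≤ ·) (↑s : Set α)),
    (-1 : ℤ) ^ (s.card + 1)

/-- For a finite poset `X` and an open (i.e. lower) subset `V ⊆ X`,
`μ(X) = μ(V) - ∑_{x ∈ X∖V} μ(Û_x)`. -/
theorem stmt10 {α : Type*} [PartialOrder α] [Fintype α] (V : Set α) (hV : IsLowerSet V) :
    mu α Set.univ =
      mu α V - ∑ x ∈ Finset.univ.filter (fun x : α => x ∉ V), mu α {a | a < x} := by
  have key : ∑ x ∈ Finset.univ.filter (fun x : α => x ∉ V), mu α {a | a < x} =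
      - ∑ s ∈ Finset.univ.filter (fun s : Finset α =>
        ¬ ((↑s : Set α) ⊆ V) ∧ IsChain (· ≤ ·) (↑s : Set α)), (-1 : ℤ) ^ (s.card + 1) := by
    unfold mu
    rw [Finset.sum_sigma', ← Finset.sum_neg_distrib]
    refine Finset.sum_bij (fun p _ => insert p.1 p.2) ?_ ?_ ?_ ?_
    · rintro ⟨x, t⟩ h
      simp only [Finset.mem_sigma, Finset.mem_filter, Finset.mem_univ, true_and] at h ⊢
      obtain ⟨hx, ht, hc⟩ := h
      refine ⟨fun hh => hx (hh (by simp)), ?_⟩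
      rw [Finset.coe_insert]
      exact hc.insert (fun b hb _ => Or.inr (le_of_lt (ht hb)))
    · rintro ⟨x, t⟩ h ⟨y, u⟩ h' e
      simp only [Finset.mem_sigma, Finset.mem_filter, Finset.mem_univ, true_and] at h h' e
      obtain ⟨hx, ht, hc⟩ := h
      obtain ⟨hy, hu, hc'⟩ := h'
      have hxt : x ∉ t := fun hh => lt_irrefl x (ht hh)
      have hyu : y ∉ u := fun hh => lt_irrefl y (hu hh)
      have hxy : x = y := by
        have h1 : x ∈ insert y u := e ▸ Finset.mem_insert_self x t
        have h2 : y ∈ insert x t := e ▸ Finset.mem_insert_self y u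
        rcases Finset.mem_insert.1 h1 with h1 | h1
        · exact h1
        rcases Finset.mem_insert.1 h2 with h2 | h2
        · exact h2.symm
        exact absurd (hu h1) (not_lt_of_gt (ht h2))
      subst hxy
      have : t = u := by
        rw [← Finset.erase_insert hxt, e, Finset.erase_insert hyu]
      subst this
      rfl
    · intro s hs
      simp only [Finset.mem_filter, Finset.mem_univ, true_and] at hs
      obtain ⟨hsV, hc⟩ := hs
      obtain ⟨y, hys, hyV⟩ := Set.not_subset.1 hsV
      obtain ⟨m, hm⟩ := s.exists_maximal ⟨y, hys⟩
      have hmax : ∀ b ∈ s, b ≤ m := by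
        intro b hb
        rcases hc.total hb hm.1 with h | h
        · exact h
        · exact hm.2 hb h
      refine ⟨⟨m, s.erase m⟩, ?_, Finset.insert_erase hm.1⟩
      simp only [Finset.mem_sigma, Finset.mem_filter, Finset.mem_univ, true_and]
      refine ⟨fun h => hyV (hV (hmax y hys) h), ?_, ?_⟩
      · intro b hb
        have hb' := Finset.mem_erase.1 (Finset.mem_coe.1 hb)
        exact lt_of_le_of_ne (hmax b hb'.2) hb'.1
      · exact hc.mono (Finset.coe_subset.2 (Finset.erase_subset m s))
    · rintro ⟨x, t⟩ h
      simp only [Finset.mem_sigma, Finset.mem_filter, Finset.mem_univ, true_and] at h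
      have hxt : x ∉ t := fun hh => lt_irrefl x (h.2.1 hh)
      rw [Finset.card_insert_of_notMem hxt]
      ring
  rw [key, sub_neg_eq_add]
  unfold mu
  rw [← Finset.sum_filter_add_sum_filter_not _ (fun s : Finset α => (↑s : Set α) ⊆ V)]
  congr 1
  · refine Finset.sum_congr ?_ (fun _ _ => rfl)
    ext s
    simp [and_comm]
  · refine Finset.sum_congr ?_ (fun _ _ => rfl)
    ext s
    simp [and_comm]
end

section
/- Let X be a finite poset and let A ⊆ X be a lower set which, equipped with the topology whose open sets are the down-sets of A, is a contractible topological space. Then μ(X) = −Σ_{x ∈ X∖A} μ(Û_x). -/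
open scoped Classical

lemma rigid_down {β : Type*} [PartialOrder β] [Finite β] (f : β → β) (hf : Monotone f)
    (hle : ∀ a, f a ≤ a) (nb : ∀ x y : β, y < x → ¬ ∀ z, z < x → z ≤ y) : ∀ a, f a = a := by
  intro a
  induction a using WellFoundedLT.induction with
  | ind x ih =>
    by_contra hne
    refine nb x (f x) (lt_of_le_of_ne (hle x) hne) fun z hz => ?_
    rw [← ih z hz]
    exact hf hz.le

lemma rigid_up {β : Type*} [PartialOrder β] [Finite β] (f : β → β) (hf : Monotone f)
    (hle : ∀ a, a ≤ f a) (nb : ∀ x y : β, x < y → ¬ ∀ z, x < z → y ≤ z) : ∀ a, f a = a := by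
  intro a
  induction a using WellFoundedGT.induction with
  | ind x ih =>
    by_contra hne
    refine nb x (f x) (lt_of_le_of_ne (hle x) (Ne.symm hne)) fun z hz => ?_
    rw [← ih z hz]
    exact hf (le_of_lt hz)

lemma contr_subsingleton {β : Type*} [PartialOrder β] [Finite β]
    (hc : ContractibleSpace (Topology.WithLowerSet β))
    (nd : ∀ x y : β, y < x → ¬ ∀ z, z < x → z ≤ y)
    (nu : ∀ x y : β, x < y → ¬ ∀ z, x < z → y ≤ z) : ∃ b : β, ∀ a : β, a = b := by
  obtain ⟨b, ⟨H⟩⟩ := id_nullhomotopic (Topology.WithLowerSet β)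
  let h : unitInterval → β → β := fun t a => H (t, a)
  have hmono : ∀ t, Monotone (h t) := by
    intro t
    have : Continuous (fun a : Topology.WithLowerSet β => H (t, a)) := by fun_prop
    have h2 := (Topology.IsLowerSet.monotone_iff_continuous (α := Topology.WithLowerSet β)
      (β := Topology.WithLowerSet β)).2 this
    exact fun a b hab => h2 hab
  have hloc : ∀ t, ∀ᶠ s in nhds t, ∀ a, h s a ≤ h t a := by
    intro t
    rw [Filter.eventually_all]
    intro a
    have hcont : Continuous (fun s : unitInterval =>
        H (s, (show Topology.WithLowerSet β from a))) := by fun_prop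
    have hop : IsOpen (Set.Iic (H (t, (show Topology.WithLowerSet β from a)))) :=
      Topology.IsLowerSet.isOpen_iff_isLowerSet.2 (isLowerSet_Iic _)
    exact (hop.preimage hcont).mem_nhds (Set.mem_Iic.2 le_rfl)
  have hclopen : IsClopen {t | ∀ a, h t a = a} := by
    constructor
    · rw [← closure_subset_iff_isClosed]
      intro t ht
      rw [mem_closure_iff_frequently] at ht
      obtain ⟨s, hs, hs'⟩ := (ht.and_eventually (hloc t)).exists
      refine rigid_up _ (hmono t) (fun a => ?_) nu
      have := hs' a
      rwa [hs a] at this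
    · rw [isOpen_iff_mem_nhds]
      intro t ht
      filter_upwards [hloc t] with s hs
      refine rigid_down _ (hmono s) (fun a => ?_) nd
      have := hs a
      rwa [ht a] at this
  have huniv := hclopen.eq_univ ⟨0, fun a => H.apply_zero a⟩
  have h1 : (1 : unitInterval) ∈ {t | ∀ a, h t a = a} := huniv ▸ Set.mem_univ _
  exact ⟨b, fun a => (h1 a).symm.trans (H.apply_one a)⟩

lemma contr_retract {β γ : Type*} [PartialOrder β] [PartialOrder γ]
    (hc : ContractibleSpace (Topology.WithLowerSet β)) (i : γ →o β) (r : β →o γ)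
    (hri : ∀ a, r (i a) = a) : ContractibleSpace (Topology.WithLowerSet γ) := by
  rw [contractible_iff_id_nullhomotopic]
  have := ((id_nullhomotopic (Topology.WithLowerSet β)).comp_right
    (Topology.WithLowerSet.map r)).comp_left (Topology.WithLowerSet.map i)
  convert this using 1
  ext a
  exact (hri a).symm

/-- toggle -/
noncomputable def tog {α : Type*} (y : α) (s : Finset α) : Finset α :=
  if y ∈ s then s.erase y else insert y s

lemma sum_toggle {α : Type*} [Fintype α] (F : Finset (Finset α)) (y : α)
    (h1 : ∀ s ∈ F, y ∈ s → s.erase y ∈ F) (h2 : ∀ s ∈ F, y ∉ s → insert y s ∈ F) :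
    ∑ s ∈ F, (-1 : ℤ) ^ (s.card + 1) = 0 := by
  refine Finset.sum_involution (fun s _ => tog y s) ?_ ?_ ?_ ?_
  · intro s hs
    by_cases hy : y ∈ s
    · simp only [tog, hy, if_true]
      rw [← Finset.card_erase_add_one hy]
      ring
    · simp only [tog, hy, if_false]
      rw [Finset.card_insert_of_notMem hy]
      ring
  · intro s hs _ he
    have : y ∈ tog y s ↔ y ∉ s := by
      by_cases hy : y ∈ s <;> simp [tog, hy]
    rw [he] at this
    tauto
  · intro s hs
    by_cases hy : y ∈ s
    · simpa [tog, hy] using h1 s hs hy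
    · simpa [tog, hy] using h2 s hs hy
  · intro s hs
    by_cases hy : y ∈ s <;> simp [tog, hy]

lemma mu_remove {α : Type*} [PartialOrder α] [Fintype α] (S : Set α) (x : α) :
    mu α S = mu α (S \ {x}) + ∑ s ∈ Finset.univ.filter
      (fun s : Finset α => ((↑s : Set α) ⊆ S ∧ IsChain (· ≤ ·) (↑s : Set α)) ∧ x ∈ s),
      (-1 : ℤ) ^ (s.card + 1) := by
  unfold mu
  rw [← Finset.sum_filter_not_add_sum_filter _ (fun s : Finset α => x ∈ s), Finset.filter_filter,
    Finset.filter_filter]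
  congr 1
  apply Finset.sum_congr _ (fun _ _ => rfl)
  ext s
  simp only [Finset.mem_filter, Finset.mem_univ, true_and]
  constructor
  · rintro ⟨⟨h1, h2⟩, h3⟩
    exact ⟨fun a ha => ⟨h1 ha, fun h => h3 (Set.mem_singleton_iff.1 h ▸ ha)⟩, h2⟩
  · rintro ⟨h1, h2⟩
    exact ⟨⟨fun a ha => (h1 ha).1, h2⟩, fun h => (h1 h).2 rfl⟩

lemma mu_remove_dom {α : Type*} [PartialOrder α] [Fintype α] (S : Set α) (x y : α)
    (hy : y ∈ S) (hxy : y ≠ x)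
    (hd : ∀ z ∈ S, (z ≤ x ∨ x ≤ z) → (z ≤ y ∨ y ≤ z)) : mu α S = mu α (S \ {x}) := by
  rw [mu_remove S x, sum_toggle _ y, add_zero]
  · intro s hs hys
    simp only [Finset.mem_filter, Finset.mem_univ, true_and] at hs ⊢
    refine ⟨⟨fun a ha => hs.1.1 (Finset.erase_subset _ _ ha),
      hs.1.2.mono (Finset.coe_subset.2 (Finset.erase_subset _ _))⟩,
      Finset.mem_erase.2 ⟨hxy.symm, hs.2⟩⟩
  · intro s hs hys
    simp only [Finset.mem_filter, Finset.mem_univ, true_and] at hs ⊢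
    refine ⟨⟨?_, ?_⟩, Finset.mem_insert_of_mem hs.2⟩
    · rw [Finset.coe_insert]
      exact Set.insert_subset hy hs.1.1
    · rw [Finset.coe_insert]
      refine hs.1.2.insert fun z hz _ => ?_
      exact (hd z (hs.1.1 hz) (hs.1.2.total hz hs.2)).symm

lemma mu_contr {α : Type*} [PartialOrder α] [Fintype α] (n : ℕ) : ∀ (S : Set α), S.ncard = n →
    ContractibleSpace (Topology.WithLowerSet ↥S) → mu α S = 0 := by
  induction n with
  | zero =>
    intro S hS hc
    obtain ⟨b, -⟩ := id_nullhomotopic (Topology.WithLowerSet S)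
    rw [Set.ncard_eq_zero] at hS
    subst hS
    exact absurd b.2 (Set.notMem_empty _)
  | succ n ih =>
    intro S hS hc
    by_cases hb : ∃ x y : S, (y < x ∧ ∀ z, z < x → z ≤ y) ∨ (x < y ∧ ∀ z, x < z → y ≤ z)
    · obtain ⟨x, y, hxy⟩ := hb
      have hne : y ≠ x := by
        rcases hxy with h | h
        · exact h.1.ne
        · exact h.1.ne'
      have hne' : (y : α) ≠ x := fun h => hne (Subtype.ext h)
      rw [mu_remove_dom S x y y.2 hne']
      · refine ih _ ?_ ?_
        · rw [Set.ncard_sdiff_singleton_of_mem x.2, hS]; rfl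
        · let i : ↥(S \ {(x : α)}) →o S := ⟨fun a => ⟨a.1, a.2.1⟩, fun a b h => h⟩
          let r0 : S → S := fun a => if a = x then y else a
          have r0m : Monotone r0 := by
            intro a b hab
            by_cases ha : a = x <;> by_cases hb : b = x
            · simp [r0, ha, hb]
            · simp only [r0, ha, hb, if_true, if_false]
              subst ha
              rcases hxy with h | h
              · exact h.1.le.trans hab
              · exact h.2 _ (lt_of_le_of_ne hab (Ne.symm hb))
            · simp only [r0, ha, hb, if_true, if_false]
              subst hb
              rcases hxy with h | h
              · exact h.2 _ (lt_of_le_of_ne hab ha)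
              · exact hab.trans h.1.le
            · simpa [r0, ha, hb] using hab
          have r0n : ∀ a, r0 a ≠ x := by
            intro a
            by_cases ha : a = x <;> simp [r0, ha, hne]
          let r : S →o ↥(S \ {(x : α)}) :=
            ⟨fun a => ⟨r0 a, (r0 a).2, fun h => r0n a (Subtype.ext h)⟩, fun a b h => r0m h⟩
          refine contr_retract hc i r fun a => ?_
          have : i a ≠ x := fun h => a.2.2 (congrArg Subtype.val h)
          apply Subtype.ext
          have h2 : r0 (i a) = i a := if_neg this
          have h3 : (r0 (i a) : α) = (i a : α) := by rw [h2]
          exact h3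
      · intro z hz hzx
        rcases eq_or_ne z x with rfl | hzne
        · rcases hxy with h | h
          · exact Or.inr h.1.le
          · exact Or.inl h.1.le
        rcases hxy with h | h <;> rcases hzx with hzx | hzx
        · exact Or.inl (h.2 ⟨z, hz⟩ (lt_of_le_of_ne hzx fun h => hzne (congrArg Subtype.val h)))
        · exact Or.inr (le_trans h.1.le hzx)
        · exact Or.inl (le_trans hzx h.1.le)
        · exact Or.inr (h.2 ⟨z, hz⟩ (lt_of_le_of_ne hzx fun h => hzne (congrArg Subtype.val h).symm))
    · push Not at hb
      obtain ⟨b, hbb⟩ := contr_subsingleton hc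
        (fun x y h h' => by obtain ⟨z, hz, hz'⟩ := (hb x y).1 h; exact hz' (h' z hz))
        (fun x y h h' => by obtain ⟨z, hz, hz'⟩ := (hb x y).2 h; exact hz' (h' z hz))
      have hS' : S = {(b : α)} := by
        ext a
        constructor
        · intro ha
          exact congrArg Subtype.val (hbb ⟨a, ha⟩)
        · rintro rfl
          exact b.2
      unfold mu
      refine sum_toggle _ (b : α) ?_ ?_
      · intro s hs hys
        simp only [Finset.mem_filter, Finset.mem_univ, true_and] at hs ⊢
        exact ⟨fun a ha => hs.1 (Finset.erase_subset _ _ ha),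
          hs.2.mono (Finset.coe_subset.2 (Finset.erase_subset _ _))⟩
      · intro s hs hys
        simp only [Finset.mem_filter, Finset.mem_univ, true_and] at hs ⊢
        rw [Finset.coe_insert]
        have h1 := Set.insert_subset b.2 hs.1
        refine ⟨h1, Set.Subsingleton.isChain ?_⟩
        exact Set.subsingleton_singleton.anti (h1.trans hS'.subset)

lemma mu_remove_max {α : Type*} [PartialOrder α] [Fintype α] (S : Set α) (hS : IsLowerSet S)
    (x : α) (hx : x ∈ S) (hmax : ∀ z ∈ S, x ≤ z → z = x) :
    mu α S = mu α (S \ {x}) - mu α {a | a < x} := by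
  rw [mu_remove S x, sub_eq_add_neg]
  congr 1
  unfold mu
  rw [← Finset.sum_neg_distrib]
  refine Finset.sum_bij' (fun s _ => s.erase x) (fun s _ => insert x s) ?_ ?_ ?_ ?_ ?_
  · intro s hs
    simp only [Finset.mem_filter, Finset.mem_univ, true_and] at hs ⊢
    refine ⟨fun a ha => ?_, hs.1.2.mono (Finset.coe_subset.2 (Finset.erase_subset _ _))⟩
    have ha' := Finset.mem_erase.1 (Finset.mem_coe.1 ha)
    rcases hs.1.2.total ha'.2 hs.2 with h | h
    · exact lt_of_le_of_ne h ha'.1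
    · exact absurd (hmax a (hs.1.1 ha'.2) h) ha'.1
  · intro s hs
    simp only [Finset.mem_filter, Finset.mem_univ, true_and] at hs ⊢
    refine ⟨?_, Finset.mem_insert_self _ _⟩
    rw [Finset.coe_insert]
    exact ⟨Set.insert_subset hx fun a ha => hS (hs.1 ha).le hx,
      hs.2.insert fun z hz _ => Or.inr (hs.1 hz).le⟩
  · intro s hs
    simp only [Finset.mem_filter, Finset.mem_univ, true_and] at hs
    exact Finset.insert_erase hs.2
  · intro s hs
    simp only [Finset.mem_filter, Finset.mem_univ, true_and] at hs
    exact Finset.erase_insert fun h => lt_irrefl x (hs.1 h)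
  · intro s hs
    simp only [Finset.mem_filter, Finset.mem_univ, true_and] at hs
    rw [← Finset.card_erase_add_one hs.2]
    ring

lemma mu_lower {α : Type*} [PartialOrder α] [Fintype α] (A : Set α) (hA : IsLowerSet A) (n : ℕ) :
    ∀ S : Set α, A ⊆ S → IsLowerSet S → S.ncard = n →
    mu α S = mu α A - ∑ x ∈ Finset.univ.filter (fun x : α => x ∈ S \ A), mu α {a | a < x} := by
  induction n with
  | zero =>
    intro S hAS hS hn
    rw [Set.ncard_eq_zero] at hn
    subst hn
    rw [Set.subset_empty_iff] at hAS
    subst hAS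
    simp
  | succ n ih =>
    intro S hAS hS hn
    rcases (S \ A).eq_empty_or_nonempty with h | h
    · have : S = A := Set.Subset.antisymm (Set.sdiff_eq_empty.1 h) hAS
      subst this
      simp
    · obtain ⟨x, hx⟩ := (Set.toFinite (S \ A)).exists_maximal h
      have hxS := hx.1.1
      have hmax : ∀ z ∈ S, x ≤ z → z = x := fun z hz hxz =>
        le_antisymm (hx.2 ⟨hz, fun hzA => hx.1.2 (hA hxz hzA)⟩ hxz) hxz
      rw [mu_remove_max S hS x hxS hmax, ih (S \ {x})]
      · have : Finset.univ.filter (fun z : α => z ∈ S \ A) =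
            insert x (Finset.univ.filter (fun z : α => z ∈ (S \ {x}) \ A)) := by
          ext z
          simp only [Finset.mem_filter, Finset.mem_univ, true_and, Finset.mem_insert, Set.mem_sdiff,
            Set.mem_singleton_iff]
          by_cases hz : z = x
          · subst hz
            simp [hxS, hx.1.2]
          · simp [hz]
        rw [this, Finset.sum_insert (by simp), sub_sub, add_comm]
        congr!
      · exact fun a ha => ⟨hAS ha, fun h => hx.1.2 (h ▸ ha)⟩
      · intro a b hba ha
        refine ⟨hS hba ha.1, fun h => ha.2 (hmax a ha.1 ?_)⟩
        rw [Set.mem_singleton_iff] at h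
        rwa [← h]
      · rw [Set.ncard_sdiff_singleton_of_mem hxS, hn]; rfl

/-- For a finite poset `X` and a lower subset `A ⊆ X` which is contractible in the
topology whose open sets are the down-sets of `A`, `μ(X) = -∑_{x ∈ X∖A} μ(Û_x)`. -/
theorem stmt11 {α : Type*} [PartialOrder α] [Fintype α] (A : Set α) (hA : IsLowerSet A)
    (hcontr : ContractibleSpace (Topology.WithLowerSet ↥A)) :
    mu α Set.univ = -∑ x ∈ Finset.univ.filter (fun x : α => x ∉ A), mu α {a | a < x} := by
  rw [mu_lower A hA _ Set.univ (Set.subset_univ _) isLowerSet_univ rfl,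
    mu_contr _ A rfl hcontr, zero_sub]
  simp only [Set.mem_sdiff, Set.mem_univ, true_and]
end

section
/- Let P be a finite poset and let C be a convex subset of P (i.e., if x < y < z with x, z ∈ C then y ∈ C). Let a ∈ C. Then μ(F̂_a ∖ C) = Σ_{y ∈ C, y ≥ a} μ(F̂_y), where F̂_a and F̂_y are taken in P and F̂_a ∖ C carries the induced order. -/
open scoped Classical

theorem mu_ge_aux {α : Type*} [PartialOrder α] [Fintype α] (a : α) :
    mu α {y | a ≤ y} = 0 := by
  unfold mu
  refine Finset.sum_involution (fun s _ => if a ∈ s then s.erase a else insert a s) ?_ ?_ ?_ ?_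
  · intro s hs
    by_cases h : a ∈ s
    · simp only [h, if_true]
      rw [← Finset.card_erase_add_one h]
      ring
    · simp only [h, if_false]
      rw [Finset.card_insert_of_notMem h]
      ring
  · intro s hs _ he
    by_cases h : a ∈ s
    · simp only [h, if_true] at he
      rw [← he] at h
      simp at h
    · simp only [h, if_false] at he
      exact h (he ▸ Finset.mem_insert_self a s)
  · intro s hs
    simp only [Finset.mem_filter, Finset.mem_univ, true_and] at hs ⊢
    obtain ⟨h1, h2⟩ := hs
    by_cases h : a ∈ s
    · simp only [h, if_true]
      have hsub : ((s.erase a : Finset α) : Set α) ⊆ s := by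
        exact_mod_cast Finset.erase_subset a s
      exact ⟨hsub.trans h1, h2.mono hsub⟩
    · simp only [h, if_false, Finset.coe_insert]
      refine ⟨Set.insert_subset (le_refl a) h1, h2.insert ?_⟩
      intro b hb _
      exact Or.inl (h1 hb)
  · intro s hs
    by_cases h : a ∈ s
    · simp [h]
    · simp [h]

theorem mu_bij_aux {α : Type*} [PartialOrder α] [Fintype α] (C : Set α)
    (hC : ∀ x y z : α, x < y → y < z → x ∈ C → z ∈ C → y ∈ C) (a : α) (ha : a ∈ C) :
    ∑ y ∈ Finset.univ.filter (fun y : α => y ∈ C ∧ a ≤ y), mu α {z | y < z} =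
    - ∑ s ∈ (Finset.univ.filter
      (fun s : Finset α => (↑s : Set α) ⊆ {y | a ≤ y} ∧ IsChain (· ≤ ·) (↑s : Set α))).filter
        (fun s : Finset α => ¬ (↑s : Set α) ⊆ {y | a < y} \ C), (-1 : ℤ) ^ (s.card + 1) := by
  unfold mu
  rw [Finset.sum_sigma', ← Finset.sum_neg_distrib]
  refine Finset.sum_bij (fun p _ => insert p.1 p.2) ?_ ?_ ?_ ?_
  · rintro ⟨y, t⟩ h
    simp only [Finset.mem_sigma, Finset.mem_filter, Finset.mem_univ, true_and] at h ⊢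
    obtain ⟨⟨hy, hay⟩, ht, hc⟩ := h
    rw [Finset.coe_insert]
    refine ⟨⟨Set.insert_subset hay fun z hz => hay.trans (le_of_lt (ht hz)),
      hc.insert fun b hb _ => Or.inl (le_of_lt (ht hb))⟩, fun h => ?_⟩
    exact (h (Set.mem_insert y _)).2 hy
  · rintro ⟨y, t⟩ h ⟨y', t'⟩ h' he
    simp only [Finset.mem_sigma, Finset.mem_filter, Finset.mem_univ, true_and] at h h' he
    have m1 : y ∈ insert y' t' := he ▸ Finset.mem_insert_self y t
    have m2 : y' ∈ insert y t := he ▸ Finset.mem_insert_self y' t'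
    have n1 : y ∉ t := fun hh => lt_irrefl y (h.2.1 hh)
    have n2 : y' ∉ t' := fun hh => lt_irrefl y' (h'.2.1 hh)
    have e : y = y' := by
      rcases Finset.mem_insert.1 m1 with e | e
      · exact e
      rcases Finset.mem_insert.1 m2 with e' | e'
      · exact e'.symm
      exact absurd (lt_trans (h'.2.1 e) (h.2.1 e')) (lt_irrefl _)
    subst e
    have : t = t' := by
      rw [← Finset.erase_insert n1, he, Finset.erase_insert n2]
    subst this
    rfl
  · intro s hs
    simp only [Finset.mem_filter, Finset.mem_univ, true_and] at hs
    obtain ⟨⟨h1, h2⟩, h3⟩ := hs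
    obtain ⟨d, hd, hd'⟩ := Set.not_subset.1 h3
    have hdC : d ∈ C := by
      by_contra hn
      refine hd' ⟨lt_of_le_of_ne (h1 hd) ?_, hn⟩
      rintro rfl
      exact hn ha
    obtain ⟨y, hys, hmin⟩ := s.exists_minimal ⟨d, hd⟩
    have hle : ∀ z ∈ s, y ≤ z := by
      intro z hz
      rcases h2.total hys hz with h | h
      · exact h
      · exact hmin hz h
    have hyC : y ∈ C := by
      rcases eq_or_lt_of_le (h1 hys : a ≤ y) with e | e
      · exact e ▸ ha
      rcases eq_or_lt_of_le (hle d hd) with e' | e'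
      · exact e' ▸ hdC
      exact hC a y d e e' ha hdC
    refine ⟨⟨y, s.erase y⟩, ?_, Finset.insert_erase hys⟩
    simp only [Finset.mem_sigma, Finset.mem_filter, Finset.mem_univ, true_and]
    refine ⟨⟨hyC, h1 hys⟩, ?_, h2.mono (by exact_mod_cast Finset.erase_subset y s)⟩
    intro z hz
    have hz' := Finset.mem_erase.1 (Finset.mem_coe.1 hz)
    exact lt_of_le_of_ne (hle z hz'.2) (Ne.symm hz'.1)
  · rintro ⟨y, t⟩ h
    simp only [Finset.mem_sigma, Finset.mem_filter, Finset.mem_univ, true_and] at h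
    have n1 : y ∉ t := fun hh => lt_irrefl y (h.2.1 hh)
    simp only [Finset.card_insert_of_notMem n1]
    ring

/-- For a finite poset `P`, a convex subset `C ⊆ P` and `a ∈ C`,
`μ(F̂_a ∖ C) = ∑_{y ∈ C, y ≥ a} μ(F̂_y)`. -/
theorem stmt13 {α : Type*} [PartialOrder α] [Fintype α] (C : Set α)
    (hC : ∀ x y z : α, x < y → y < z → x ∈ C → z ∈ C → y ∈ C) (a : α) (ha : a ∈ C) :
    mu α ({y | a < y} \ C) =
      ∑ y ∈ Finset.univ.filter (fun y : α => y ∈ C ∧ a ≤ y), mu α {z | y < z} := by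
  rw [mu_bij_aux C hC a ha]
  have h0 := mu_ge_aux a
  unfold mu at h0
  rw [← Finset.sum_filter_add_sum_filter_not _
    (fun s : Finset α => (↑s : Set α) ⊆ {y | a < y} \ C)] at h0
  have h1 : mu α ({y | a < y} \ C) = ∑ s ∈ (Finset.univ.filter
      (fun s : Finset α => (↑s : Set α) ⊆ {y | a ≤ y} ∧ IsChain (· ≤ ·) (↑s : Set α))).filter
        (fun s : Finset α => (↑s : Set α) ⊆ {y | a < y} \ C), (-1 : ℤ) ^ (s.card + 1) := by
    unfold mu
    refine Finset.sum_congr ?_ fun _ _ => rfl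
    ext s
    simp only [Finset.mem_filter, Finset.mem_univ, true_and]
    constructor
    · rintro ⟨h, h'⟩
      exact ⟨⟨fun z hz => le_of_lt (h hz).1, h'⟩, h⟩
    · rintro ⟨⟨_, h'⟩, h⟩
      exact ⟨h, h'⟩
  rw [h1]
  linarith
end
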